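/- Let S be a multiplicative set of positive integers satisfying Condition B with density δ ∈ (0,1) and exponent ρ > 0. Then the Euler–Kronecker constant γ_S = lim_{s→1⁺} (L_S'(s)/L_S(s) + δ/(s−1)) exists, the Wirsing constant C_0(S) = (1/Γ(δ)) · lim_{P→∞} ∏_{p<P} (1 + χ_S(p)/p + χ_S(p²)/p² + …)(1 − 1/p)^δ exists and is positive, and as x → ∞ one has S(x) = C_0(S)·x·(log x)^{δ−1}·(1 + (1+o(1))·C_1(S)/log x), where C_1(S) = (1−δ)(1−γ_S); equivalently, (S(x)/(C_0(S)·x·(log x)^{δ−1}) − 1)·log x → C_1(S) as x → ∞. -/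

import Mathlib

open Filter Real
open scoped Classical

/-- A set of positive integers is *multiplicative* if `1 ∈ S` and for all coprime
positive integers `m, n` one has `m * n ∈ S ↔ m ∈ S ∧ n ∈ S`. -/
def IsMultiplicativeSet (S : Set ℕ) : Prop :=
  1 ∈ S ∧ ∀ m n : ℕ, 0 < m → 0 < n → Nat.Coprime m n → (m * n ∈ S ↔ m ∈ S ∧ n ∈ S)

/-- `S(x)`: the number of `n ≤ x` with `n ∈ S`. -/
noncomputable def setCount (S : Set ℕ) (x : ℝ) : ℕ :=
  {n : ℕ | 0 < n ∧ (n : ℝ) ≤ x ∧ n ∈ S}.ncard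

/-- `π_S(x)`: the number of primes `p ≤ x` with `p ∈ S`. -/
noncomputable def primeCount (S : Set ℕ) (x : ℝ) : ℕ :=
  {p : ℕ | p.Prime ∧ (p : ℝ) ≤ x ∧ p ∈ S}.ncard

/-- The characteristic function of `S`. -/
noncomputable def chiS (S : Set ℕ) (n : ℕ) : ℝ := if n ∈ S then 1 else 0

/-- The logarithmic integral `Li(x) = ∫₂ˣ dt / log t`. -/
noncomputable def Li (x : ℝ) : ℝ := ∫ t in (2:ℝ)..x, 1 / Real.log t

/-- Condition B with density `δ` and exponent `ρ`:
`π_S(x) = δ Li(x) + O(x / (log x)^{2+ρ})`. -/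
def ConditionB (S : Set ℕ) (δ ρ : ℝ) : Prop :=
  ∃ C : ℝ, ∀ x : ℝ, 2 ≤ x →
    |(primeCount S x : ℝ) - δ * Li x| ≤ C * x / Real.log x ^ (2 + ρ)

/-- The Dirichlet series `L_S(s) = ∑_{n ∈ S} n^{-s}` of `S` (as a function of a real
variable `s`). -/
noncomputable def LSeries' (S : Set ℕ) (s : ℝ) : ℝ :=
  ∑' n : ℕ, if n ∈ S then (n : ℝ) ^ (-s) else 0

/-- `γS` is the Euler–Kronecker constant of `S` (with density `δ`), i.e.
`L_S'(s)/L_S(s) + δ/(s-1) → γS` as `s → 1⁺`. -/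
def IsEulerKronecker (S : Set ℕ) (δ γS : ℝ) : Prop :=
  Tendsto (fun s : ℝ => deriv (LSeries' S) s / LSeries' S s + δ / (s - 1))
    (nhdsWithin 1 (Set.Ioi 1)) (nhds γS)

/-- The partial Euler-type product
`∏_{p < P, p prime} (1 + χ_S(p)/p + χ_S(p²)/p² + …) (1 - 1/p)^δ`. -/
noncomputable def wirsingProd (S : Set ℕ) (δ : ℝ) (P : ℕ) : ℝ :=
  ∏ p ∈ Finset.filter Nat.Prime (Finset.range P),
    (∑' e : ℕ, chiS S (p ^ e) / (p : ℝ) ^ e) * (1 - 1 / (p : ℝ)) ^ δ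

/-- The summatory function of `a` on a logarithmic scale: `∑_{1 ≤ n ≤ e^u} a n`. -/
noncomputable def logSum (a : ℕ → ℝ) (u : ℝ) : ℝ :=
  ∑ n ∈ Finset.Icc 1 ⌊exp u⌋₊, a n

/-- The normalised counting function `S(e^u) e^{-u}`. -/
noncomputable def dens (S : Set ℕ) (u : ℝ) : ℝ := logSum (chiS S) u * exp (-u)

/-- The integral of `dens S` over `[0, u]`. -/
noncomputable def densInt (S : Set ℕ) (u : ℝ) : ℝ := ∫ v in (0:ℝ)..u, dens S v

/-- The logarithmic mean `∑_{n ≤ e^u, n ∈ S} 1/n`. -/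
noncomputable def logMean (S : Set ℕ) (u : ℝ) : ℝ := logSum (fun n => chiS S n / n) u

/-- The weight `log p` on the primes `p ∈ S`. -/
noncomputable def primeWeight (S : Set ℕ) (n : ℕ) : ℝ :=
  if n.Prime then chiS S n * log n else 0

lemma mem_Icc_floor_exp {n : ℕ} {u : ℝ} :
    n ∈ Finset.Icc 1 ⌊exp u⌋₊ ↔ 1 ≤ n ∧ log n ≤ u := by
  rw [Finset.mem_Icc]
  refine and_congr_right fun h => ?_
  have hn : (0:ℝ) < n := by exact_mod_cast h
  rw [Nat.le_floor_iff (exp_pos u).le, Real.log_le_iff_le_exp hn]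

lemma logSum_eq_sum_ite (a : ℕ → ℝ) {u w : ℝ} (h : w ≤ u) :
    logSum a w = ∑ n ∈ Finset.Icc 1 ⌊exp u⌋₊, if log n ≤ w then a n else 0 := by
  rw [logSum, ← Finset.sum_filter]
  refine Finset.sum_congr ?_ fun _ _ => rfl
  ext n
  simp only [Finset.mem_filter, mem_Icc_floor_exp]
  constructor
  · rintro ⟨h1, h2⟩; exact ⟨⟨h1, h2.trans h⟩, h2⟩
  · rintro ⟨⟨h1, _⟩, h2⟩; exact ⟨h1, h2⟩

lemma logSum_nonneg {a : ℕ → ℝ} (ha : ∀ n, 0 ≤ a n) (u : ℝ) : 0 ≤ logSum a u :=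
  Finset.sum_nonneg fun n _ => ha n

lemma logSum_mono {a : ℕ → ℝ} (ha : ∀ n, 0 ≤ a n) : Monotone (logSum a) := by
  intro u v h
  refine Finset.sum_le_sum_of_subset_of_nonneg ?_ fun n _ _ => ha n
  intro n hn
  rw [mem_Icc_floor_exp] at hn ⊢
  exact ⟨hn.1, hn.2.trans h⟩

lemma logSum_of_neg (a : ℕ → ℝ) {u : ℝ} (hu : u < 0) : logSum a u = 0 := by
  have : ⌊exp u⌋₊ = 0 := Nat.floor_eq_zero.2 (by simpa using hu)
  simp [logSum, this]

/-- Partial summation on the logarithmic scale. -/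
lemma integral_logSum_mul {a : ℕ → ℝ} {u : ℝ} (hu : 0 ≤ u) {g : ℝ → ℝ}
    (hg : Continuous g) :
    ∫ v in (0:ℝ)..u, logSum a v * g v =
      ∑ n ∈ Finset.Icc 1 ⌊exp u⌋₊, a n * ∫ v in (log n)..u, g v := by
  have key : ∀ n ∈ Finset.Icc 1 ⌊exp u⌋₊,
      IntervalIntegrable (fun v => (Set.Ici (log n)).indicator (fun v => a n * g v) v)
        MeasureTheory.volume 0 u ∧
      ∫ v in (0:ℝ)..u, (Set.Ici (log n)).indicator (fun v => a n * g v) v =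
        a n * ∫ v in (log n)..u, g v := by
    intro n hn
    rw [mem_Icc_floor_exp] at hn
    have h0 : 0 ≤ log n := log_natCast_nonneg n
    constructor
    · rw [intervalIntegrable_iff]
      exact (((continuous_const.mul hg).intervalIntegrable 0 u).def').indicator measurableSet_Ici
    · rw [intervalIntegral.integral_of_le hu, intervalIntegral.integral_of_le hn.2,
        MeasureTheory.setIntegral_indicator measurableSet_Ici,
        ← MeasureTheory.integral_const_mul]
      apply MeasureTheory.setIntegral_congr_set
      have h1 : (Set.Ioc 0 u ∩ Set.Ici (log n) : Set ℝ) =ᵐ[MeasureTheory.volume]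
          (Set.Ioc 0 u ∩ Set.Ioi (log n) : Set ℝ) :=
        MeasureTheory.ae_eq_set_inter (Filter.EventuallyEq.refl _ _)
          MeasureTheory.Ioi_ae_eq_Ici.symm
      refine h1.trans (Filter.EventuallyEq.of_eq (Set.ext fun v => ?_))
      simp only [Set.mem_inter_iff, Set.mem_Ioc, Set.mem_Ioi]
      constructor
      · rintro ⟨⟨_, h⟩, h'⟩; exact ⟨h', h⟩
      · rintro ⟨h', h⟩; exact ⟨⟨h0.trans_lt h', h⟩, h'⟩
  rw [← Finset.sum_congr rfl fun n hn => (key n hn).2,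
    ← intervalIntegral.integral_finsetSum fun n hn => (key n hn).1]
  refine intervalIntegral.integral_congr fun v hv => ?_
  rw [Set.uIcc_of_le hu] at hv
  rw [logSum_eq_sum_ite a hv.2, Finset.sum_mul]
  refine Finset.sum_congr rfl fun n _ => ?_
  by_cases h : log n ≤ v <;> simp [Set.indicator, h]

lemma sum_mul_logSum_comm (a b : ℕ → ℝ) (u : ℝ) :
    ∑ n ∈ Finset.Icc 1 ⌊exp u⌋₊, a n * logSum b (u - log n) =
      ∑ n ∈ Finset.Icc 1 ⌊exp u⌋₊, b n * logSum a (u - log n) := by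
  have key : ∀ c d : ℕ → ℝ, ∀ n, c n * logSum d (u - log n) =
      ∑ m ∈ Finset.Icc 1 ⌊exp u⌋₊, if log n + log m ≤ u then c n * d m else 0 := by
    intro c d n
    rw [logSum_eq_sum_ite d (by linarith [log_natCast_nonneg n] : u - log n ≤ u),
      Finset.mul_sum]
    refine Finset.sum_congr rfl fun m _ => ?_
    by_cases h : log m ≤ u - log n
    · rw [if_pos h, if_pos (by linarith)]
    · rw [if_neg h, if_neg (by intro h'; apply h; linarith), mul_zero]
  simp_rw [key]
  rw [Finset.sum_comm]
  refine Finset.sum_congr rfl fun n _ => Finset.sum_congr rfl fun m _ => ?_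
  rw [add_comm, mul_comm]

/-- The convolution swap restricted to `log n > V` in one variable. -/
lemma sum_filter_mul_logSum (a b : ℕ → ℝ) {u V : ℝ} (hV : 0 ≤ V) :
    ∑ n ∈ (Finset.Icc 1 ⌊exp u⌋₊).filter (fun n : ℕ => V < log n),
        b n * logSum a (u - log n) =
      ∑ m ∈ Finset.Icc 1 ⌊exp (u - V)⌋₊, a m * (logSum b (u - log m) - logSum b V) := by
  have h1 := sum_mul_logSum_comm (fun n => if V < log n then b n else 0) a u
  have h2 : ∀ w, logSum (fun n => if V < log n then b n else 0) w =
      if V ≤ w then logSum b w - logSum b V else 0 := by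
    intro w
    split_ifs with h
    · rw [logSum_eq_sum_ite b h, logSum, logSum, ← Finset.sum_sub_distrib]
      refine Finset.sum_congr rfl fun n _ => ?_
      by_cases hn : V < log n
      · simp [hn, not_le.2 hn]
      · simp [hn, not_lt.1 hn]
    · refine Finset.sum_eq_zero fun n hn => ?_
      rw [mem_Icc_floor_exp] at hn
      rw [if_neg]
      linarith [hn.2, not_le.1 h]
  rw [Finset.sum_filter]
  calc _ = ∑ n ∈ Finset.Icc 1 ⌊exp u⌋₊,
        (if V < log n then b n else 0) * logSum a (u - log n) :=
        Finset.sum_congr rfl fun n _ => by split_ifs <;> simp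
    _ = _ := h1
    _ = ∑ m ∈ Finset.Icc 1 ⌊exp u⌋₊,
        if log m ≤ u - V then a m * (logSum b (u - log m) - logSum b V) else 0 := by
        refine Finset.sum_congr rfl fun m _ => ?_
        rw [h2]
        by_cases h : log m ≤ u - V
        · rw [if_pos h, if_pos (by linarith)]
        · rw [if_neg h, if_neg (by intro h'; apply h; linarith), mul_zero]
    _ = _ := (logSum_eq_sum_ite (fun m => a m * (logSum b (u - log m) - logSum b V))
        (by linarith : u - V ≤ u)).symm

lemma chiS_nonneg (S : Set ℕ) (n : ℕ) : 0 ≤ chiS S n := by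
  unfold chiS; split_ifs <;> norm_num

lemma chiS_le_one (S : Set ℕ) (n : ℕ) : chiS S n ≤ 1 := by
  unfold chiS; split_ifs <;> norm_num

lemma primeWeight_nonneg (S : Set ℕ) (n : ℕ) : 0 ≤ primeWeight S n := by
  unfold primeWeight
  split_ifs
  · exact mul_nonneg (chiS_nonneg S n) (log_natCast_nonneg n)
  · exact le_rfl

lemma dens_nonneg (S : Set ℕ) (u : ℝ) : 0 ≤ dens S u :=
  mul_nonneg (logSum_nonneg (chiS_nonneg S) u) (exp_pos _).le

lemma dens_of_neg (S : Set ℕ) {u : ℝ} (hu : u < 0) : dens S u = 0 := by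
  simp [dens, logSum_of_neg _ hu]

lemma logSum_chiS_le (S : Set ℕ) (u : ℝ) : logSum (chiS S) u ≤ exp u := by
  calc logSum (chiS S) u ≤ ∑ n ∈ Finset.Icc 1 ⌊exp u⌋₊, (1:ℝ) :=
        Finset.sum_le_sum fun n _ => chiS_le_one S n
    _ = ⌊exp u⌋₊ := by simp
    _ ≤ exp u := Nat.floor_le (exp_pos u).le

lemma dens_le_one (S : Set ℕ) (u : ℝ) : dens S u ≤ 1 := by
  calc dens S u ≤ exp u * exp (-u) :=
        mul_le_mul_of_nonneg_right (logSum_chiS_le S u) (exp_pos _).le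
    _ = 1 := by rw [← exp_add]; simp

lemma measurable_dens (S : Set ℕ) : Measurable (dens S) :=
  (logSum_mono (chiS_nonneg S)).measurable.mul (by fun_prop)

lemma intervalIntegrable_dens (S : Set ℕ) (a b : ℝ) :
    IntervalIntegrable (dens S) MeasureTheory.volume a b :=
  (logSum_mono (chiS_nonneg S)).intervalIntegrable.mul_continuousOn (by fun_prop)

lemma logMean_nonneg (S : Set ℕ) (u : ℝ) : 0 ≤ logMean S u :=
  logSum_nonneg (fun n => div_nonneg (chiS_nonneg S n) n.cast_nonneg) u

lemma logMean_mono (S : Set ℕ) : Monotone (logMean S) :=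
  logSum_mono fun n => div_nonneg (chiS_nonneg S n) n.cast_nonneg

lemma exp_neg_log_natCast {n : ℕ} (hn : 1 ≤ n) : exp (-log n) = (n:ℝ)⁻¹ := by
  rw [exp_neg, exp_log (by exact_mod_cast hn)]

lemma integral_exp_neg (a b : ℝ) : ∫ v in a..b, exp (-v) = exp (-a) - exp (-b) := by
  have := intervalIntegral.integral_comp_neg (a := a) (b := b) (fun v => exp v)
  simp only [this, integral_exp]

lemma densInt_eq (S : Set ℕ) {u : ℝ} (hu : 0 ≤ u) : densInt S u = logMean S u - dens S u := by
  unfold densInt dens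
  rw [integral_logSum_mul hu (by fun_prop), logMean, logSum, logSum, Finset.sum_mul,
    ← Finset.sum_sub_distrib]
  refine Finset.sum_congr rfl fun n hn => ?_
  rw [mem_Icc_floor_exp] at hn
  rw [integral_exp_neg, exp_neg_log_natCast hn.1, div_eq_mul_inv, mul_sub]

lemma densInt_le_logMean (S : Set ℕ) {u : ℝ} (hu : 0 ≤ u) : densInt S u ≤ logMean S u := by
  rw [densInt_eq S hu]; linarith [dens_nonneg S u]

lemma densInt_nonneg (S : Set ℕ) {u : ℝ} (hu : 0 ≤ u) : 0 ≤ densInt S u :=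
  intervalIntegral.integral_nonneg hu fun v _ => dens_nonneg S v

lemma dens_le_logMean (S : Set ℕ) (u : ℝ) : dens S u ≤ logMean S u := by
  rcases lt_or_ge u 0 with h | h
  · rw [dens_of_neg S h]; exact logMean_nonneg S u
  · linarith [densInt_eq S h, densInt_nonneg S h]

/-- `dens S` is right-continuous. -/
lemma continuousWithinAt_dens (S : Set ℕ) (u : ℝ) :
    ContinuousWithinAt (dens S) (Set.Ici u) u := by
  have h1 : ContinuousWithinAt (logSum (chiS S)) (Set.Ici u) u := by
    have h2 : ∀ᶠ x in nhds (exp u), x < (⌊exp u⌋₊ : ℝ) + 1 :=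
      eventually_lt_nhds (Nat.lt_floor_add_one _)
    have h3 : ∀ᶠ v in nhds u, exp v < (⌊exp u⌋₊ : ℝ) + 1 :=
      continuous_exp.continuousAt.eventually h2
    refine ContinuousWithinAt.congr_of_eventuallyEq
      (f := fun _ => logSum (chiS S) u) continuousWithinAt_const ?_ rfl
    filter_upwards [h3.filter_mono nhdsWithin_le_nhds, self_mem_nhdsWithin] with v hv hv'
    have : ⌊exp v⌋₊ = ⌊exp u⌋₊ := by
      rw [Nat.floor_eq_iff (exp_pos v).le]
      exact ⟨(Nat.floor_le (exp_pos u).le).trans (exp_le_exp.2 hv'), hv⟩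
    simp [logSum, this]
  exact h1.mul (by fun_prop)

lemma hasDerivWithinAt_densInt (S : Set ℕ) (u : ℝ) :
    HasDerivWithinAt (densInt S) (dens S u) (Set.Ici u) u := by
  have hm : StronglyMeasurableAtFilter (dens S) (nhdsWithin u (Set.Ioi u))
      MeasureTheory.volume :=
    (measurable_dens S).stronglyMeasurable.stronglyMeasurableAtFilter
  exact intervalIntegral.integral_hasDerivWithinAt_right (intervalIntegrable_dens S 0 u) hm
    ((continuousWithinAt_dens S u).mono Set.Ioi_subset_Ici_self)

lemma continuous_densInt (S : Set ℕ) : Continuous (densInt S) :=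
  intervalIntegral.continuous_primitive (intervalIntegrable_dens S) 0

lemma one_add_rpow_le_exp_half {k t : ℝ} (hk : 1 ≤ k) (ht : 0 ≤ t) :
    (1 + t) ^ k ≤ (2 * k) ^ k * exp (t / 2) := by
  have h1 : 1 + t ≤ 2 * k * exp (t / (2 * k)) := by
    have := add_one_le_exp (t / (2 * k))
    have h2 : 2 * k * (t / (2 * k) + 1) = t + 2 * k := by field_simp
    nlinarith
  calc (1 + t) ^ k ≤ (2 * k * exp (t / (2 * k))) ^ k :=
        rpow_le_rpow (by linarith) h1 (by linarith)
    _ = (2 * k) ^ k * exp (t / 2) := by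
        rw [mul_rpow (by linarith) (exp_pos _).le, ← exp_mul]
        congr 2
        field_simp

/-- `e^v (1+v)^{-k}` grows at least like `e^{v/2}`, up to a constant. -/
lemma exp_mul_rpow_neg_le {k v u : ℝ} (hk : 1 ≤ k) (hv : 0 ≤ v) (hvu : v ≤ u) :
    exp v * (1 + v) ^ (-k) ≤
      (2 * k) ^ k * (exp (u / 2) * (1 + u) ^ (-k)) * exp (v / 2) := by
  have h1 : 1 + u ≤ (1 + v) * (1 + (u - v)) := by nlinarith
  have h2 : (1 + u) ^ k ≤ (1 + v) ^ k * ((2 * k) ^ k * exp ((u - v) / 2)) := by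
    calc (1 + u) ^ k ≤ ((1 + v) * (1 + (u - v))) ^ k :=
          rpow_le_rpow (by linarith) h1 (by linarith)
      _ = (1 + v) ^ k * (1 + (u - v)) ^ k := mul_rpow (by linarith) (by linarith)
      _ ≤ _ := mul_le_mul_of_nonneg_left (one_add_rpow_le_exp_half hk (by linarith))
          (rpow_nonneg (by linarith) _)
  have hu0 : 0 < (1 + u) ^ k := rpow_pos_of_pos (by linarith) _
  have hv0 : 0 < (1 + v) ^ k := rpow_pos_of_pos (by linarith) _
  rw [rpow_neg (by linarith), rpow_neg (by linarith), ← div_eq_mul_inv, div_le_iff₀ hv0]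
  have e1 : exp v = exp (v / 2) * exp (u / 2) * (exp ((u - v) / 2))⁻¹ := by
    rw [← exp_neg, ← exp_add, ← exp_add]; congr 1; ring
  have e2 : (exp ((u - v) / 2))⁻¹ ≤ (2 * k) ^ k * ((1 + u) ^ k)⁻¹ * (1 + v) ^ k := by
    have hE := exp_pos ((u - v) / 2)
    rw [inv_le_iff_one_le_mul₀ hE]
    calc (1:ℝ) = ((1 + u) ^ k)⁻¹ * (1 + u) ^ k := (inv_mul_cancel₀ hu0.ne').symm
      _ ≤ ((1 + u) ^ k)⁻¹ * ((1 + v) ^ k * ((2 * k) ^ k * exp ((u - v) / 2))) :=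
          mul_le_mul_of_nonneg_left h2 (inv_nonneg.2 hu0.le)
      _ = _ := by ring
  rw [e1]
  calc exp (v / 2) * exp (u / 2) * (exp ((u - v) / 2))⁻¹
      ≤ exp (v / 2) * exp (u / 2) * ((2 * k) ^ k * ((1 + u) ^ k)⁻¹ * (1 + v) ^ k) :=
        mul_le_mul_of_nonneg_left e2 (by positivity)
    _ = _ := by ring

lemma primeCount_exp (S : Set ℕ) (u : ℝ) :
    (primeCount S (exp u) : ℝ) = logSum (fun n => if n.Prime then chiS S n else 0) u := by
  have : {p : ℕ | p.Prime ∧ (p : ℝ) ≤ exp u ∧ p ∈ S} =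
      ((Finset.Icc 1 ⌊exp u⌋₊).filter (fun n => n.Prime ∧ n ∈ S) : Finset ℕ) := by
    ext p
    simp only [Set.mem_ofPred_eq, Finset.coe_filter, Finset.mem_Icc]
    rw [Nat.le_floor_iff (exp_pos u).le]
    constructor
    · rintro ⟨h1, h2, h3⟩; exact ⟨⟨h1.one_le, h2⟩, h1, h3⟩
    · rintro ⟨⟨_, h2⟩, h1, h3⟩; exact ⟨h1, h2, h3⟩
  rw [primeCount, this, Set.ncard_coe_finset, Finset.card_filter, logSum]
  push_cast
  refine Finset.sum_congr rfl fun n _ => ?_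
  by_cases h1 : n.Prime <;> by_cases h2 : n ∈ S <;> simp [chiS, h1, h2]

lemma setCount_exp (S : Set ℕ) (u : ℝ) :
    (setCount S (exp u) : ℝ) = logSum (chiS S) u := by
  have : {n : ℕ | 0 < n ∧ (n : ℝ) ≤ exp u ∧ n ∈ S} =
      ((Finset.Icc 1 ⌊exp u⌋₊).filter (fun n => n ∈ S) : Finset ℕ) := by
    ext p
    simp only [Set.mem_ofPred_eq, Finset.coe_filter, Finset.mem_Icc]
    rw [Nat.le_floor_iff (exp_pos u).le]
    constructor
    · rintro ⟨h1, h2, h3⟩; exact ⟨⟨h1, h2⟩, h3⟩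
    · rintro ⟨⟨h1, h2⟩, h3⟩; exact ⟨h1, h2, h3⟩
  rw [setCount, this, Set.ncard_coe_finset, Finset.card_filter, logSum]
  push_cast
  rfl

lemma hasDerivAt_Li_exp {v : ℝ} (hv : 0 < v) :
    HasDerivAt (fun v => Li (exp v)) (exp v / v) v := by
  have hx : 1 < exp v := by rwa [one_lt_exp_iff]
  have hc : ContinuousOn (fun t : ℝ => 1 / log t) (Set.Ioi 1) := by
    refine continuousOn_const.div (continuousOn_log.mono ?_) ?_
    · intro t ht; simp only [Set.mem_Ioi] at ht; simp; linarith
    · intro t ht; exact (log_pos ht).ne'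
  have hsub : Set.uIcc 2 (exp v) ⊆ Set.Ioi 1 := by
    intro t ht
    rw [Set.mem_uIcc] at ht
    simp only [Set.mem_Ioi]
    rcases ht with h | h <;> linarith
  have h1 : HasDerivAt Li (1 / log (exp v)) (exp v) := by
    refine intervalIntegral.integral_hasDerivAt_right
      (hc.mono hsub).intervalIntegrable ?_ (hc.continuousAt (Ioi_mem_nhds hx))
    exact hc.stronglyMeasurableAtFilter isOpen_Ioi _ hx
  have h2 := h1.comp v (Real.hasDerivAt_exp v)
  rw [log_exp, one_div_mul_eq_div] at h2
  exact h2

lemma integral_Li_exp {u : ℝ} (hu : log 2 ≤ u) :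
    ∫ v in (log 2)..u, Li (exp v) = u * Li (exp u) - (exp u - 2) := by
  have hl : 0 < log 2 := log_pos (by norm_num)
  have hd : ∀ v ∈ Set.uIcc (log 2) u,
      HasDerivAt (fun v => v * Li (exp v) - exp v) (Li (exp v)) v := by
    intro v hv
    rw [Set.uIcc_of_le hu] at hv
    have hv0 : 0 < v := hl.trans_le hv.1
    have := ((hasDerivAt_id v).mul (hasDerivAt_Li_exp hv0)).sub (Real.hasDerivAt_exp v)
    exact this.congr_deriv (by rw [one_mul, id, mul_div_cancel₀ _ hv0.ne']; ring)
  have hcont : ContinuousOn (fun v => Li (exp v)) (Set.uIcc (log 2) u) := by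
    intro v hv
    rw [Set.uIcc_of_le hu] at hv
    exact (hasDerivAt_Li_exp (hl.trans_le hv.1)).continuousAt.continuousWithinAt
  rw [intervalIntegral.integral_eq_sub_of_hasDerivAt hd hcont.intervalIntegrable]
  have : Li 2 = 0 := by simp [Li]
  rw [exp_log (by norm_num), this]
  ring

/-- Partial summation relating `θ_S` and `π_S`. -/
lemma logSum_primeWeight_eq (S : Set ℕ) {u : ℝ} (hu : 0 ≤ u) :
    logSum (primeWeight S) u = u * primeCount S (exp u) -
      ∫ v in (0:ℝ)..u, (primeCount S (exp v) : ℝ) := by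
  simp_rw [primeCount_exp]
  have h := integral_logSum_mul (a := fun n => if n.Prime then chiS S n else 0) hu
    (g := fun _ => 1) continuous_const
  simp only [mul_one, intervalIntegral.integral_const, smul_eq_mul] at h
  rw [h, logSum, logSum, Finset.mul_sum, ← Finset.sum_sub_distrib]
  refine Finset.sum_congr rfl fun n _ => ?_
  unfold primeWeight
  split_ifs <;> ring

lemma abs_logSum_primeWeight_sub_le {S : Set ℕ} {δ ρ : ℝ} (hρ : 0 < ρ)
    (hB : ConditionB S δ ρ) :
    ∃ C : ℝ, 0 ≤ C ∧ ∀ u : ℝ, 0 ≤ u →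
      |logSum (primeWeight S) u - δ * exp u| ≤ C * (exp u * (1 + u) ^ (-(1 + ρ))) := by
  obtain ⟨C₀, hC₀⟩ := hB
  have hl : 0 < log 2 := log_pos (by norm_num)
  set c : ℝ := (1 + log 2) / log 2 with hc
  have hcpos : 0 < c := by positivity
  set k : ℝ := 2 + ρ with hk
  set B : ℝ := (2 * k) ^ k with hBdef
  have hBpos : 0 < B := by positivity
  set C₁ : ℝ := |C₀| * c ^ k with hC₁
  have hC₁0 : 0 ≤ C₁ := by positivity
  have hr : ∀ v, log 2 ≤ v → |(primeCount S (exp v) : ℝ) - δ * Li (exp v)| ≤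
      C₁ * (exp v * (1 + v) ^ (-k)) := by
    intro v hv
    have hv0 : 0 < v := hl.trans_le hv
    have h := hC₀ (exp v) (by rwa [← log_le_iff_le_exp (by norm_num)])
    rw [log_exp] at h
    refine h.trans ?_
    have h2 : (1 + v) ^ k ≤ c ^ k * v ^ k := by
      rw [← mul_rpow hcpos.le hv0.le]
      refine rpow_le_rpow (by linarith) ?_ (by linarith)
      rw [hc, div_mul_eq_mul_div, le_div_iff₀ hl]; nlinarith
    have h3 : 0 < v ^ k := rpow_pos_of_pos hv0 _
    have h4 : 0 < (1 + v) ^ k := rpow_pos_of_pos (by linarith) _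
    rw [rpow_neg (by linarith), hC₁, ← div_eq_mul_inv, ← mul_div_assoc, div_le_div_iff₀ h3 h4]
    calc C₀ * exp v * (1 + v) ^ k ≤ |C₀| * exp v * (c ^ k * v ^ k) := by
          refine mul_le_mul ?_ h2 h4.le (by positivity)
          exact mul_le_mul_of_nonneg_right (le_abs_self _) (exp_pos _).le
      _ = _ := by ring
  have hint : ∀ a b, IntervalIntegrable (fun v => (primeCount S (exp v) : ℝ))
      MeasureTheory.volume a b := by
    intro a b
    simp_rw [primeCount_exp]
    exact (logSum_mono fun n => by split_ifs <;> simp [chiS_nonneg]).intervalIntegrable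
  have hsmall : ∀ u : ℝ, 0 ≤ u → 1 ≤ B * (exp u * (1 + u) ^ (-(1 + ρ))) := by
    intro u hu
    have h1 : (1 + u) ^ (1 + ρ) ≤ B * exp u := by
      calc (1 + u) ^ (1 + ρ) ≤ (1 + u) ^ k :=
            rpow_le_rpow_of_exponent_le (by linarith) (by linarith)
        _ ≤ B * exp (u / 2) := one_add_rpow_le_exp_half (by linarith) hu
        _ ≤ B * exp u := mul_le_mul_of_nonneg_left (exp_le_exp.2 (by linarith)) hBpos.le
    rw [rpow_neg (by linarith), ← mul_assoc, ← div_eq_mul_inv,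
      le_div_iff₀ (rpow_pos_of_pos (by linarith) _), one_mul]
    exact h1
  refine ⟨2 * |δ| * B + C₁ + 2 * (C₁ * B), by positivity, fun u hu => ?_⟩
  set W := exp u * (1 + u) ^ (-(1 + ρ)) with hW
  have hWpos : 0 < W := mul_pos (exp_pos _) (rpow_pos_of_pos (by linarith) _)
  rcases lt_or_ge u (log 2) with hlt | hge
  · have h0 : logSum (primeWeight S) u = 0 := by
      refine Finset.sum_eq_zero fun n hn => ?_
      rw [mem_Icc_floor_exp] at hn
      unfold primeWeight
      rw [if_neg]
      intro hp
      have : log 2 ≤ log n := log_le_log (by norm_num) (by exact_mod_cast hp.two_le)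
      linarith [hn.2]
    have hexp : exp u ≤ 2 := by
      rw [← le_log_iff_exp_le (by norm_num)]; exact hlt.le
    rw [h0, zero_sub, abs_neg, abs_mul, abs_of_pos (exp_pos u)]
    calc |δ| * exp u ≤ |δ| * 2 * (B * W) := by
          have := hsmall u hu
          nlinarith [abs_nonneg δ, mul_le_mul_of_nonneg_left hexp (abs_nonneg δ)]
      _ ≤ _ := by nlinarith [mul_nonneg hC₁0 hBpos.le]
  · have hz : ∫ v in (0:ℝ)..(log 2), (primeCount S (exp v) : ℝ) = 0 := by
      rw [intervalIntegral.integral_of_le hl.le, ← MeasureTheory.integral_Ioc_eq_integral_Ioo.symm]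
      refine MeasureTheory.setIntegral_eq_zero_of_forall_eq_zero fun v hv => ?_
      rw [primeCount_exp]
      refine Finset.sum_eq_zero fun n hn => ?_
      rw [mem_Icc_floor_exp] at hn
      rw [if_neg]
      intro hp
      have : log 2 ≤ log n := log_le_log (by norm_num) (by exact_mod_cast hp.two_le)
      linarith [hn.2, hv.2]
    have hLi : IntervalIntegrable (fun v => δ * Li (exp v)) MeasureTheory.volume (log 2) u := by
      refine ContinuousOn.intervalIntegrable fun v hv => ?_
      rw [Set.uIcc_of_le hge] at hv
      exact ((hasDerivAt_Li_exp (hl.trans_le hv.1)).continuousAt.const_mul δ).continuousWithinAt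
    have e1 : logSum (primeWeight S) u - δ * exp u =
        -(2 * δ) + u * ((primeCount S (exp u) : ℝ) - δ * Li (exp u)) -
          ∫ v in (log 2)..u, ((primeCount S (exp v) : ℝ) - δ * Li (exp v)) := by
      rw [logSum_primeWeight_eq S hu, intervalIntegral.integral_sub (hint _ _) hLi,
        intervalIntegral.integral_const_mul, integral_Li_exp hge,
        ← intervalIntegral.integral_add_adjacent_intervals (hint 0 (log 2)) (hint _ _), hz]
      ring
    have b1 : |u * ((primeCount S (exp u) : ℝ) - δ * Li (exp u))| ≤ C₁ * W := by
      rw [abs_mul, abs_of_nonneg hu]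
      calc u * _ ≤ (1 + u) * (C₁ * (exp u * (1 + u) ^ (-k))) :=
            mul_le_mul (by linarith) (hr u hge) (abs_nonneg _) (by linarith)
        _ = C₁ * W := by
            rw [hW, show -(1 + ρ) = -k + 1 by rw [hk]; ring, rpow_add_one (by linarith)]
            ring
    have b2 : |∫ v in (log 2)..u, ((primeCount S (exp v) : ℝ) - δ * Li (exp v))| ≤
        2 * (C₁ * B) * W := by
      have hb : ∀ v ∈ Set.Ioc (log 2) u, ‖(primeCount S (exp v) : ℝ) - δ * Li (exp v)‖ ≤
          C₁ * (B * (exp (u / 2) * (1 + u) ^ (-k))) * exp (v / 2) := by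
        intro v hv
        refine (hr v hv.1.le).trans ?_
        rw [mul_assoc C₁]
        exact mul_le_mul_of_nonneg_left
          (exp_mul_rpow_neg_le (by linarith) (hl.trans hv.1).le hv.2) hC₁0
      have := intervalIntegral.norm_integral_le_of_norm_le hge
        (μ := MeasureTheory.volume) (Filter.Eventually.of_forall hb)
        (Continuous.intervalIntegrable (by fun_prop) _ _)
      rw [Real.norm_eq_abs] at this
      refine this.trans ?_
      rw [intervalIntegral.integral_const_mul]
      have hi : ∫ v in (log 2)..u, exp (v / 2) ≤ 2 * exp (u / 2) := by
        rw [intervalIntegral.integral_comp_div (fun v => exp v) (by norm_num), integral_exp,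
          smul_eq_mul]
        linarith [exp_pos (log 2 / 2)]
      have hP : 0 ≤ (1 + u) ^ (-k) := rpow_nonneg (by linarith) _
      calc C₁ * (B * (exp (u / 2) * (1 + u) ^ (-k))) * ∫ v in (log 2)..u, exp (v / 2)
          ≤ C₁ * (B * (exp (u / 2) * (1 + u) ^ (-k))) * (2 * exp (u / 2)) :=
            mul_le_mul_of_nonneg_left hi (by positivity)
        _ = 2 * (C₁ * B) * ((exp (u / 2) * exp (u / 2)) * (1 + u) ^ (-k)) := by ring
        _ ≤ 2 * (C₁ * B) * W := by
            rw [← exp_add, add_halves]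
            refine mul_le_mul_of_nonneg_left ?_ (by positivity)
            refine mul_le_mul_of_nonneg_left ?_ (exp_pos _).le
            exact rpow_le_rpow_of_exponent_le (by linarith) (by linarith)
    have b0 : |-(2 * δ)| ≤ 2 * |δ| * B * W := by
      rw [abs_neg, abs_mul, abs_of_pos (by norm_num : (0:ℝ) < 2)]
      have := hsmall u hu
      nlinarith [abs_nonneg δ]
    rw [e1]
    calc _ ≤ |-(2 * δ)| + |u * ((primeCount S (exp u) : ℝ) - δ * Li (exp u))| +
          |∫ v in (log 2)..u, ((primeCount S (exp v) : ℝ) - δ * Li (exp v))| :=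
          (abs_sub _ _).trans (add_le_add (abs_add_le _ _) le_rfl)
      _ ≤ _ := by linarith

/-- The elements of `S` not divisible by `p`. -/
def coprimePart (S : Set ℕ) (p : ℕ) : Set ℕ := {n | n ∈ S ∧ ¬ p ∣ n}

/-- The coefficient of the prime power `p ^ (k + 2)` in the decomposition of
`∑_{n ≤ x, n ∈ S} log n`. -/
noncomputable def remCoeff (S : Set ℕ) (p k : ℕ) : ℝ :=
  if p.Prime then (((k:ℝ) + 2) * chiS S (p ^ (k + 2)) - chiS S p * chiS S (p ^ (k + 1))) * log p
  else 0

/-- The normalised contribution of `p ^ (k + 2)` to `∑_{n ≤ e^u, n ∈ S} log n`. -/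
noncomputable def remTerm (S : Set ℕ) (u : ℝ) (q : ℕ × ℕ) : ℝ :=
  remCoeff S q.1 q.2 / (q.1:ℝ) ^ (q.2 + 2) *
    dens (coprimePart S q.1) (u - ((q.2:ℝ) + 2) * log q.1)

lemma chiS_coprimePart (S : Set ℕ) (p n : ℕ) :
    chiS (coprimePart S p) n = if ¬ p ∣ n then chiS S n else 0 := by
  unfold chiS coprimePart
  by_cases h1 : n ∈ S <;> by_cases h2 : p ∣ n <;> simp [h1, h2]

lemma chiS_mul {S : Set ℕ} (hS : IsMultiplicativeSet S) {m n : ℕ} (hm : 0 < m) (hn : 0 < n)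
    (h : Nat.Coprime m n) : chiS S (m * n) = chiS S m * chiS S n := by
  unfold chiS
  have := hS.2 m n hm hn h
  by_cases h1 : m ∈ S <;> by_cases h2 : n ∈ S <;> simp [this, h1, h2]

lemma chiS_one {S : Set ℕ} (hS : IsMultiplicativeSet S) : chiS S 1 = 1 := by
  simp [chiS, hS.1]

/-- Splitting a sum over `S` according to the exact power of `p`. -/
lemma sum_chiS_mul_factorization {S : Set ℕ} (hS : IsMultiplicativeSet S) {p : ℕ}
    (hp : p.Prime) (w : ℕ → ℝ) (u : ℝ) {K : ℕ} (hK : ⌊exp u⌋₊ < K) :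
    ∑ n ∈ Finset.Icc 1 ⌊exp u⌋₊, chiS S n * w (n.factorization p) =
      ∑ e ∈ Finset.range K, w e * chiS S (p ^ e) *
        logSum (chiS (coprimePart S p)) (u - e * log p) := by
  rw [← Finset.sum_fiberwise_of_maps_to (t := Finset.range K)
    (g := fun n => n.factorization p)]
  · refine Finset.sum_congr rfl fun e _ => ?_
    have hpe : 0 < p ^ e := pow_pos hp.pos e
    have hlog : ∀ m : ℕ, 1 ≤ m → log ((p ^ e * m : ℕ) : ℝ) = e * log p + log m := by
      intro m hm
      have h1 : ((p:ℝ)) ^ e ≠ 0 := by exact_mod_cast hpe.ne'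
      have h2 : (m:ℝ) ≠ 0 := by exact_mod_cast (show m ≠ 0 by omega)
      rw [Nat.cast_mul, Nat.cast_pow, log_mul h1 h2, log_pow]
    rw [logSum, Finset.mul_sum]
    simp_rw [chiS_coprimePart, mul_ite, mul_zero]
    rw [← Finset.sum_filter]
    refine Finset.sum_nbij' (fun n => n / p ^ e) (fun m => p ^ e * m) ?_ ?_ ?_ ?_ ?_
    · intro n hn
      simp only [Finset.mem_filter, mem_Icc_floor_exp] at hn ⊢
      obtain ⟨⟨h1, h2⟩, h3⟩ := hn
      have hdvd : p ^ e ∣ n := h3 ▸ Nat.ordProj_dvd n p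
      obtain ⟨m, rfl⟩ := hdvd
      have hm : 1 ≤ m := Nat.pos_of_ne_zero (by rintro rfl; simp at h1)
      rw [hlog m hm] at h2
      rw [Nat.mul_div_cancel_left m hpe]
      refine ⟨⟨hm, by linarith⟩, ?_⟩
      have := Nat.not_dvd_ordCompl hp (n := p ^ e * m) (by omega)
      rwa [h3, Nat.mul_div_cancel_left m hpe] at this
    · intro m hm
      simp only [Finset.mem_filter, mem_Icc_floor_exp] at hm ⊢
      obtain ⟨⟨h1, h2⟩, h3⟩ := hm
      refine ⟨⟨Nat.mul_pos hpe h1, ?_⟩, ?_⟩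
      · rw [hlog m h1]; linarith
      · rw [Nat.factorization_mul hpe.ne' (by omega), hp.factorization_pow]
        simp [Nat.factorization_eq_zero_of_not_dvd h3]
    · intro n hn
      simp only [Finset.mem_filter] at hn
      exact Nat.mul_div_cancel' (hn.2 ▸ Nat.ordProj_dvd n p)
    · intro m _
      exact Nat.mul_div_cancel_left m hpe
    · intro n hn
      simp only [Finset.mem_filter, mem_Icc_floor_exp] at hn
      obtain ⟨⟨h1, h2⟩, h3⟩ := hn
      have hdvd : p ^ e ∣ n := h3 ▸ Nat.ordProj_dvd n p
      have hnd := Nat.not_dvd_ordCompl hp (n := n) (by omega)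
      rw [h3] at hnd ⊢
      obtain ⟨m, rfl⟩ := hdvd
      have hm : 1 ≤ m := Nat.pos_of_ne_zero (by rintro rfl; simp at h1)
      rw [Nat.mul_div_cancel_left m hpe] at hnd ⊢
      rw [chiS_mul hS hpe hm (Nat.Coprime.pow_left e ((Nat.Prime.coprime_iff_not_dvd hp).2 hnd))]
      ring
  · intro n hn
    rw [Finset.mem_Icc] at hn
    rw [Finset.mem_range]
    have := Nat.factorization_lt (n := n) p (by omega)
    omega

lemma sum_factorization_sub {S : Set ℕ} (hS : IsMultiplicativeSet S) {p : ℕ}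
    (hp : p.Prime) (u : ℝ) :
    (∑ n ∈ Finset.Icc 1 ⌊exp u⌋₊, chiS S n * (n.factorization p : ℝ) -
      chiS S p * logSum (chiS S) (u - log p)) * log p =
      ∑ k ∈ Finset.range (⌊exp u⌋₊ + 1), remCoeff S p k *
        logSum (chiS (coprimePart S p)) (u - ((k:ℝ) + 2) * log p) := by
  have h1 := sum_chiS_mul_factorization hS hp (fun e => (e:ℝ)) u
    (K := ⌊exp u⌋₊ + 1 + 1 + 1) (by omega)
  have hle : ⌊exp (u - log p)⌋₊ ≤ ⌊exp u⌋₊ :=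
    Nat.floor_mono (exp_le_exp.2 (by linarith [log_natCast_nonneg p]))
  have h2 := sum_chiS_mul_factorization hS hp (fun _ => 1) (u - log p)
    (K := ⌊exp u⌋₊ + 1 + 1) (by omega)
  simp only [mul_one, one_mul] at h2
  rw [h1, logSum, h2, Finset.sum_range_succ', Finset.sum_range_succ', Finset.sum_range_succ' _ (_ + 1)]
  simp only [pow_zero, chiS_one hS, remCoeff, if_pos hp]
  push_cast
  rw [mul_add, Finset.mul_sum]
  simp only [pow_one, one_mul, zero_mul, add_zero, sub_zero]
  rw [add_sub_add_right_eq_sub, ← Finset.sum_sub_distrib, Finset.sum_mul]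
  refine Finset.sum_congr rfl fun k _ => ?_
  have e2 : u - log p - ((k:ℝ) + 1) * log p = u - ((k:ℝ) + 2) * log p := by ring
  have e3 : u - ((k:ℝ) + 1 + 1) * log p = u - ((k:ℝ) + 2) * log p := by ring
  rw [e2, e3]
  ring

lemma logSum_mul_exp_neg (S : Set ℕ) (u w : ℝ) :
    logSum (chiS S) (u - w) * exp (-u) = exp (-w) * dens S (u - w) := by
  rw [dens, mul_left_comm, ← exp_add]
  congr 2; ring

lemma exp_neg_nat_mul_log {p : ℕ} (hp : 0 < p) (k : ℕ) :
    exp (-(((k:ℝ) + 2) * log p)) = ((p:ℝ) ^ (k + 2))⁻¹ := by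
  have hp' : (0:ℝ) < p := by exact_mod_cast hp
  rw [exp_neg, show ((k:ℝ) + 2) * log p = log ((p:ℝ) ^ (k + 2)) by rw [log_pow]; push_cast; ring,
    exp_log (by positivity)]

lemma remTerm_eq_zero (S : Set ℕ) {u : ℝ} {q : ℕ × ℕ}
    (hq : q ∉ Finset.Icc 1 ⌊exp u⌋₊ ×ˢ Finset.range (⌊exp u⌋₊ + 1)) : remTerm S u q = 0 := by
  unfold remTerm
  by_cases hp : q.1.Prime
  · rw [dens_of_neg, mul_zero]
    rw [sub_neg, show ((q.2:ℝ) + 2) * log q.1 = log ((q.1 ^ (q.2 + 2) : ℕ) : ℝ) by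
      push_cast; rw [log_pow]; push_cast; ring]
    rw [lt_log_iff_exp_lt (by exact_mod_cast pow_pos hp.pos _)]
    have h1 : exp u < (⌊exp u⌋₊ : ℝ) + 1 := Nat.lt_floor_add_one _
    refine h1.trans_le ?_
    have : ⌊exp u⌋₊ + 1 ≤ q.1 ^ (q.2 + 2) := by
      simp only [Finset.mem_product, Finset.mem_Icc, Finset.mem_range, not_and_or] at hq
      have hb : q.1 ≤ q.1 ^ (q.2 + 2) := Nat.le_self_pow (by omega) _
      have hc : q.2 + 2 < q.1 ^ (q.2 + 2) := Nat.lt_pow_self hp.one_lt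
      have := hp.pos
      omega
    exact_mod_cast this
  · simp [remCoeff, hp]

lemma tsum_remTerm_eq (S : Set ℕ) (u : ℝ) :
    ∑' q, remTerm S u q =
      ∑ p ∈ Finset.Icc 1 ⌊exp u⌋₊, ∑ k ∈ Finset.range (⌊exp u⌋₊ + 1), remTerm S u (p, k) := by
  rw [tsum_eq_sum (s := Finset.Icc 1 ⌊exp u⌋₊ ×ˢ Finset.range (⌊exp u⌋₊ + 1))
    fun q hq => remTerm_eq_zero S hq, Finset.sum_product]

lemma sum_chiS_mul_log (S : Set ℕ) (u : ℝ) :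
    ∑ n ∈ Finset.Icc 1 ⌊exp u⌋₊, chiS S n * log n =
      ∑ p ∈ Finset.Icc 1 ⌊exp u⌋₊, if p.Prime then
        (∑ n ∈ Finset.Icc 1 ⌊exp u⌋₊, chiS S n * (n.factorization p : ℝ)) * log p else 0 := by
  have h : ∀ n ∈ Finset.Icc 1 ⌊exp u⌋₊, chiS S n * log n =
      ∑ p ∈ Finset.Icc 1 ⌊exp u⌋₊, if p.Prime then
        chiS S n * (n.factorization p : ℝ) * log p else 0 := by
    intro n hn
    rw [Finset.mem_Icc] at hn
    rw [Real.log_nat_eq_sum_factorization, Finsupp.sum, Finset.mul_sum,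
      Finset.sum_subset (s₂ := Finset.Icc 1 ⌊exp u⌋₊)]
    · refine Finset.sum_congr rfl fun p _ => ?_
      split_ifs with hp
      · ring
      · simp [Nat.factorization_eq_zero_of_not_prime n hp]
    · intro p hp
      rw [Nat.support_factorization, Nat.mem_primeFactors] at hp
      rw [Finset.mem_Icc]
      exact ⟨hp.1.one_le, (Nat.le_of_dvd (by omega) hp.2.1).trans hn.2⟩
    · intro p _ hp
      rw [Finsupp.notMem_support_iff] at hp
      simp [hp]
  rw [Finset.sum_congr rfl h, Finset.sum_comm]
  refine Finset.sum_congr rfl fun p _ => ?_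
  split_ifs
  · rw [Finset.sum_mul]
  · simp

/-- The fundamental identity obtained by evaluating `∑_{n ≤ e^u, n ∈ S} log n` in two ways. -/
lemma mul_dens_eq {S : Set ℕ} (hS : IsMultiplicativeSet S) {u : ℝ} (hu : 0 ≤ u) :
    u * dens S u = (∫ v in (0:ℝ)..u, dens S v * exp (v - u)) +
      (∑ p ∈ Finset.Icc 1 ⌊exp u⌋₊, primeWeight S p / p * dens S (u - log p)) +
      ∑' q, remTerm S u q := by
  have h1 : ∫ v in (0:ℝ)..u, dens S v * exp (v - u) =
      (∑ n ∈ Finset.Icc 1 ⌊exp u⌋₊, chiS S n * (u - log n)) * exp (-u) := by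
    have := integral_logSum_mul (a := chiS S) hu (g := fun _ => 1) continuous_const
    simp only [mul_one, intervalIntegral.integral_const, smul_eq_mul] at this
    rw [← this, ← intervalIntegral.integral_mul_const]
    refine intervalIntegral.integral_congr fun v _ => ?_
    simp only [dens]
    rw [mul_assoc, ← exp_add]
    congr 2; ring
  have h2 : ∑ p ∈ Finset.Icc 1 ⌊exp u⌋₊, primeWeight S p / p * dens S (u - log p) =
      (∑ p ∈ Finset.Icc 1 ⌊exp u⌋₊, primeWeight S p * logSum (chiS S) (u - log p)) *
        exp (-u) := by
    rw [Finset.sum_mul]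
    refine Finset.sum_congr rfl fun p hp => ?_
    rw [Finset.mem_Icc] at hp
    rw [mul_assoc, logSum_mul_exp_neg, exp_neg_log_natCast hp.1]
    ring
  have h3 : ∑' q, remTerm S u q =
      (∑ p ∈ Finset.Icc 1 ⌊exp u⌋₊, if p.Prime then
        (∑ n ∈ Finset.Icc 1 ⌊exp u⌋₊, chiS S n * (n.factorization p : ℝ) -
          chiS S p * logSum (chiS S) (u - log p)) * log p else 0) * exp (-u) := by
    rw [tsum_remTerm_eq, Finset.sum_mul]
    refine Finset.sum_congr rfl fun p _ => ?_
    split_ifs with hp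
    · rw [sum_factorization_sub hS hp, Finset.sum_mul]
      refine Finset.sum_congr rfl fun k _ => ?_
      rw [mul_assoc, logSum_mul_exp_neg, exp_neg_nat_mul_log hp.pos, remTerm]
      ring
    · simp [remTerm, remCoeff, hp]
  rw [h1, h2, h3, ← add_mul, ← add_mul, dens, ← mul_assoc]
  congr 1
  have h4 : ∑ n ∈ Finset.Icc 1 ⌊exp u⌋₊, chiS S n * (u - log n) =
      u * logSum (chiS S) u - ∑ n ∈ Finset.Icc 1 ⌊exp u⌋₊, chiS S n * log n := by
    rw [logSum, Finset.mul_sum, ← Finset.sum_sub_distrib]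
    exact Finset.sum_congr rfl fun n _ => by ring
  rw [h4, sum_chiS_mul_log, add_assoc, ← Finset.sum_add_distrib, sub_add,
    ← Finset.sum_sub_distrib, eq_comm, sub_eq_self]
  refine Finset.sum_eq_zero fun p _ => ?_
  unfold primeWeight
  split_ifs <;> ring

/-- The convolution `∑_{m ≤ e^w, m ∈ S} K (w - log m) / m`. -/
noncomputable def kerSum (S : Set ℕ) (K : ℝ → ℝ) (w : ℝ) : ℝ :=
  ∑ m ∈ Finset.Icc 1 ⌊exp w⌋₊, chiS S m / m * K (w - log m)

lemma kerSum_mono {S : Set ℕ} {K K' : ℝ → ℝ} (h : ∀ t, 0 ≤ t → K t ≤ K' t) (w : ℝ) :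
    kerSum S K w ≤ kerSum S K' w := by
  refine Finset.sum_le_sum fun m hm => ?_
  have := (mem_Icc_floor_exp.1 hm).2
  exact mul_le_mul_of_nonneg_left (h _ (by linarith))
    (div_nonneg (chiS_nonneg S m) m.cast_nonneg)

lemma kerSum_nonneg {S : Set ℕ} {K : ℝ → ℝ} (h : ∀ t, 0 ≤ t → 0 ≤ K t) (w : ℝ) :
    0 ≤ kerSum S K w := by
  refine Finset.sum_nonneg fun m hm => ?_
  have := (mem_Icc_floor_exp.1 hm).2
  exact mul_nonneg (div_nonneg (chiS_nonneg S m) m.cast_nonneg) (h _ (by linarith))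

lemma kerSum_const_mul (S : Set ℕ) (K : ℝ → ℝ) (c w : ℝ) :
    kerSum S (fun t => c * K t) w = c * kerSum S K w := by
  rw [kerSum, kerSum, Finset.mul_sum]
  exact Finset.sum_congr rfl fun m _ => by ring

lemma kerSum_const (S : Set ℕ) (c w : ℝ) : kerSum S (fun _ => c) w = logMean S w * c := by
  rw [kerSum, logMean, logSum, Finset.sum_mul]

lemma kerSum_le_sum_range {S : Set ℕ} {K : ℝ → ℝ} (hK : AntitoneOn K (Set.Ici 0))
    (hK0 : ∀ t, 0 ≤ t → 0 ≤ K t) (w : ℝ) :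
    kerSum S K w ≤ exp 1 * ∑ j ∈ Finset.range (⌊w⌋₊ + 1), K j * dens S (w - j) := by
  have hd : ∀ j : ℕ, K j * dens S (w - j) = ∑ m ∈ Finset.Icc 1 ⌊exp w⌋₊,
      if log m ≤ w - j then K j * (chiS S m * exp (-(w - j))) else 0 := by
    intro j
    rw [dens, logSum_eq_sum_ite (chiS S) (u := w) (w := w - j) (by simp), Finset.sum_mul,
      Finset.mul_sum]
    refine Finset.sum_congr rfl fun m _ => ?_
    split_ifs <;> simp
  simp_rw [hd]
  rw [Finset.sum_comm, Finset.mul_sum]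
  refine Finset.sum_le_sum fun m hm => ?_
  obtain ⟨h1, h2⟩ := mem_Icc_floor_exp.1 hm
  have hlog := log_natCast_nonneg m
  set j := ⌊w - log m⌋₊ with hj
  have hj1 : (j:ℝ) ≤ w - log m := Nat.floor_le (by linarith)
  have hj2 : w - log m < j + 1 := Nat.lt_floor_add_one _
  have hmem : j ∈ Finset.range (⌊w⌋₊ + 1) := by
    rw [Finset.mem_range, Nat.lt_succ_iff]
    exact Nat.floor_mono (by linarith)
  have hnn : ∀ i ∈ Finset.range (⌊w⌋₊ + 1), (0:ℝ) ≤
      if log m ≤ w - i then K i * (chiS S m * exp (-(w - i))) else 0 := by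
    intro i _
    split_ifs
    · exact mul_nonneg (hK0 _ i.cast_nonneg) (mul_nonneg (chiS_nonneg S m) (exp_pos _).le)
    · exact le_rfl
  refine le_trans ?_ (mul_le_mul_of_nonneg_left (Finset.single_le_sum hnn hmem) (exp_pos 1).le)
  rw [if_pos (by linarith)]
  have hk : K (w - log m) ≤ K j := hK (Set.mem_Ici.2 j.cast_nonneg)
    (Set.mem_Ici.2 (by linarith)) hj1
  have hm1 : ((m:ℝ))⁻¹ ≤ exp 1 * exp (-(w - j)) := by
    rw [← exp_neg_log_natCast h1, ← exp_add]
    exact exp_le_exp.2 (by linarith)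
  rw [div_eq_mul_inv]
  calc chiS S m * (m:ℝ)⁻¹ * K (w - log m)
      ≤ chiS S m * (exp 1 * exp (-(w - j))) * K j := by
        refine mul_le_mul (mul_le_mul_of_nonneg_left hm1 (chiS_nonneg S m)) hk
          (hK0 _ (by linarith)) ?_
        exact mul_nonneg (chiS_nonneg S m) (by positivity)
    _ = _ := by ring

/-- The error term in the weighted prime sum condition, as an explicit bound. -/
def PrimeWeightBound (S : Set ℕ) (δ ρ C : ℝ) : Prop :=
  ∀ u : ℝ, 0 ≤ u →
    |logSum (primeWeight S) u - δ * exp u| ≤ C * (exp u * (1 + u) ^ (-(1 + ρ)))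

/-- The contribution of the primes `p > e^V` to `∑_{p ∈ S} (log p / p) S(x/p) (x/p)⁻¹`. -/
noncomputable def primeTail (S : Set ℕ) (V u : ℝ) : ℝ :=
  ∑ p ∈ (Finset.Icc 1 ⌊exp u⌋₊).filter (fun p : ℕ => V < log p),
    primeWeight S p / p * dens S (u - log p)

lemma div_mul_dens (S : Set ℕ) (c u : ℝ) {p : ℕ} (hp : 1 ≤ p) :
    c / p * dens S (u - log p) = c * logSum (chiS S) (u - log p) * exp (-u) := by
  rw [mul_assoc, logSum_mul_exp_neg, exp_neg_log_natCast hp]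
  ring

lemma abs_primeTail_sub_le {S : Set ℕ} {δ ρ C : ℝ} (hE : PrimeWeightBound S δ ρ C)
    {u V : ℝ} (hV : 0 ≤ V) (hu : V ≤ u) :
    |primeTail S V u - δ * densInt S (u - V)| ≤
      C * ((1 + V) ^ (-(1 + ρ)) * dens S (u - V) +
        kerSum S (fun t => (1 + V + t) ^ (-(1 + ρ))) (u - V)) := by
  have e1 : primeTail S V u = ∑ m ∈ Finset.Icc 1 ⌊exp (u - V)⌋₊,
      chiS S m * (logSum (primeWeight S) (u - log m) - logSum (primeWeight S) V) * exp (-u) := by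
    rw [primeTail, ← Finset.sum_mul, ← sum_filter_mul_logSum _ _ hV, Finset.sum_mul]
    refine Finset.sum_congr rfl fun p hp => ?_
    rw [Finset.mem_filter, mem_Icc_floor_exp] at hp
    exact div_mul_dens S _ u hp.1.1
  have e2 : δ * densInt S (u - V) = ∑ m ∈ Finset.Icc 1 ⌊exp (u - V)⌋₊,
      chiS S m * (δ * exp (u - log m) - δ * exp V) * exp (-u) := by
    rw [densInt_eq S (by linarith), logMean, dens, logSum, logSum, Finset.sum_mul,
      ← Finset.sum_sub_distrib, Finset.mul_sum]
    refine Finset.sum_congr rfl fun m hm => ?_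
    rw [mem_Icc_floor_exp] at hm
    rw [sub_eq_add_neg u (log m), exp_add, exp_neg_log_natCast hm.1, neg_sub, sub_eq_add_neg V u,
      exp_add]
    have : exp u * exp (-u) = 1 := by rw [← exp_add]; simp
    linear_combination (-chiS S m * δ * (m:ℝ)⁻¹) * this
  have e3 : C * ((1 + V) ^ (-(1 + ρ)) * dens S (u - V) +
        kerSum S (fun t => (1 + V + t) ^ (-(1 + ρ))) (u - V)) =
      ∑ m ∈ Finset.Icc 1 ⌊exp (u - V)⌋₊,
        chiS S m * (C * (exp (u - log m) * (1 + (u - log m)) ^ (-(1 + ρ))) +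
          C * (exp V * (1 + V) ^ (-(1 + ρ)))) * exp (-u) := by
    rw [dens, kerSum, logSum, Finset.sum_mul, Finset.mul_sum, ← Finset.sum_add_distrib,
      Finset.mul_sum]
    refine Finset.sum_congr rfl fun m hm => ?_
    rw [mem_Icc_floor_exp] at hm
    have e4 : 1 + V + (u - V - log m) = 1 + (u - log m) := by ring
    rw [e4, sub_eq_add_neg u (log m), exp_add, exp_neg_log_natCast hm.1, neg_sub,
      sub_eq_add_neg V u, exp_add]
    have : exp u * exp (-u) = 1 := by rw [← exp_add]; simp
    linear_combination (-chiS S m * C * (1 + (u + -log m)) ^ (-(1 + ρ)) * (m:ℝ)⁻¹) * this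
  rw [e1, e2, e3, ← Finset.sum_sub_distrib]
  refine (Finset.abs_sum_le_sum_abs _ _).trans (Finset.sum_le_sum fun m hm => ?_)
  rw [mem_Icc_floor_exp] at hm
  have h1 := hE (u - log m) (by linarith [hm.2])
  have h2 := hE V hV
  rw [← sub_mul, ← mul_sub, abs_mul, abs_mul, abs_of_nonneg (chiS_nonneg S m),
    abs_of_pos (exp_pos _)]
  refine mul_le_mul_of_nonneg_right (mul_le_mul_of_nonneg_left ?_ (chiS_nonneg S m))
    (exp_pos _).le
  rw [abs_le] at h1 h2 ⊢
  constructor <;> linarith [h1.1, h1.2, h2.1, h2.2]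

lemma primeTail_zero (S : Set ℕ) (u : ℝ) :
    primeTail S 0 u = ∑ p ∈ Finset.Icc 1 ⌊exp u⌋₊, primeWeight S p / p * dens S (u - log p) := by
  rw [primeTail, Finset.sum_filter]
  refine Finset.sum_congr rfl fun p hp => ?_
  split_ifs with h
  · rfl
  · rw [primeWeight]
    split_ifs with h2
    · exact absurd (log_pos (by exact_mod_cast h2.one_lt)) h
    · simp

lemma integral_dens_mul_exp_eq_kerSum (S : Set ℕ) {u : ℝ} (hu : 0 ≤ u) :
    ∫ v in (0:ℝ)..u, dens S v * exp (v - u) = kerSum S (fun t => t * exp (-t)) u := by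
  have h1 : ∀ v : ℝ, dens S v * exp (v - u) = logSum (chiS S) v * exp (-u) := by
    intro v
    rw [dens, mul_assoc, ← exp_add]
    congr 2; ring
  simp_rw [h1]
  rw [integral_logSum_mul hu continuous_const, kerSum]
  refine Finset.sum_congr rfl fun m hm => ?_
  rw [mem_Icc_floor_exp] at hm
  rw [intervalIntegral.integral_const, smul_eq_mul, neg_sub, sub_eq_add_neg (log m), exp_add,
    exp_log (by exact_mod_cast hm.1)]
  have : (m:ℝ) ≠ 0 := by have := hm.1; positivity
  field_simp

lemma mul_exp_neg_le_rpow {ρ t : ℝ} (hρ : 0 < ρ) (ht : 0 ≤ t) :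
    t * exp (-t) ≤ 2 * (2 * (1 + ρ)) ^ (1 + ρ) * (1 + t) ^ (-(1 + ρ)) := by
  have h1 := one_add_rpow_le_exp_half (k := 1 + ρ) (by linarith) ht
  have h2 : t ≤ 2 * exp (t / 2) := by linarith [add_one_le_exp (t / 2)]
  have h3 : (1 + t) ^ (-(1 + ρ)) * (1 + t) ^ (1 + ρ) = 1 := by
    rw [← rpow_add (by linarith)]; simp
  have h4 : exp (-t) * (exp (t / 2) * exp (t / 2)) = 1 := by
    rw [← exp_add, ← exp_add]; simp
  have hpos : 0 < (1 + t) ^ (-(1 + ρ)) := rpow_pos_of_pos (by linarith) _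
  calc t * exp (-t) ≤ 2 * exp (t / 2) * exp (-t) :=
        mul_le_mul_of_nonneg_right h2 (exp_pos _).le
    _ = 2 * exp (t / 2) * exp (-t) * ((1 + t) ^ (-(1 + ρ)) * (1 + t) ^ (1 + ρ)) := by
        rw [h3, mul_one]
    _ ≤ 2 * exp (t / 2) * exp (-t) * ((1 + t) ^ (-(1 + ρ)) *
          ((2 * (1 + ρ)) ^ (1 + ρ) * exp (t / 2))) := by gcongr
    _ = 2 * (2 * (1 + ρ)) ^ (1 + ρ) * (1 + t) ^ (-(1 + ρ)) *
          (exp (-t) * (exp (t / 2) * exp (t / 2))) := by ring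
    _ = _ := by rw [h4, mul_one]

lemma antitoneOn_one_add_rpow {ρ V : ℝ} (hρ : 0 < ρ) (hV : 0 ≤ V) :
    AntitoneOn (fun t : ℝ => (1 + V + t) ^ (-(1 + ρ))) (Set.Ici 0) := by
  intro a ha b _ hab
  have := Set.mem_Ici.1 ha
  exact rpow_le_rpow_of_nonpos (by linarith) (by linarith) (by linarith)

lemma abs_remCoeff_le (S : Set ℕ) (p k : ℕ) :
    |remCoeff S p k| ≤ ((k:ℝ) + 2) * log p := by
  have hl := log_natCast_nonneg p
  rw [remCoeff]
  split_ifs with hp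
  · rw [abs_mul, abs_of_nonneg hl]
    refine mul_le_mul_of_nonneg_right ?_ hl
    have h1 := chiS_nonneg S (p ^ (k + 2))
    have h2 := chiS_le_one S (p ^ (k + 2))
    have h3 : chiS S p * chiS S (p ^ (k + 1)) ≤ 1 :=
      mul_le_one₀ (chiS_le_one S _) (chiS_nonneg S _) (chiS_le_one S _)
    have h4 : 0 ≤ chiS S p * chiS S (p ^ (k + 1)) :=
      mul_nonneg (chiS_nonneg S _) (chiS_nonneg S _)
    have hk : (0:ℝ) ≤ k := k.cast_nonneg
    rw [abs_le]
    constructor <;> nlinarith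
  · rw [abs_zero]; positivity

/-- The normalised size of the coefficient of `p ^ (k + 2)`. -/
noncomputable def remWeight (S : Set ℕ) (q : ℕ × ℕ) : ℝ :=
  |remCoeff S q.1 q.2| / (q.1:ℝ) ^ (q.2 + 2)

lemma remWeight_nonneg (S : Set ℕ) (q : ℕ × ℕ) : 0 ≤ remWeight S q := by
  unfold remWeight; positivity

lemma remWeight_mul_le (S : Set ℕ) (q : ℕ × ℕ) :
    remWeight S q * (1 + ((q.2:ℝ) + 2) * log q.1) ≤
      128 * ((q.1:ℝ) ^ (-(3/2) : ℝ) * ((2:ℝ) ^ (-(3/4) : ℝ)) ^ q.2) := by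
  obtain ⟨p, k⟩ := q
  by_cases hp : p.Prime
  swap
  · simp only [remWeight, remCoeff, if_neg hp, abs_zero, zero_div, zero_mul]
    positivity
  have hp2 : (2:ℝ) ≤ p := by exact_mod_cast hp.two_le
  have hp0 : (0:ℝ) < p := by linarith
  set y : ℝ := ((k:ℝ) + 2) * log p with hy
  have hy0 : 0 ≤ y := mul_nonneg (by positivity) (log_natCast_nonneg p)
  have hx : ((p:ℝ) ^ (k + 2)) = exp y := by
    rw [hy, mul_comm, ← rpow_natCast, rpow_def_of_pos hp0]; push_cast; rfl
  have h1 : remWeight S (p, k) ≤ y / exp y := by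
    rw [remWeight, ← hx]
    exact div_le_div_of_nonneg_right (abs_remCoeff_le S p k) (by positivity)
  have h2 : y * (1 + y) ≤ 128 * exp (y / 4) := by
    have h3 : y ≤ 8 * exp (y / 8) := by linarith [add_one_le_exp (y / 8)]
    have h4 : 1 + y ≤ 8 * exp (y / 8) := by linarith [add_one_le_exp (y / 8)]
    have h5 : exp (y / 4) = exp (y / 8) * exp (y / 8) := by rw [← exp_add]; ring_nf
    have h6 := mul_le_mul h3 h4 (by linarith) (by positivity)
    rw [h5]; nlinarith [exp_pos (y / 8)]
  have h7 : exp (y / 4) / exp y = exp (-(3 / 4) * y) := by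
    rw [← exp_sub]; ring_nf
  have h8 : exp (-(3 / 4) * y) = (p:ℝ) ^ (-(3/2) : ℝ) * ((p:ℝ) ^ (-(3/4) : ℝ)) ^ k := by
    rw [← rpow_natCast, ← rpow_mul hp0.le, ← rpow_add hp0, rpow_def_of_pos hp0, hy]
    ring_nf
  calc remWeight S (p, k) * (1 + y) ≤ y / exp y * (1 + y) := by gcongr
    _ = y * (1 + y) / exp y := by ring
    _ ≤ 128 * exp (y / 4) / exp y := by gcongr
    _ = 128 * ((p:ℝ) ^ (-(3/2) : ℝ) * ((p:ℝ) ^ (-(3/4) : ℝ)) ^ k) := by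
        rw [mul_div_assoc, h7, h8]
    _ ≤ _ := by
        have h9 : (p:ℝ) ^ (-(3/4) : ℝ) ≤ (2:ℝ) ^ (-(3/4) : ℝ) :=
          rpow_le_rpow_of_nonpos (by norm_num) hp2 (by norm_num)
        simp only
        gcongr

lemma summable_remWeight_mul (S : Set ℕ) :
    Summable fun q : ℕ × ℕ => remWeight S q * (1 + ((q.2:ℝ) + 2) * log q.1) := by
  have h1 : Summable fun n : ℕ => (n:ℝ) ^ (-(3/2) : ℝ) :=
    Real.summable_nat_rpow.2 (by norm_num)
  have h2 : Summable fun k : ℕ => ((2:ℝ) ^ (-(3/4) : ℝ)) ^ k :=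
    summable_geometric_of_lt_one (by positivity)
      (rpow_lt_one_of_one_lt_of_neg (by norm_num) (by norm_num))
  refine Summable.of_nonneg_of_le (fun q => ?_) (remWeight_mul_le S)
    ((h1.mul_of_nonneg h2 (fun n => by positivity) (fun k => by positivity)).mul_left 128)
  exact mul_nonneg (remWeight_nonneg S q)
    (add_nonneg zero_le_one (mul_nonneg (by positivity) (log_natCast_nonneg _)))

lemma summable_remWeight (S : Set ℕ) : Summable (remWeight S) := by
  refine Summable.of_nonneg_of_le (remWeight_nonneg S) (fun q => ?_) (summable_remWeight_mul S)
  refine le_mul_of_one_le_right (remWeight_nonneg S q) ?_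
  have := mul_nonneg (add_nonneg q.2.cast_nonneg zero_le_two : (0:ℝ) ≤ q.2 + 2)
    (log_natCast_nonneg q.1)
  linarith

lemma dens_coprimePart_le (S : Set ℕ) (p : ℕ) (u : ℝ) :
    dens (coprimePart S p) u ≤ dens S u := by
  refine mul_le_mul_of_nonneg_right (Finset.sum_le_sum fun n _ => ?_) (exp_pos _).le
  rw [chiS_coprimePart]
  split_ifs
  · exact chiS_nonneg S n
  · exact le_rfl

lemma abs_remTerm_le (S : Set ℕ) (u : ℝ) (q : ℕ × ℕ) :
    |remTerm S u q| ≤ remWeight S q * dens S (u - ((q.2:ℝ) + 2) * log q.1) := by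
  rw [remTerm, abs_mul, abs_div, abs_of_nonneg (dens_nonneg _ _), remWeight,
    abs_of_nonneg (by positivity : (0:ℝ) ≤ (q.1:ℝ) ^ (q.2 + 2))]
  exact mul_le_mul_of_nonneg_left (dens_coprimePart_le S q.1 _) (by positivity)

lemma abs_tsum_remTerm_le {S : Set ℕ} {u B : ℝ} (f : ℕ × ℕ → ℝ) (hf : Summable f)
    (h : ∀ q, |remTerm S u q| ≤ B * f q) : |∑' q, remTerm S u q| ≤ B * ∑' q, f q := by
  rw [← tsum_mul_left, ← Real.norm_eq_abs]
  exact tsum_of_norm_bounded (hf.mul_left B).hasSum fun q => by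
    rw [Real.norm_eq_abs]; exact h q

/-- A multiplicative set whose primes have weighted density `δ` with a power of the logarithm
saved in the error term. -/
structure IsPrimeRegular (S : Set ℕ) (δ ρ : ℝ) : Prop where
  mult : IsMultiplicativeSet S
  density_pos : 0 < δ
  density_lt : δ < 1
  exponent_pos : 0 < ρ
  exponent_le : ρ ≤ 1
  bound : ∃ C : ℝ, 0 ≤ C ∧ PrimeWeightBound S δ ρ C

lemma mul_log_natCast_nonneg (k p : ℕ) : 0 ≤ ((k:ℝ) + 2) * log p :=
  mul_nonneg (by positivity) (log_natCast_nonneg p)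

lemma one_le_logMean {S : Set ℕ} (hS : IsMultiplicativeSet S) {u : ℝ} (hu : 0 ≤ u) :
    1 ≤ logMean S u := by
  have h1 : 1 ∈ Finset.Icc 1 ⌊exp u⌋₊ := mem_Icc_floor_exp.2 ⟨le_rfl, by simpa using hu⟩
  refine le_trans ?_ (Finset.single_le_sum (f := fun n : ℕ => chiS S n / n)
    (fun n _ => div_nonneg (chiS_nonneg S n) n.cast_nonneg) h1)
  simp [chiS_one hS]

lemma exists_abs_mul_dens_sub_le {S : Set ℕ} {δ ρ : ℝ} (h : IsPrimeRegular S δ ρ) :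
    ∃ C : ℝ, 0 ≤ C ∧ ∀ u : ℝ, 0 ≤ u → |u * dens S u - δ * densInt S u| ≤
      C * (dens S u + kerSum S (fun t => (1 + t) ^ (-(1 + ρ))) u) + |∑' q, remTerm S u q| := by
  obtain ⟨C, hC0, hC⟩ := h.bound
  have hρ := h.exponent_pos
  refine ⟨C + 2 * (2 * (1 + ρ)) ^ (1 + ρ), by positivity, fun u hu => ?_⟩
  have h1 := abs_primeTail_sub_le hC le_rfl hu
  simp only [sub_zero, add_zero, one_rpow, one_mul] at h1
  rw [mul_dens_eq h.mult hu, ← primeTail_zero, integral_dens_mul_exp_eq_kerSum S hu]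
  have h2 : kerSum S (fun t => t * exp (-t)) u ≤
      2 * (2 * (1 + ρ)) ^ (1 + ρ) * kerSum S (fun t => (1 + t) ^ (-(1 + ρ))) u := by
    rw [← kerSum_const_mul]
    exact kerSum_mono (fun t ht => mul_exp_neg_le_rpow hρ ht) u
  have h3 : 0 ≤ kerSum S (fun t => t * exp (-t)) u :=
    kerSum_nonneg (fun t ht => by positivity) u
  have h4 : 0 ≤ 2 * (2 * (1 + ρ)) ^ (1 + ρ) * dens S u :=
    mul_nonneg (by positivity) (dens_nonneg S u)
  have h5 := abs_le.1 h1
  have h6 := neg_abs_le (∑' q, remTerm S u q)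
  have h7 := le_abs_self (∑' q, remTerm S u q)
  rw [abs_le]
  constructor <;> linarith [h5.1, h5.2]

lemma exists_dens_mul_le {S : Set ℕ} {δ ρ : ℝ} (h : IsPrimeRegular S δ ρ) :
    ∃ C : ℝ, 0 ≤ C ∧ ∀ u : ℝ, 0 ≤ u → dens S u * (1 + u) ≤ C * logMean S u := by
  obtain ⟨C, hC0, hC⟩ := exists_abs_mul_dens_sub_le h
  have hρ := h.exponent_pos
  have hT : 0 ≤ ∑' q, remWeight S q := tsum_nonneg (remWeight_nonneg S)
  have hδ := h.density_pos
  refine ⟨1 + δ + 2 * C + ∑' q, remWeight S q, by positivity, fun u hu => ?_⟩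
  have h1 := (abs_le.1 (hC u hu)).2
  have h2 : kerSum S (fun t => (1 + t) ^ (-(1 + ρ))) u ≤ logMean S u := by
    rw [← mul_one (logMean S u), ← kerSum_const]
    exact kerSum_mono (fun t ht => rpow_le_one_of_one_le_of_nonpos (by linarith)
      (by linarith)) u
  have hd := dens_le_logMean S u
  have h3 : |∑' q, remTerm S u q| ≤ logMean S u * ∑' q, remWeight S q := by
    refine abs_tsum_remTerm_le _ (summable_remWeight S) fun q => ?_
    refine (abs_remTerm_le S u q).trans ?_
    rw [mul_comm]
    refine mul_le_mul_of_nonneg_right ?_ (remWeight_nonneg S q)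
    exact (dens_le_logMean S _).trans
      (logMean_mono S (by linarith [mul_log_natCast_nonneg q.2 q.1]))
  have h4 := mul_le_mul_of_nonneg_left (densInt_le_logMean S hu) hδ.le
  have h5 := mul_le_mul_of_nonneg_left (add_le_add hd h2) hC0
  linarith

lemma exists_dens_sub_le {S : Set ℕ} {δ ρ : ℝ} (h : IsPrimeRegular S δ ρ) :
    ∃ C : ℝ, 0 ≤ C ∧ ∀ u w : ℝ, 0 ≤ u → 0 ≤ w →
      dens S (u - w) ≤ C * (logMean S u * (1 + u) ^ (-(ρ / 2))) * (1 + w) ^ (ρ / 2) := by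
  obtain ⟨C, hC0, hC⟩ := exists_dens_mul_le h
  have hρ := h.exponent_pos
  have hρ1 := h.exponent_le
  refine ⟨C, hC0, fun u w hu hw => ?_⟩
  have hM := logMean_nonneg S u
  rcases lt_or_ge u w with hlt | hle
  · rw [dens_of_neg S (by linarith)]; positivity
  have h1 := (hC (u - w) (by linarith)).trans
    (mul_le_mul_of_nonneg_left (logMean_mono S (by linarith : u - w ≤ u)) hC0)
  have h2 : (1 + w) / (1 + u) ≤ ((1 + w) / (1 + u)) ^ (ρ / 2) := by
    conv_lhs => rw [← rpow_one ((1 + w) / (1 + u))]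
    exact rpow_le_rpow_of_exponent_ge (by positivity)
      ((div_le_one (by linarith)).2 (by linarith)) (by linarith)
  have h3 : 1 + u ≤ (1 + (u - w)) * (1 + w) := by nlinarith
  have h4 : dens S (u - w) ≤ C * logMean S u * ((1 + w) / (1 + u)) := by
    rw [mul_div_assoc', le_div_iff₀ (by linarith)]
    calc dens S (u - w) * (1 + u) ≤ dens S (u - w) * ((1 + (u - w)) * (1 + w)) :=
          mul_le_mul_of_nonneg_left h3 (dens_nonneg S _)
      _ = dens S (u - w) * (1 + (u - w)) * (1 + w) := by ring
      _ ≤ _ := mul_le_mul_of_nonneg_right h1 (by linarith)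
  calc dens S (u - w) ≤ C * logMean S u * ((1 + w) / (1 + u)) := h4
    _ ≤ C * logMean S u * ((1 + w) / (1 + u)) ^ (ρ / 2) := by gcongr
    _ = _ := by
      rw [div_rpow (by linarith) (by linarith), rpow_neg (by linarith)]
      ring

lemma summable_one_add_rpow {a : ℝ} (ha : 1 < a) :
    Summable fun j : ℕ => (1 + (j:ℝ)) ^ (-a) := by
  have := (summable_nat_add_iff 1).2 (Real.summable_nat_rpow.2 (by linarith : -a < -1))
  refine this.congr fun j => ?_
  push_cast
  rw [add_comm]

lemma exists_abs_mul_dens_sub_le_logMean {S : Set ℕ} {δ ρ : ℝ} (h : IsPrimeRegular S δ ρ) :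
    ∃ C : ℝ, 0 ≤ C ∧ ∀ u : ℝ, 0 ≤ u → |u * dens S u - δ * densInt S u| ≤
      C * (logMean S u * (1 + u) ^ (-(ρ / 2))) := by
  obtain ⟨C, hC0, hC⟩ := exists_abs_mul_dens_sub_le h
  obtain ⟨D, hD0, hD⟩ := exists_dens_sub_le h
  have hρ := h.exponent_pos
  have hρ1 := h.exponent_le
  set T := ∑' q : ℕ × ℕ, remWeight S q * (1 + ((q.2:ℝ) + 2) * log q.1) with hT
  have hT0 : 0 ≤ T := tsum_nonneg fun q => mul_nonneg (remWeight_nonneg S q)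
    (by linarith [mul_log_natCast_nonneg q.2 q.1])
  have hZs := summable_one_add_rpow (a := 1 + ρ / 2) (by linarith)
  set Z := ∑' j : ℕ, (1 + (j:ℝ)) ^ (-(1 + ρ / 2)) with hZ
  have hZ0 : 0 ≤ Z := tsum_nonneg fun j => by positivity
  refine ⟨C * (D + exp 1 * (D * Z)) + D * T, by positivity, fun u hu => ?_⟩
  set Y := logMean S u * (1 + u) ^ (-(ρ / 2)) with hY
  have hY0 : 0 ≤ Y := mul_nonneg (logMean_nonneg S u) (by positivity)
  have h1 : dens S u ≤ D * Y := by
    have := hD u 0 hu le_rfl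
    simpa using this
  have h2 : kerSum S (fun t => (1 + t) ^ (-(1 + ρ))) u ≤ exp 1 * (D * Z) * Y := by
    have hanti := antitoneOn_one_add_rpow hρ (le_refl (0:ℝ))
    simp only [add_zero] at hanti
    refine (kerSum_le_sum_range hanti (fun t ht => by positivity) u).trans ?_
    rw [mul_assoc]
    refine mul_le_mul_of_nonneg_left ?_ (exp_pos 1).le
    calc ∑ j ∈ Finset.range (⌊u⌋₊ + 1), (1 + (j:ℝ)) ^ (-(1 + ρ)) * dens S (u - j)
        ≤ ∑ j ∈ Finset.range (⌊u⌋₊ + 1), D * Y * (1 + (j:ℝ)) ^ (-(1 + ρ / 2)) := by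
          refine Finset.sum_le_sum fun j _ => ?_
          have e : (1 + (j:ℝ)) ^ (-(1 + ρ / 2)) =
              (1 + (j:ℝ)) ^ (-(1 + ρ)) * (1 + (j:ℝ)) ^ (ρ / 2) := by
            rw [← rpow_add (by positivity)]; ring_nf
          rw [e]
          calc _ ≤ (1 + (j:ℝ)) ^ (-(1 + ρ)) * (D * Y * (1 + (j:ℝ)) ^ (ρ / 2)) :=
                mul_le_mul_of_nonneg_left (hD u j hu j.cast_nonneg) (by positivity)
            _ = _ := by ring
      _ = D * Y * ∑ j ∈ Finset.range (⌊u⌋₊ + 1), (1 + (j:ℝ)) ^ (-(1 + ρ / 2)) := by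
          rw [Finset.mul_sum]
      _ ≤ D * Y * Z := mul_le_mul_of_nonneg_left
          (hZs.sum_le_tsum _ fun j _ => by positivity) (by positivity)
      _ = D * Z * Y := by ring
  have h3 : |∑' q, remTerm S u q| ≤ D * Y * T := by
    refine abs_tsum_remTerm_le _ (summable_remWeight_mul S) fun q => ?_
    have hw := mul_log_natCast_nonneg q.2 q.1
    refine (abs_remTerm_le S u q).trans ?_
    calc _ ≤ remWeight S q * (D * Y * (1 + ((q.2:ℝ) + 2) * log q.1)) := by
          refine mul_le_mul_of_nonneg_left ((hD u _ hu hw).trans ?_) (remWeight_nonneg S q)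
          refine mul_le_mul_of_nonneg_left ?_ (by positivity)
          conv_rhs => rw [← rpow_one (1 + ((q.2:ℝ) + 2) * log q.1)]
          exact rpow_le_rpow_of_exponent_le (by linarith) (by linarith)
      _ = _ := by ring
  refine (hC u hu).trans ?_
  have := mul_le_mul_of_nonneg_left (add_le_add h1 h2) hC0
  linarith

lemma exists_tendsto_of_abs_deriv_le {f f' : ℝ → ℝ} {a K η : ℝ} (ha : 0 < a) (hη : 0 < η)
    (hf : ContinuousOn f (Set.Ici a))
    (hf' : ∀ u, a ≤ u → HasDerivWithinAt f (f' u) (Set.Ici u) u)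
    (hb : ∀ u, a ≤ u → |f' u| ≤ K * u ^ (-(1 + η))) :
    ∃ L, Tendsto f atTop (nhds L) ∧ ∀ u, a ≤ u → |f u - L| ≤ K / η * u ^ (-η) := by
  have hK : 0 ≤ K := by
    have h1 := (abs_nonneg _).trans (hb a le_rfl)
    exact nonneg_of_mul_nonneg_left h1 (rpow_pos_of_pos ha _)
  have key : ∀ u v, a ≤ u → u ≤ v → |f v - f u| ≤ K / η * u ^ (-η) := by
    intro u v hu huv
    have hB : ∀ x, 0 < x → HasDerivAt (fun x : ℝ => K / η * (u ^ (-η) - x ^ (-η)))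
        (K * x ^ (-(1 + η))) x := by
      intro x hx
      have h1 := ((Real.hasDerivAt_rpow_const (p := -η) (Or.inl hx.ne')).const_sub
        (u ^ (-η))).const_mul (K / η)
      refine h1.congr_deriv ?_
      have e : -η - 1 = -(1 + η) := by ring
      rw [e]
      field_simp
    have h2 := image_norm_le_of_norm_deriv_right_le_deriv_boundary' (f := fun x => f x - f u)
      (f' := f') (a := u) (b := v) (B := fun x : ℝ => K / η * (u ^ (-η) - x ^ (-η)))
      (B' := fun x => K * x ^ (-(1 + η)))
      ((hf.mono fun x hx => Set.mem_Ici.2 (hu.trans hx.1)).sub continuousOn_const)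
      (fun x hx => (hf' x (hu.trans hx.1)).sub_const _)
      (by simp)
      (fun x hx => (hB x (by linarith [hx.1])).continuousAt.continuousWithinAt)
      (fun x hx => (hB x (by linarith [hx.1])).hasDerivWithinAt)
      (fun x hx => hb x (hu.trans hx.1)) (Set.right_mem_Icc.2 huv)
    rw [Real.norm_eq_abs] at h2
    refine h2.trans (mul_le_mul_of_nonneg_left ?_ (by positivity))
    linarith [rpow_pos_of_pos (show 0 < v by linarith) (-η)]
  have hlim : Tendsto (fun u : ℝ => K / η * u ^ (-η)) atTop (nhds 0) := by
    simpa using (tendsto_rpow_neg_atTop hη).const_mul (K / η)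
  have hcauchy : Cauchy (map f atTop) := by
    refine Metric.cauchy_iff.2 ⟨inferInstance, fun ε hε => ?_⟩
    obtain ⟨b, hb1, hb2⟩ := ((hlim.eventually_lt_const (half_pos hε)).and
      (eventually_ge_atTop a)).exists
    refine ⟨f '' Set.Ici b, image_mem_map (Ici_mem_atTop b), ?_⟩
    rintro _ ⟨x, hx, rfl⟩ _ ⟨y, hy, rfl⟩
    have h1 := key b x hb2 hx
    have h2 := key b y hb2 hy
    rw [abs_sub_comm] at h2
    rw [Real.dist_eq]
    calc |f x - f y| = |(f x - f b) + (f b - f y)| := by ring_nf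
      _ ≤ |f x - f b| + |f b - f y| := abs_add_le _ _
      _ < ε := by linarith
  obtain ⟨L, hL⟩ := CompleteSpace.complete hcauchy
  refine ⟨L, hL, fun u hu => ?_⟩
  have h1 : Tendsto (fun v => |f v - f u|) atTop (nhds |L - f u|) :=
    (Tendsto.sub_const hL (f u)).abs
  rw [abs_sub_comm]
  exact le_of_tendsto h1 ((eventually_ge_atTop u).mono fun v hv => key u v hu hv)

lemma exists_tendsto_dens {S : Set ℕ} {δ ρ : ℝ} (h : IsPrimeRegular S δ ρ) :
    ∃ C₀ : ℝ, 0 < C₀ ∧ Tendsto (fun u => dens S u / u ^ (δ - 1)) atTop (nhds C₀) ∧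
      Tendsto (fun u => densInt S u / u ^ δ) atTop (nhds (C₀ / δ)) := by
  obtain ⟨C, hC0, hC⟩ := exists_abs_mul_dens_sub_le_logMean h
  obtain ⟨D, hD0, hD⟩ := exists_dens_mul_le h
  have hρ := h.exponent_pos
  have hδ := h.density_pos
  have hMI : ∀ u : ℝ, max 1 (2 * D) ≤ u → logMean S u ≤ 2 * densInt S u := by
    intro u hu
    have h1 := (le_max_left _ _).trans hu
    have h2 := (le_max_right _ _).trans hu
    have h3 := hD u (by linarith)
    have h4 := densInt_eq S (u := u) (by linarith)
    have h5 := dens_nonneg S u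
    have hM := logMean_nonneg S u
    have h6 : dens S u ≤ logMean S u / 2 := by
      rw [le_div_iff₀ two_pos]
      have h7 : dens S u * (1 + u) ≤ u / 2 * logMean S u :=
        h3.trans (mul_le_mul_of_nonneg_right (by linarith) hM)
      by_contra hcon
      push Not at hcon
      nlinarith
    linarith
  have ha : 0 < max 1 (2 * D) := lt_of_lt_of_le one_pos (le_max_left _ _)
  have hIpos : ∀ u : ℝ, max 1 (2 * D) ≤ u → 0 < densInt S u := fun u hu => by
    have := one_le_logMean h.mult (ha.le.trans hu)
    linarith [hMI u hu]
  obtain ⟨L, hL, -⟩ := exists_tendsto_of_abs_deriv_le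
    (f := fun u => log (densInt S u) - δ * log u)
    (f' := fun u => dens S u / densInt S u - δ * u⁻¹) (K := 2 * C) ha (half_pos hρ)
    (by
      refine ((continuous_densInt S).continuousOn.log fun u hu => (hIpos u hu).ne').sub ?_
      exact continuousOn_const.mul (continuousOn_id.log fun u hu => (ha.trans_le hu).ne'))
    (fun u hu => ((hasDerivWithinAt_densInt S u).log (hIpos u hu).ne').sub
      ((Real.hasDerivAt_log (ha.trans_le hu).ne').hasDerivWithinAt.const_mul δ))
    (fun u hu => by
      have hu0 := ha.trans_le hu
      have hI := hIpos u hu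
      have e : dens S u / densInt S u - δ * u⁻¹ =
          (u * dens S u - δ * densInt S u) / (u * densInt S u) := by
        field_simp
      rw [e, abs_div, abs_of_pos (mul_pos hu0 hI), div_le_iff₀ (mul_pos hu0 hI)]
      have h1 : (1 + u) ^ (-(ρ / 2)) ≤ u ^ (-(ρ / 2)) :=
        rpow_le_rpow_of_nonpos hu0 (by linarith) (by linarith)
      have h2 : u ^ (-(1 + ρ / 2)) * u = u ^ (-(ρ / 2)) := by
        rw [← rpow_add_one hu0.ne']; ring_nf
      calc _ ≤ C * (logMean S u * (1 + u) ^ (-(ρ / 2))) := hC u hu0.le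
        _ ≤ C * (2 * densInt S u * u ^ (-(ρ / 2))) := by
          have := hMI u hu
          gcongr
        _ = 2 * C * u ^ (-(1 + ρ / 2)) * (u * densInt S u) := by
          rw [← h2]; ring)
  have hI : Tendsto (fun u => densInt S u / u ^ δ) atTop (nhds (exp L)) := by
    refine ((continuous_exp.tendsto L).comp hL).congr' ?_
    filter_upwards [eventually_ge_atTop (max 1 (2 * D))] with u hu
    have hu0 := ha.trans_le hu
    rw [Function.comp, exp_sub, exp_log (hIpos u hu), rpow_def_of_pos hu0, mul_comm δ]
  refine ⟨δ * exp L, mul_pos hδ (exp_pos L), ?_, by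
    rwa [mul_div_cancel_left₀ _ hδ.ne']⟩
  have h0 : Tendsto (fun u : ℝ => 2 * C * (densInt S u / u ^ δ) * u ^ (-(ρ / 2))) atTop (nhds 0) := by
    simpa using (hI.const_mul (2 * C)).mul (tendsto_rpow_neg_atTop (half_pos hρ))
  have h1 : Tendsto (fun u => dens S u / u ^ (δ - 1) - δ * (densInt S u / u ^ δ)) atTop
      (nhds 0) := by
    refine squeeze_zero_norm' ?_ h0
    filter_upwards [eventually_ge_atTop (max 1 (2 * D))] with u hu
    have hu0 := ha.trans_le hu
    have hI := hIpos u hu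
    have hud : 0 < u ^ δ := rpow_pos_of_pos hu0 _
    have e : dens S u / u ^ (δ - 1) - δ * (densInt S u / u ^ δ) =
        (u * dens S u - δ * densInt S u) / u ^ δ := by
      rw [rpow_sub_one hu0.ne']; field_simp
    have h1 : (1 + u) ^ (-(ρ / 2)) ≤ u ^ (-(ρ / 2)) :=
      rpow_le_rpow_of_nonpos hu0 (by linarith) (by linarith)
    rw [e, Real.norm_eq_abs, abs_div, abs_of_pos hud, div_le_iff₀ hud]
    calc _ ≤ C * (logMean S u * (1 + u) ^ (-(ρ / 2))) := hC u hu0.le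
      _ ≤ C * (2 * densInt S u * u ^ (-(ρ / 2))) := by
        have := hMI u hu
        gcongr
      _ = _ := by field_simp
  have := h1.add (hI.const_mul δ)
  simpa using this

lemma exists_dens_le_rpow {S : Set ℕ} {δ ρ : ℝ} (h : IsPrimeRegular S δ ρ) :
    ∃ D : ℝ, 0 ≤ D ∧ ∀ u : ℝ, 0 ≤ u → dens S u ≤ D * (1 + u) ^ (δ - 1) := by
  obtain ⟨C₀, hC0, hC, -⟩ := exists_tendsto_dens h
  have hδ := h.density_pos
  have hδ1 := h.density_lt
  obtain ⟨a, ha⟩ := eventually_atTop.1 (hC.eventually_lt_const (lt_add_one C₀))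
  set b := max a 1
  have hb : 1 ≤ b := le_max_right _ _
  refine ⟨2 * (C₀ + 1) + (1 + b), by positivity, fun u hu => ?_⟩
  have hp : 0 < (1 + u) ^ (δ - 1) := rpow_pos_of_pos (by linarith) _
  rcases le_total b u with hbu | hub
  · have h1 := ha u ((le_max_left a 1).trans hbu)
    have hu0 : 0 < u := by linarith
    rw [div_lt_iff₀ (rpow_pos_of_pos hu0 _)] at h1
    have h2 : u ^ (δ - 1) ≤ 2 * (1 + u) ^ (δ - 1) := by
      have h3 : (2 * u) ^ (δ - 1) ≤ (1 + u) ^ (δ - 1) :=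
        rpow_le_rpow_of_nonpos (by linarith) (by linarith) (by linarith)
      rw [mul_rpow zero_le_two hu0.le] at h3
      have h4 : (2:ℝ)⁻¹ ≤ 2 ^ (δ - 1) := by
        rw [← rpow_neg_one]
        exact rpow_le_rpow_of_exponent_le one_le_two (by linarith)
      have h5 : 0 < u ^ (δ - 1) := rpow_pos_of_pos hu0 _
      nlinarith
    nlinarith
  · have h1 := dens_le_one S u
    have h2 : (1 + b)⁻¹ ≤ (1 + u) ^ (δ - 1) := by
      rw [← rpow_neg_one]
      exact (rpow_le_rpow_of_nonpos (by linarith) (by linarith) (by linarith)).trans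
        (rpow_le_rpow_of_exponent_le (by linarith) (by linarith))
    have h3 : 1 ≤ (1 + b) * (1 + u) ^ (δ - 1) := by
      rw [← inv_le_iff_one_le_mul₀' (by linarith)]
      exact h2
    nlinarith

lemma isMultiplicativeSet_coprimePart {S : Set ℕ} (hS : IsMultiplicativeSet S) {p : ℕ}
    (hp : p.Prime) : IsMultiplicativeSet (coprimePart S p) := by
  refine ⟨⟨hS.1, fun h => hp.one_lt.ne' (Nat.dvd_one.1 h)⟩, fun m n hm hn hmn => ?_⟩
  change (m * n ∈ S ∧ ¬ p ∣ m * n) ↔ (m ∈ S ∧ ¬ p ∣ m) ∧ (n ∈ S ∧ ¬ p ∣ n)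
  rw [hS.2 m n hm hn hmn, hp.dvd_mul]
  tauto

lemma isPrimeRegular_coprimePart {S : Set ℕ} {δ ρ : ℝ} (h : IsPrimeRegular S δ ρ) {p : ℕ}
    (hp : p.Prime) : IsPrimeRegular (coprimePart S p) δ ρ := by
  refine ⟨isMultiplicativeSet_coprimePart h.mult hp, h.density_pos, h.density_lt,
    h.exponent_pos, h.exponent_le, ?_⟩
  obtain ⟨C, hC0, hC⟩ := h.bound
  have hρ := h.exponent_pos
  set A := (2 * (1 + ρ)) ^ (1 + ρ) with hA
  have hA0 : 0 ≤ A := by positivity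
  have hl := log_natCast_nonneg p
  refine ⟨C + log p * A, by positivity, fun u hu => ?_⟩
  have h1 : |logSum (primeWeight (coprimePart S p)) u - logSum (primeWeight S) u| ≤ log p := by
    rw [logSum, logSum, ← Finset.sum_sub_distrib]
    have e : ∀ n, primeWeight (coprimePart S p) n - primeWeight S n =
        if n = p then - primeWeight S p else 0 := by
      intro n
      split_ifs with hn
      · subst hn
        simp [primeWeight, hp, chiS_coprimePart]
      · rw [primeWeight, primeWeight, chiS_coprimePart]
        split_ifs with h1 h2
        · exact absurd ((Nat.prime_dvd_prime_iff_eq hp h1).1 h2).symm hn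
        · simp
        · simp
    simp_rw [e]
    rw [Finset.sum_ite_eq']
    split_ifs
    · rw [abs_neg, abs_of_nonneg (primeWeight_nonneg S p), primeWeight, if_pos hp]
      exact mul_le_of_le_one_left hl (chiS_le_one S p)
    · simpa using hl
  have h2 : 1 ≤ A * (exp u * (1 + u) ^ (-(1 + ρ))) := by
    have h3 := one_add_rpow_le_exp_half (k := 1 + ρ) (by linarith) hu
    have h4 : exp (u / 2) ≤ exp u := exp_le_exp.2 (by linarith)
    have h5 : (1 + u) ^ (-(1 + ρ)) * (1 + u) ^ (1 + ρ) = 1 := by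
      rw [← rpow_add (by linarith)]; simp
    have h6 : (1 + u) ^ (1 + ρ) ≤ A * exp u := h3.trans (mul_le_mul_of_nonneg_left h4 hA0)
    calc 1 = (1 + u) ^ (-(1 + ρ)) * (1 + u) ^ (1 + ρ) := h5.symm
      _ ≤ (1 + u) ^ (-(1 + ρ)) * (A * exp u) :=
          mul_le_mul_of_nonneg_left h6 (rpow_nonneg (by linarith) _)
      _ = _ := by ring
  have h3 := mul_le_mul_of_nonneg_left h2 hl
  have h4 := hC u hu
  rw [abs_le] at h1 h4 ⊢
  constructor <;> linarith [h1.1, h1.2, h4.1, h4.2]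

lemma exists_dens_sub_mul_rpow_le {S : Set ℕ} {δ ρ : ℝ} (h : IsPrimeRegular S δ ρ) :
    ∃ D : ℝ, 0 ≤ D ∧ ∀ u w : ℝ, 0 ≤ u → 0 ≤ w → dens S (u - w) * u ^ (1 - δ) ≤ D * (1 + w) := by
  obtain ⟨D, hD0, hD⟩ := exists_dens_le_rpow h
  have hδ := h.density_pos
  have hδ1 := h.density_lt
  refine ⟨D, hD0, fun u w hu hw => ?_⟩
  rcases lt_or_ge u w with hlt | hle
  · rw [dens_of_neg S (by linarith), zero_mul]; positivity
  have h1 : u ^ (1 - δ) ≤ (1 + w) * (1 + (u - w)) ^ (1 - δ) := by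
    calc u ^ (1 - δ) ≤ ((1 + w) * (1 + (u - w))) ^ (1 - δ) :=
          rpow_le_rpow hu (by nlinarith) (by linarith)
      _ = (1 + w) ^ (1 - δ) * (1 + (u - w)) ^ (1 - δ) :=
          mul_rpow (by linarith) (by linarith)
      _ ≤ _ := by
          refine mul_le_mul_of_nonneg_right ?_ (rpow_nonneg (by linarith) _)
          conv_rhs => rw [← rpow_one (1 + w)]
          exact rpow_le_rpow_of_exponent_le (by linarith) (by linarith)
  have h2 : (1 + (u - w)) ^ (δ - 1) * (1 + (u - w)) ^ (1 - δ) = 1 := by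
    rw [← rpow_add (by linarith)]; simp
  calc _ ≤ D * (1 + (u - w)) ^ (δ - 1) * ((1 + w) * (1 + (u - w)) ^ (1 - δ)) :=
        mul_le_mul (hD _ (by linarith)) h1 (rpow_nonneg hu _)
          (mul_nonneg hD0 (rpow_nonneg (by linarith) _))
    _ = D * (1 + w) * ((1 + (u - w)) ^ (δ - 1) * (1 + (u - w)) ^ (1 - δ)) := by ring
    _ = _ := by rw [h2, mul_one]

lemma tendsto_dens_sub_mul_rpow {S : Set ℕ} {δ C₀ : ℝ}
    (hC : Tendsto (fun u => dens S u / u ^ (δ - 1)) atTop (nhds C₀)) (w : ℝ) :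
    Tendsto (fun u => dens S (u - w) * u ^ (1 - δ)) atTop (nhds C₀) := by
  have h1 : Tendsto (fun u : ℝ => u - w) atTop atTop := tendsto_atTop_add_const_right _ _ tendsto_id
  have h2 := hC.comp h1
  have h3 : Tendsto (fun u : ℝ => (u - w) / u) atTop (nhds 1) := by
    have : Tendsto (fun u : ℝ => 1 - w / u) atTop (nhds (1 - 0)) :=
      tendsto_const_nhds.sub (tendsto_const_nhds.div_atTop tendsto_id)
    rw [sub_zero] at this
    refine this.congr' ?_
    filter_upwards [eventually_gt_atTop 0] with u hu
    field_simp
  have h4 : Tendsto (fun u : ℝ => ((u - w) / u) ^ (δ - 1)) atTop (nhds 1) := by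
    have := h3.rpow_const (p := δ - 1) (Or.inl one_ne_zero)
    rwa [one_rpow] at this
  have h5 := h2.mul h4
  rw [mul_one] at h5
  refine h5.congr' ?_
  filter_upwards [eventually_gt_atTop 0, eventually_gt_atTop w] with u hu huw
  have hp : 0 < (u - w) ^ (δ - 1) := rpow_pos_of_pos (by linarith) _
  rw [Function.comp, div_rpow (by linarith) hu.le, ← neg_sub δ 1, rpow_neg hu.le]
  field_simp

lemma tendsto_integral_dens_mul_exp {S : Set ℕ} {δ ρ C₀ : ℝ} (h : IsPrimeRegular S δ ρ)
    (hC : Tendsto (fun u => dens S u / u ^ (δ - 1)) atTop (nhds C₀)) :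
    Tendsto (fun u => (∫ v in (0:ℝ)..u, dens S v * exp (v - u)) * u ^ (1 - δ)) atTop
      (nhds (∫ w in Set.Ioi (0:ℝ), C₀ * exp (-w))) := by
  obtain ⟨D, hD0, hD⟩ := exists_dens_sub_mul_rpow_le h
  have e : ∀ᶠ u : ℝ in atTop, ∫ w in Set.Ioi (0:ℝ), dens S (u - w) * u ^ (1 - δ) * exp (-w) =
      (∫ v in (0:ℝ)..u, dens S v * exp (v - u)) * u ^ (1 - δ) := by
    filter_upwards [eventually_ge_atTop 0] with u hu
    have h1 := intervalIntegral.integral_comp_sub_left (a := 0) (b := u)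
      (fun v => dens S v * exp (v - u)) u
    simp only [sub_self, sub_zero] at h1
    rw [← h1, intervalIntegral.integral_of_le hu, ← MeasureTheory.integral_mul_const]
    have h2 := MeasureTheory.setIntegral_eq_of_subset_of_forall_sdiff_eq_zero
      (μ := MeasureTheory.volume) (f := fun w => dens S (u - w) * u ^ (1 - δ) * exp (-w))
      (t := Set.Ioi 0) (s := Set.Ioc 0 u) measurableSet_Ioi Set.Ioc_subset_Ioi_self
      (fun w hw => by
        have h3 : u < w := by
          by_contra hcon
          exact hw.2 ⟨hw.1, not_lt.1 hcon⟩
        rw [dens_of_neg S (by linarith), zero_mul, zero_mul])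
    rw [h2]
    refine MeasureTheory.integral_congr_ae (Eventually.of_forall fun w => ?_)
    have : u - w - u = -w := by ring
    simp only [this]
    ring
  refine Tendsto.congr' e ?_
  refine MeasureTheory.tendsto_integral_filter_of_dominated_convergence
    (fun w => D * ((1 + w) * exp (-w))) ?_ ?_ ?_ ?_
  · refine Eventually.of_forall fun u => ?_
    exact ((((measurable_dens S).comp (measurable_const.sub measurable_id)).mul_const _).mul
      (measurable_exp.comp measurable_neg)).aestronglyMeasurable
  · filter_upwards [eventually_ge_atTop 0] with u hu
    refine (MeasureTheory.ae_restrict_iff' measurableSet_Ioi).2 (Eventually.of_forall ?_)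
    intro w hw
    have hw0 : 0 ≤ w := (Set.mem_Ioi.1 hw).le
    rw [Real.norm_eq_abs, abs_of_nonneg (mul_nonneg (mul_nonneg (dens_nonneg S _)
      (rpow_nonneg hu _)) (exp_pos _).le), ← mul_assoc]
    exact mul_le_mul_of_nonneg_right (hD u w hu hw0) (exp_pos _).le
  · have h1 := (Real.GammaIntegral_convergent (s := 1) one_pos)
    have h2 := (Real.GammaIntegral_convergent (s := 2) two_pos)
    refine ((h1.add h2).congr_fun (fun w hw => ?_) measurableSet_Ioi).const_mul D
    have : (2:ℝ) - 1 = 1 := by norm_num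
    simp only [Pi.add_apply, sub_self, rpow_zero, this, rpow_one]
    ring
  · exact Eventually.of_forall fun w => (tendsto_dens_sub_mul_rpow hC w).mul_const _

lemma tendsto_densInt_sub {S : Set ℕ} {δ ρ C₀ : ℝ} (h : IsPrimeRegular S δ ρ)
    (hC : Tendsto (fun u => dens S u / u ^ (δ - 1)) atTop (nhds C₀)) {V : ℝ} (hV : 0 ≤ V) :
    Tendsto (fun u => (densInt S u - densInt S (u - V)) * u ^ (1 - δ)) atTop
      (nhds (C₀ * V)) := by
  obtain ⟨D, hD0, hD⟩ := exists_dens_sub_mul_rpow_le h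
  have e : ∀ u : ℝ, ∫ w in (0:ℝ)..V, dens S (u - w) * u ^ (1 - δ) =
      (densInt S u - densInt S (u - V)) * u ^ (1 - δ) := by
    intro u
    rw [intervalIntegral.integral_mul_const, intervalIntegral.integral_comp_sub_left
      (fun v => dens S v) u, sub_zero, densInt, densInt,
      intervalIntegral.integral_interval_sub_left (intervalIntegrable_dens S _ _)
        (intervalIntegrable_dens S _ _)]
  simp_rw [← e]
  have e2 : C₀ * V = ∫ _ in (0:ℝ)..V, C₀ := by simp [mul_comm]
  rw [e2]
  refine intervalIntegral.tendsto_integral_filter_of_dominated_convergence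
    (fun w => D * (1 + w)) ?_ ?_ ?_ ?_
  · refine Eventually.of_forall fun u => ?_
    exact (((measurable_dens S).comp (measurable_const.sub measurable_id)).mul_const
      _).aestronglyMeasurable
  · filter_upwards [eventually_ge_atTop 0] with u hu
    refine Eventually.of_forall fun w hw => ?_
    rw [Set.uIoc_of_le hV] at hw
    rw [Real.norm_eq_abs, abs_of_nonneg (mul_nonneg (dens_nonneg S _) (rpow_nonneg hu _))]
    exact hD u w hu hw.1.le
  · exact Continuous.intervalIntegrable (by fun_prop) _ _
  · exact Eventually.of_forall fun w _ => tendsto_dens_sub_mul_rpow hC w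

lemma exists_tendsto_tsum_remTerm {S : Set ℕ} {δ ρ : ℝ} (h : IsPrimeRegular S δ ρ) :
    ∃ L, Tendsto (fun u => (∑' q, remTerm S u q) * u ^ (1 - δ)) atTop (nhds L) := by
  obtain ⟨D, hD0, hD⟩ := exists_dens_sub_mul_rpow_le h
  have hlim : ∀ q : ℕ × ℕ, ∃ c, Tendsto (fun u => remTerm S u q * u ^ (1 - δ)) atTop
      (nhds c) := by
    rintro ⟨p, k⟩
    by_cases hp : p.Prime
    · obtain ⟨c, -, hc, -⟩ := exists_tendsto_dens (isPrimeRegular_coprimePart h hp)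
      refine ⟨_, ((tendsto_dens_sub_mul_rpow hc (((k:ℝ) + 2) * log p)).const_mul
        (remCoeff S p k / (p:ℝ) ^ (k + 2))).congr fun u => ?_⟩
      rw [remTerm]; ring
    · refine ⟨0, tendsto_const_nhds.congr fun u => ?_⟩
      simp [remTerm, remCoeff, hp]
  choose c hc using hlim
  refine ⟨∑' q, c q, ?_⟩
  simp_rw [← tsum_mul_right]
  refine tendsto_tsum_of_dominated_convergence ((summable_remWeight_mul S).mul_left D) hc ?_
  filter_upwards [eventually_ge_atTop 0] with u hu
  intro q
  have hw := mul_log_natCast_nonneg q.2 q.1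
  rw [norm_mul, Real.norm_eq_abs, Real.norm_eq_abs, abs_of_nonneg (rpow_nonneg hu _)]
  calc _ ≤ remWeight S q * dens S (u - ((q.2:ℝ) + 2) * log q.1) * u ^ (1 - δ) :=
        mul_le_mul_of_nonneg_right (abs_remTerm_le S u q) (rpow_nonneg hu _)
    _ = remWeight S q * (dens S (u - ((q.2:ℝ) + 2) * log q.1) * u ^ (1 - δ)) := by ring
    _ ≤ remWeight S q * (D * (1 + ((q.2:ℝ) + 2) * log q.1)) :=
        mul_le_mul_of_nonneg_left (hD u _ hu hw) (remWeight_nonneg S q)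
    _ = _ := by ring

lemma rpow_mul_rpow_le_add {a x y δ ρ : ℝ} (ha : 0 < a) (hx : 0 < x) (hxy : x ≤ y)
    (hδ : 0 < δ) (hδ1 : δ < 1) (hρ : 0 < ρ) (hρ1 : ρ ≤ 1) (h : y / 2 ≤ x ∨ y / 2 ≤ a) :
    a ^ (-(1 + ρ)) * x ^ (δ - 1) ≤
      2 * y ^ (δ - 1) * a ^ (-(1 + ρ)) + 4 * y ^ (δ - 1 - ρ / 2) * x ^ (-(1 + ρ / 2)) := by
  have hy : 0 < y := hx.trans_le hxy
  have h1 : 0 < a ^ (-(1 + ρ)) := rpow_pos_of_pos ha _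
  have h2 : 0 < y ^ (δ - 1) := rpow_pos_of_pos hy _
  have h3 : 0 < y ^ (δ - 1 - ρ / 2) := rpow_pos_of_pos hy _
  have h4 : 0 < x ^ (-(1 + ρ / 2)) := rpow_pos_of_pos hx _
  have hhalf : ∀ {b c e : ℝ}, 0 ≤ e → e ≤ 2 → y / 2 ≤ b → b ^ (-e) ≤ 2 ^ e * y ^ (-e) := by
    intro b c e he _ hb
    have := rpow_le_rpow_of_nonpos (half_pos hy) hb (by linarith : -e ≤ 0)
    rwa [div_rpow hy.le zero_le_two, rpow_neg zero_le_two, div_inv_eq_mul, mul_comm] at this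
  rcases h with h | h
  · have h5 : x ^ (δ - 1) ≤ 2 * y ^ (δ - 1) := by
      have := hhalf (c := 0) (e := 1 - δ) (by linarith) (by linarith) h
      rw [neg_sub] at this
      refine this.trans (mul_le_mul_of_nonneg_right ?_ h2.le)
      conv_rhs => rw [← rpow_one (2:ℝ)]
      exact rpow_le_rpow_of_exponent_le one_le_two (by linarith)
    calc _ ≤ a ^ (-(1 + ρ)) * (2 * y ^ (δ - 1)) := mul_le_mul_of_nonneg_left h5 h1.le
      _ = 2 * y ^ (δ - 1) * a ^ (-(1 + ρ)) := by ring
      _ ≤ _ := le_add_of_nonneg_right (by positivity)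
  · have h5 : a ^ (-(1 + ρ)) ≤ 4 * y ^ (-(1 + ρ)) := by
      refine (hhalf (c := 0) (by linarith) (by linarith) h).trans
        (mul_le_mul_of_nonneg_right ?_ (rpow_nonneg hy.le _))
      have : (2:ℝ) ^ (1 + ρ) ≤ 2 ^ (2:ℝ) :=
        rpow_le_rpow_of_exponent_le one_le_two (by linarith)
      norm_num at this ⊢
      exact this
    have h6 : x ^ (δ - 1) ≤ x ^ (-(1 + ρ / 2)) * y ^ (δ + ρ / 2) := by
      have e : x ^ (δ - 1) = x ^ (-(1 + ρ / 2)) * x ^ (δ + ρ / 2) := by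
        rw [← rpow_add hx]; ring_nf
      rw [e]
      exact mul_le_mul_of_nonneg_left (rpow_le_rpow hx.le hxy (by linarith)) h4.le
    have e : y ^ (δ - 1 - ρ / 2) = y ^ (-(1 + ρ)) * y ^ (δ + ρ / 2) := by
      rw [← rpow_add hy]; ring_nf
    calc _ ≤ 4 * y ^ (-(1 + ρ)) * (x ^ (-(1 + ρ / 2)) * y ^ (δ + ρ / 2)) :=
          mul_le_mul h5 h6 (rpow_nonneg hx.le _) (by positivity)
      _ = 4 * y ^ (δ - 1 - ρ / 2) * x ^ (-(1 + ρ / 2)) := by rw [e]; ring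
      _ ≤ _ := le_add_of_nonneg_left (by positivity)

/-- The tail `∑_{j ≥ V} (1 + j)^{-(1+ρ)}`. -/
noncomputable def rpowTail (ρ : ℝ) (V : ℕ) : ℝ := ∑' j : ℕ, (1 + ((j + V : ℕ) : ℝ)) ^ (-(1 + ρ))

lemma tendsto_rpowTail (ρ : ℝ) : Tendsto (rpowTail ρ) atTop (nhds 0) :=
  tendsto_sum_nat_add fun j : ℕ => (1 + (j:ℝ)) ^ (-(1 + ρ))

lemma sum_range_le_rpowTail {ρ : ℝ} (hρ : 0 < ρ) (V n : ℕ) :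
    ∑ j ∈ Finset.range n, (1 + (V:ℝ) + j) ^ (-(1 + ρ)) ≤ rpowTail ρ V := by
  have hs := (summable_nat_add_iff V).2 (summable_one_add_rpow (a := 1 + ρ) (by linarith))
  have h1 := hs.sum_le_tsum (Finset.range n) fun j _ => by positivity
  refine le_trans (le_of_eq (Finset.sum_congr rfl fun j _ => ?_)) h1
  push_cast
  ring_nf

lemma exists_kerSum_le {S : Set ℕ} {δ ρ : ℝ} (h : IsPrimeRegular S δ ρ) :
    ∃ D : ℝ, 0 ≤ D ∧ ∀ (V : ℕ) (w : ℝ), 0 ≤ w →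
      (1 + (V:ℝ)) ^ (-(1 + ρ)) * dens S w +
        kerSum S (fun t => (1 + (V:ℝ) + t) ^ (-(1 + ρ))) w ≤
      D * ((1 + w) ^ (δ - 1) * (rpowTail ρ V + (1 + w) ^ (-(ρ / 2)))) := by
  obtain ⟨D, hD0, hD⟩ := exists_dens_le_rpow h
  have hδ := h.density_pos
  have hδ1 := h.density_lt
  have hρ := h.exponent_pos
  have hρ1 := h.exponent_le
  have hZs := summable_one_add_rpow (a := 1 + ρ / 2) (by linarith)
  set Z := ∑' j : ℕ, (1 + (j:ℝ)) ^ (-(1 + ρ / 2)) with hZ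
  have hZ0 : 0 ≤ Z := tsum_nonneg fun j => by positivity
  refine ⟨D + exp 1 * (D * (2 + 4 * Z)), by positivity, fun V w hw => ?_⟩
  have hy : 0 < 1 + w := by linarith
  have hY := rpow_pos_of_pos hy (δ - 1)
  have hY2 := rpow_pos_of_pos hy (-(ρ / 2))
  have hτ : (1 + (V:ℝ)) ^ (-(1 + ρ)) ≤ rpowTail ρ V := by
    simpa using sum_range_le_rpowTail hρ V 1
  have hτ0 : 0 ≤ rpowTail ρ V := le_trans (by positivity) hτ
  have h1 : (1 + (V:ℝ)) ^ (-(1 + ρ)) * dens S w ≤ rpowTail ρ V * (D * (1 + w) ^ (δ - 1)) :=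
    mul_le_mul hτ (hD w hw) (dens_nonneg S w) hτ0
  have h2 := kerSum_le_sum_range (S := S) (antitoneOn_one_add_rpow hρ V.cast_nonneg)
    (fun t ht => by positivity) w
  have h3 : ∀ j ∈ Finset.range (⌊w⌋₊ + 1),
      (1 + (V:ℝ) + j) ^ (-(1 + ρ)) * dens S (w - j) ≤
        D * (2 * (1 + w) ^ (δ - 1) * (1 + (V:ℝ) + j) ^ (-(1 + ρ)) +
          4 * (1 + w) ^ (δ - 1 - ρ / 2) * (1 + ((⌊w⌋₊ + 1 - 1 - j : ℕ) : ℝ)) ^ (-(1 + ρ / 2))) := by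
    intro j hj
    have hjw : j ≤ ⌊w⌋₊ := Nat.lt_succ_iff.1 (Finset.mem_range.1 hj)
    have hfl := Nat.floor_le hw
    have hjw' : (j:ℝ) ≤ ⌊w⌋₊ := by exact_mod_cast hjw
    have hj0 : (0:ℝ) ≤ j := j.cast_nonneg
    have hV0 : (0:ℝ) ≤ V := V.cast_nonneg
    have h4 := rpow_mul_rpow_le_add (a := 1 + (V:ℝ) + j) (x := 1 + (w - j)) (y := 1 + w)
      (by positivity) (by linarith) (by linarith) hδ hδ1 hρ hρ1 (by
        rcases le_total (j:ℝ) (w / 2) with h5 | h5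
        · left; linarith
        · right; linarith)
    have h5 : (1 + (w - j)) ^ (-(1 + ρ / 2)) ≤
        (1 + ((⌊w⌋₊ + 1 - 1 - j : ℕ) : ℝ)) ^ (-(1 + ρ / 2)) := by
      refine rpow_le_rpow_of_nonpos (by positivity) ?_ (by linarith)
      rw [Nat.add_sub_cancel, Nat.cast_sub hjw]
      linarith
    calc _ ≤ (1 + (V:ℝ) + j) ^ (-(1 + ρ)) * (D * (1 + (w - j)) ^ (δ - 1)) :=
          mul_le_mul_of_nonneg_left (hD _ (by linarith)) (by positivity)
      _ = D * ((1 + (V:ℝ) + j) ^ (-(1 + ρ)) * (1 + (w - j)) ^ (δ - 1)) := by ring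
      _ ≤ _ := by
        refine mul_le_mul_of_nonneg_left (h4.trans ?_) hD0
        gcongr
  have h4 : ∑ j ∈ Finset.range (⌊w⌋₊ + 1), (1 + (V:ℝ) + j) ^ (-(1 + ρ)) * dens S (w - j) ≤
      D * (2 * (1 + w) ^ (δ - 1) * rpowTail ρ V + 4 * (1 + w) ^ (δ - 1 - ρ / 2) * Z) := by
    refine (Finset.sum_le_sum h3).trans ?_
    rw [← Finset.mul_sum, Finset.sum_add_distrib, ← Finset.mul_sum, ← Finset.mul_sum,
      Finset.sum_range_reflect (fun i : ℕ => (1 + (i:ℝ)) ^ (-(1 + ρ / 2)))]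
    have h5 := sum_range_le_rpowTail hρ V (⌊w⌋₊ + 1)
    have h6 := hZs.sum_le_tsum (Finset.range (⌊w⌋₊ + 1)) fun j _ => by positivity
    gcongr
  have e : (1 + w) ^ (δ - 1 - ρ / 2) = (1 + w) ^ (δ - 1) * (1 + w) ^ (-(ρ / 2)) := by
    rw [← rpow_add hy]; ring_nf
  rw [e] at h4
  have h5 := mul_le_mul_of_nonneg_left h4 (exp_pos 1).le
  refine (add_le_add h1 (h2.trans h5)).trans ?_
  have h6 : 0 ≤ D * ((1 + w) ^ (δ - 1) * (1 + w) ^ (-(ρ / 2))) := by positivity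
  have h7 : 0 ≤ exp 1 * (D * ((1 + w) ^ (δ - 1) * (1 + w) ^ (-(ρ / 2)))) := by positivity
  have h8 : 0 ≤ exp 1 * (D * Z * ((1 + w) ^ (δ - 1) * rpowTail ρ V)) := by positivity
  nlinarith

lemma exists_abs_primeTail_mul_rpow_le {S : Set ℕ} {δ ρ : ℝ} (h : IsPrimeRegular S δ ρ) :
    ∃ D : ℝ, 0 ≤ D ∧ ∀ (V : ℕ) (u : ℝ), 2 * (V:ℝ) ≤ u →
      |(primeTail S V u - δ * densInt S (u - V)) * u ^ (1 - δ)| ≤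
        D * rpowTail ρ V + D * (1 + u) ^ (-(ρ / 2)) := by
  obtain ⟨C, hC0, hC⟩ := h.bound
  obtain ⟨D, hD0, hD⟩ := exists_kerSum_le h
  have hδ := h.density_pos
  have hδ1 := h.density_lt
  have hρ := h.exponent_pos
  have hρ1 := h.exponent_le
  refine ⟨4 * (C * D), by positivity, fun V u hu => ?_⟩
  have hV0 : (0:ℝ) ≤ V := V.cast_nonneg
  set w := u - V with hw
  have hw0 : 0 ≤ w := by linarith
  have hu0 : 0 ≤ u := by linarith
  have hy : 0 < 1 + w := by linarith
  have hτ0 : 0 ≤ rpowTail ρ V := tsum_nonneg fun j => by positivity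
  have h1 := abs_primeTail_sub_le hC hV0 (by linarith : (V:ℝ) ≤ u)
  have h2 := mul_le_mul_of_nonneg_left (hD V w hw0) hC0
  have htwo : ∀ {e : ℝ}, e ≤ 1 → (2:ℝ) ^ e ≤ 2 := fun he => by
    conv_rhs => rw [← rpow_one (2:ℝ)]
    exact rpow_le_rpow_of_exponent_le one_le_two he
  have h3 : u ^ (1 - δ) ≤ 2 * (1 + w) ^ (1 - δ) := by
    calc u ^ (1 - δ) ≤ (2 * (1 + w)) ^ (1 - δ) :=
          rpow_le_rpow hu0 (by linarith) (by linarith)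
      _ = 2 ^ (1 - δ) * (1 + w) ^ (1 - δ) := mul_rpow zero_le_two hy.le
      _ ≤ _ := mul_le_mul_of_nonneg_right (htwo (by linarith)) (rpow_nonneg hy.le _)
  have h4 : (1 + w) ^ (-(ρ / 2)) ≤ 2 * (1 + u) ^ (-(ρ / 2)) := by
    have h5 : (2 * (1 + w)) ^ (-(ρ / 2)) ≤ (1 + u) ^ (-(ρ / 2)) :=
      rpow_le_rpow_of_nonpos (by linarith) (by linarith) (by linarith)
    rw [mul_rpow zero_le_two hy.le, rpow_neg zero_le_two, inv_mul_eq_div,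
      div_le_iff₀ (by positivity)] at h5
    refine h5.trans ?_
    rw [mul_comm]
    exact mul_le_mul_of_nonneg_right (htwo (by linarith)) (rpow_nonneg (by linarith) _)
  have h5 : (1 + w) ^ (δ - 1) * (1 + w) ^ (1 - δ) = 1 := by
    rw [← rpow_add hy]; simp
  have hX := rpow_nonneg hy.le (-(ρ / 2))
  rw [abs_mul, abs_of_nonneg (rpow_nonneg hu0 _)]
  calc _ ≤ C * (D * ((1 + w) ^ (δ - 1) * (rpowTail ρ V + (1 + w) ^ (-(ρ / 2))))) *
        (2 * (1 + w) ^ (1 - δ)) :=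
        mul_le_mul (h1.trans h2) h3 (rpow_nonneg hu0 _) (by positivity)
    _ = 2 * (C * D) * (rpowTail ρ V + (1 + w) ^ (-(ρ / 2))) *
        ((1 + w) ^ (δ - 1) * (1 + w) ^ (1 - δ)) := by ring
    _ = 2 * (C * D) * (rpowTail ρ V + (1 + w) ^ (-(ρ / 2))) := by rw [h5, mul_one]
    _ ≤ 2 * (C * D) * (2 * rpowTail ρ V + 2 * (1 + u) ^ (-(ρ / 2))) := by
        gcongr; linarith
    _ = _ := by ring

lemma exists_tendsto_of_approx {g : ℝ → ℝ} {a : ℕ → ℝ → ℝ} {α τ : ℕ → ℝ} {e : ℝ → ℝ}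
    (ha : ∀ V, Tendsto (a V) atTop (nhds (α V))) (hτ : Tendsto τ atTop (nhds 0))
    (he : Tendsto e atTop (nhds 0)) (h : ∀ V, ∀ᶠ u in atTop, |g u - a V u| ≤ τ V + e u) :
    ∃ G, Tendsto g atTop (nhds G) ∧ Tendsto α atTop (nhds G) := by
  have hcauchy : Cauchy (map g atTop) := by
    refine Metric.cauchy_iff.2 ⟨inferInstance, fun ε hε => ?_⟩
    obtain ⟨V, hV⟩ := (hτ.eventually_lt_const (by positivity : 0 < ε / 6)).exists
    have h1 := (ha V).eventually (Metric.ball_mem_nhds _ (by positivity : 0 < ε / 6))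
    have h2 := he.eventually_lt_const (by positivity : 0 < ε / 6)
    refine ⟨g '' {u | |g u - α V| < ε / 2}, image_mem_map ?_, ?_⟩
    · filter_upwards [h V, h1, h2] with u hu hu1 hu2
      rw [Real.dist_eq] at hu1
      have := abs_sub_le (g u) (a V u) (α V)
      change |g u - α V| < ε / 2
      linarith
    · rintro _ ⟨x, hx, rfl⟩ _ ⟨y, hy, rfl⟩
      have h3 := abs_sub_le (g x) (α V) (g y)
      rw [abs_sub_comm (α V)] at h3
      have hx' : |g x - α V| < ε / 2 := hx
      have hy' : |g y - α V| < ε / 2 := hy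
      rw [Real.dist_eq]
      linarith
  obtain ⟨G, hG⟩ := CompleteSpace.complete hcauchy
  have hG' : Tendsto g atTop (nhds G) := hG
  refine ⟨G, hG', ?_⟩
  rw [tendsto_iff_dist_tendsto_zero]
  refine squeeze_zero (fun V => dist_nonneg) (fun V => ?_) hτ
  rw [dist_comm, Real.dist_eq]
  have h1 := (hG'.sub (ha V)).abs
  have h2 := he.const_add (τ V)
  rw [add_zero] at h2
  exact le_of_tendsto_of_tendsto h1 h2 (h V)

lemma primeTail_zero_eq (S : Set ℕ) {V u : ℝ} (hu : V ≤ u) :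
    primeTail S 0 u = primeTail S V u +
      ∑ p ∈ Finset.Icc 1 ⌊exp V⌋₊, primeWeight S p / p * dens S (u - log p) := by
  rw [primeTail_zero, ← Finset.sum_filter_add_sum_filter_not _ (fun p : ℕ => V < log p),
    primeTail]
  congr 1
  refine Finset.sum_congr (Finset.ext fun p => ?_) fun _ _ => rfl
  rw [Finset.mem_filter, mem_Icc_floor_exp, mem_Icc_floor_exp, not_lt]
  constructor
  · rintro ⟨⟨h1, _⟩, h2⟩; exact ⟨h1, h2⟩
  · rintro ⟨h1, h2⟩; exact ⟨⟨h1, by linarith⟩, h2⟩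

lemma exists_tendsto_primeTail_zero_sub {S : Set ℕ} {δ ρ C₀ : ℝ} (h : IsPrimeRegular S δ ρ)
    (hC : Tendsto (fun u => dens S u / u ^ (δ - 1)) atTop (nhds C₀)) :
    ∃ G, Tendsto (fun u => (primeTail S 0 u - δ * densInt S u) * u ^ (1 - δ)) atTop (nhds G) ∧
      Tendsto (fun V : ℕ => C₀ * (logSum (fun p => primeWeight S p / p) V - δ * V)) atTop
        (nhds G) := by
  obtain ⟨D, hD0, hD⟩ := exists_abs_primeTail_mul_rpow_le h
  have hρ := h.exponent_pos
  refine exists_tendsto_of_approx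
    (a := fun V u => (∑ p ∈ Finset.Icc 1 ⌊exp V⌋₊,
      primeWeight S p / p * (dens S (u - log p) * u ^ (1 - δ))) -
        δ * ((densInt S u - densInt S (u - V)) * u ^ (1 - δ)))
    (τ := fun V => D * rpowTail ρ V) (e := fun u => D * (1 + u) ^ (-(ρ / 2))) ?_ ?_ ?_ ?_
  · intro V
    have h1 : Tendsto (fun u => ∑ p ∈ Finset.Icc 1 ⌊exp (V:ℝ)⌋₊,
        primeWeight S p / p * (dens S (u - log p) * u ^ (1 - δ))) atTop
        (nhds (∑ p ∈ Finset.Icc 1 ⌊exp (V:ℝ)⌋₊, primeWeight S p / p * C₀)) :=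
      tendsto_finsetSum _ fun p _ => (tendsto_dens_sub_mul_rpow hC (log p)).const_mul _
    have h2 := (tendsto_densInt_sub h hC (V.cast_nonneg (α := ℝ))).const_mul δ
    have e : C₀ * (logSum (fun p => primeWeight S p / p) V - δ * V) =
        (∑ p ∈ Finset.Icc 1 ⌊exp (V:ℝ)⌋₊, primeWeight S p / p * C₀) - δ * (C₀ * V) := by
      rw [logSum, ← Finset.sum_mul]; ring
    rw [e]
    exact h1.sub h2
  · simpa using (tendsto_rpowTail ρ).const_mul D
  · have h1 : Tendsto (fun u : ℝ => (1 + u) ^ (-(ρ / 2))) atTop (nhds 0) :=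
      (tendsto_rpow_neg_atTop (half_pos hρ)).comp
        (tendsto_atTop_add_const_left atTop (1:ℝ) tendsto_id)
    simpa using h1.const_mul D
  · intro V
    filter_upwards [eventually_ge_atTop (2 * (V:ℝ))] with u hu
    have hV0 : (0:ℝ) ≤ V := V.cast_nonneg
    refine le_trans (le_of_eq ?_) (hD V u hu)
    congr 1
    have e2 : ∑ p ∈ Finset.Icc 1 ⌊exp (V:ℝ)⌋₊,
        primeWeight S p / p * (dens S (u - log p) * u ^ (1 - δ)) =
        (∑ p ∈ Finset.Icc 1 ⌊exp (V:ℝ)⌋₊, primeWeight S p / p * dens S (u - log p)) *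
          u ^ (1 - δ) := by
      rw [Finset.sum_mul]
      exact Finset.sum_congr rfl fun p _ => by ring
    rw [primeTail_zero_eq S (by linarith : (V:ℝ) ≤ u), e2]
    ring

lemma exists_tendsto_mul_dens_sub {S : Set ℕ} {δ ρ : ℝ} (h : IsPrimeRegular S δ ρ) :
    ∃ K, Tendsto (fun u => (u * dens S u - δ * densInt S u) * u ^ (1 - δ)) atTop (nhds K) := by
  obtain ⟨C₀, hC0, hC, -⟩ := exists_tendsto_dens h
  obtain ⟨L, hL⟩ := exists_tendsto_tsum_remTerm h
  obtain ⟨G, hG, -⟩ := exists_tendsto_primeTail_zero_sub h hC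
  refine ⟨_, (((tendsto_integral_dens_mul_exp h hC).add hG).add hL).congr' ?_⟩
  filter_upwards [eventually_ge_atTop 0] with u hu
  rw [mul_dens_eq h.mult hu, ← primeTail_zero]
  ring

lemma exists_tendsto_logSum_primeWeight {S : Set ℕ} {δ ρ : ℝ} (h : IsPrimeRegular S δ ρ) :
    ∃ A, Tendsto (fun V : ℕ => logSum (fun p => primeWeight S p / p) V - δ * V) atTop
      (nhds A) := by
  obtain ⟨C₀, hC0, hC, -⟩ := exists_tendsto_dens h
  obtain ⟨G, -, hG⟩ := exists_tendsto_primeTail_zero_sub h hC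
  refine ⟨_, (hG.div_const C₀).congr fun V => ?_⟩
  field_simp

lemma tendsto_mul_densInt_sub {S : Set ℕ} {δ C₀ K : ℝ}
    (hI : Tendsto (fun u => densInt S u / u ^ δ) atTop (nhds (C₀ / δ)))
    (hK : Tendsto (fun u => (u * dens S u - δ * densInt S u) * u ^ (1 - δ)) atTop (nhds K)) :
    Tendsto (fun u => u * (densInt S u / u ^ δ - C₀ / δ) + K) atTop (nhds 0) := by
  set f : ℝ → ℝ := fun u => densInt S u * u ^ (-δ) + K * u⁻¹ with hf
  set f' : ℝ → ℝ := fun u => dens S u * u ^ (-δ) + densInt S u * (-δ * u ^ (-δ - 1)) +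
    K * (-(u ^ 2)⁻¹) with hf'
  have hd : ∀ u, 0 < u → HasDerivWithinAt f (f' u) (Set.Ici u) u := by
    intro u hu
    have h1 := hasDerivAt_rpow_const (x := u) (p := -δ) (Or.inl hu.ne')
    have h2 := hasDerivAt_inv hu.ne'
    exact ((hasDerivWithinAt_densInt S u).mul h1.hasDerivWithinAt).add
      (h2.const_mul K).hasDerivWithinAt
  have hf'_eq : ∀ u, 0 < u →
      f' u = ((u * dens S u - δ * densInt S u) * u ^ (1 - δ) - K) * u ^ (-(1 + (1:ℝ))) := by
    intro u hu
    have e1 : u ^ (1 - δ) = u ^ (-δ) * u := by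
      rw [← rpow_add_one hu.ne']; ring_nf
    have e2 : u ^ (-(1 + (1:ℝ))) = (u ^ 2)⁻¹ := by
      rw [rpow_neg hu.le]; norm_num
    have e3 : u ^ (-δ - 1) = u ^ (-δ) * u⁻¹ := by
      rw [rpow_sub_one hu.ne']; ring
    simp only [hf', e1, e2, e3]
    field_simp
    ring
  have hinv : Tendsto (fun u : ℝ => K * u⁻¹) atTop (nhds 0) := by
    simpa using tendsto_inv_atTop_zero.const_mul K
  have hflim : Tendsto f atTop (nhds (C₀ / δ)) := by
    have := hI.add hinv
    rw [add_zero] at this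
    refine this.congr' ?_
    filter_upwards [eventually_gt_atTop 0] with u hu
    simp only [hf, rpow_neg hu.le, div_eq_mul_inv]
  rw [Metric.tendsto_atTop]
  intro ε hε
  obtain ⟨a₀, ha₀⟩ := (Metric.tendsto_atTop.1 hK) (ε / 2) (by positivity)
  set a := max a₀ 1
  have ha : 0 < a := lt_of_lt_of_le one_pos (le_max_right _ _)
  have hcont : ContinuousOn f (Set.Ici a) := by
    intro u hu
    have hu0 : 0 < u := ha.trans_le hu
    exact (((continuous_densInt S).continuousAt.mul
      (continuousAt_rpow_const u _ (Or.inl hu0.ne'))).add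
      ((continuousAt_inv₀ hu0.ne').const_mul K)).continuousWithinAt
  have hbd : ∀ u, a ≤ u → |f' u| ≤ ε / 2 * u ^ (-(1 + (1:ℝ))) := by
    intro u hu
    have hu0 : 0 < u := ha.trans_le hu
    have h1 := ha₀ u ((le_max_left _ _).trans hu)
    rw [Real.dist_eq] at h1
    rw [hf'_eq u hu0, abs_mul, abs_of_nonneg (rpow_nonneg hu0.le (-(1 + (1:ℝ))))]
    exact mul_le_mul_of_nonneg_right h1.le (rpow_nonneg hu0.le _)
  obtain ⟨L, hL, hLb⟩ := exists_tendsto_of_abs_deriv_le ha one_pos hcont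
    (fun u hu => hd u (ha.trans_le hu)) hbd
  rw [tendsto_nhds_unique hL hflim] at hLb
  refine ⟨a, fun u hu => ?_⟩
  have hu0 : 0 < u := ha.trans_le hu
  have h1 := hLb u hu
  rw [rpow_neg_one, div_one] at h1
  have e : u * (densInt S u / u ^ δ - C₀ / δ) + K = u * (f u - C₀ / δ) := by
    simp only [hf, rpow_neg hu0.le]
    field_simp
    ring
  rw [Real.dist_eq, sub_zero, e, abs_mul, abs_of_pos hu0]
  calc u * |f u - C₀ / δ| ≤ u * (ε / 2 * u⁻¹) := by gcongr
    _ = ε / 2 := by field_simp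
    _ < ε := by linarith

lemma tendsto_dens_second_order {S : Set ℕ} {δ C₀ K : ℝ} (hδ : δ ≠ 0) (hC0 : C₀ ≠ 0)
    (hI : Tendsto (fun u => densInt S u / u ^ δ) atTop (nhds (C₀ / δ)))
    (hK : Tendsto (fun u => (u * dens S u - δ * densInt S u) * u ^ (1 - δ)) atTop (nhds K)) :
    Tendsto (fun u => (dens S u / (C₀ * u ^ (δ - 1)) - 1) * u) atTop
      (nhds ((1 - δ) * (K / C₀))) := by
  have h := ((((tendsto_mul_densInt_sub hI hK).const_mul δ).sub_const (δ * K)).add hK).div_const C₀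
  have e : (δ * 0 - δ * K + K) / C₀ = (1 - δ) * (K / C₀) := by field_simp; ring
  rw [e] at h
  refine h.congr' ?_
  filter_upwards [eventually_gt_atTop 0] with u hu
  have e1 : u ^ (1 - δ) = (u ^ δ)⁻¹ * u := by
    rw [← rpow_neg hu.le, ← rpow_add_one hu.ne']; ring_nf
  have e2 : u ^ (δ - 1) = u ^ δ * u⁻¹ := by
    rw [rpow_sub_one hu.ne']; ring
  have h3 : u ^ δ ≠ 0 := (rpow_pos_of_pos hu _).ne'
  rw [e1, e2]
  field_simp
  ring

lemma tendsto_setCount_second_order {S : Set ℕ} {δ C₀ B : ℝ}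
    (h : Tendsto (fun u => (dens S u / (C₀ * u ^ (δ - 1)) - 1) * u) atTop (nhds B)) :
    Tendsto (fun x : ℝ => ((setCount S x : ℝ) / (C₀ * x * log x ^ (δ - 1)) - 1) * log x)
      atTop (nhds B) := by
  refine (h.comp tendsto_log_atTop).congr' ?_
  filter_upwards [eventually_gt_atTop 0] with x hx
  have e := setCount_exp S (log x)
  rw [exp_log hx] at e
  simp only [Function.comp, dens, exp_neg, exp_log hx, e]
  congr 2
  rw [mul_right_comm, div_mul_eq_div_div_swap, div_mul_eq_div_div_swap _ (C₀ * log x ^ (δ - 1))]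
  ring

lemma tendsto_rpow_mul_integral_exp {f : ℝ → ℝ} {δ a : ℝ} (hδ : 0 < δ) (hδ1 : δ < 1)
    (hf : Measurable f) (hb : ∀ u, 0 < u → |f u| ≤ u + 1)
    (ha : Tendsto (fun u => f u * u ^ (1 - δ)) atTop (nhds a)) :
    Tendsto (fun ε => ε ^ δ * ∫ u in Set.Ioi 0, f u * exp (-(ε * u)))
      (nhdsWithin 0 (Set.Ioi 0)) (nhds (a * Gamma δ)) := by
  obtain ⟨b, hb0⟩ := eventually_atTop.1 (ha.abs.eventually_le_const (lt_add_one |a|))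
  set c := max b 1
  have hc : 1 ≤ c := le_max_right _ _
  obtain ⟨B, hB⟩ : ∃ B, ∀ u, 0 < u → |f u| ≤ B * u ^ (δ - 1) := by
    refine ⟨max (|a| + 1) ((c + 1) * c ^ (1 - δ)), fun u hu => ?_⟩
    have e : u ^ (1 - δ) * u ^ (δ - 1) = 1 := by
      rw [← rpow_add hu]; norm_num
    have hp := rpow_nonneg hu.le (1 - δ)
    suffices h : |f u| * u ^ (1 - δ) ≤ max (|a| + 1) ((c + 1) * c ^ (1 - δ)) by
      have := mul_le_mul_of_nonneg_right h (rpow_nonneg hu.le (δ - 1))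
      rwa [mul_assoc, e, mul_one] at this
    rcases le_total c u with h | h
    · have h1 := hb0 u ((le_max_left _ _).trans h)
      rw [abs_mul, abs_of_nonneg hp] at h1
      exact h1.trans (le_max_left _ _)
    · refine le_trans ?_ (le_max_right _ _)
      have h1 := rpow_le_rpow hu.le h (by linarith : 0 ≤ 1 - δ)
      exact mul_le_mul ((hb u hu).trans (by linarith)) h1 hp (by linarith)
  have hG : a * Gamma δ = ∫ t in Set.Ioi (0:ℝ), a * (exp (-t) * t ^ (δ - 1)) := by
    rw [MeasureTheory.integral_const_mul, Gamma_eq_integral hδ]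
  have key : ∀ ε : ℝ, 0 < ε → ε ^ δ * ∫ u in Set.Ioi 0, f u * exp (-(ε * u)) =
      ∫ t in Set.Ioi (0:ℝ), ε ^ (δ - 1) * f (ε⁻¹ * t) * exp (-t) := by
    intro ε hε
    have h1 := MeasureTheory.integral_comp_mul_left_Ioi
      (fun u => f u * exp (-(ε * u))) 0 (inv_pos.2 hε)
    rw [mul_zero, inv_inv, smul_eq_mul] at h1
    have h2 : ε ^ δ = ε ^ (δ - 1) * ε := by
      rw [← rpow_add_one hε.ne']; ring_nf
    rw [h2, mul_assoc, ← h1, ← MeasureTheory.integral_const_mul]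
    congr 1
    ext t
    rw [mul_inv_cancel_left₀ hε.ne']
    ring
  rw [hG]
  refine Tendsto.congr' (f₁ := fun ε => ∫ t in Set.Ioi (0:ℝ),
    ε ^ (δ - 1) * f (ε⁻¹ * t) * exp (-t)) ?_ ?_
  · filter_upwards [self_mem_nhdsWithin] with ε hε using (key ε hε).symm
  refine MeasureTheory.tendsto_integral_filter_of_dominated_convergence
    (fun t => B * (exp (-t) * t ^ (δ - 1))) ?_ ?_ ?_ ?_
  · refine Eventually.of_forall fun ε => Measurable.aestronglyMeasurable ?_
    exact ((hf.comp (measurable_const.mul measurable_id)).const_mul _).mul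
      (measurable_exp.comp measurable_neg)
  · filter_upwards [self_mem_nhdsWithin] with ε hε
    have hε : 0 < ε := hε
    refine (MeasureTheory.ae_restrict_iff' measurableSet_Ioi).2 (Eventually.of_forall ?_)
    intro t ht
    have ht : 0 < t := ht
    have h1 := hB (ε⁻¹ * t) (by positivity)
    rw [mul_rpow (by positivity) ht.le] at h1
    rw [norm_mul, norm_mul, Real.norm_eq_abs, Real.norm_eq_abs, Real.norm_eq_abs, abs_exp,
      abs_of_pos (rpow_pos_of_pos hε _)]
    have h2 : ε ^ (δ - 1) * ε⁻¹ ^ (δ - 1) = 1 := by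
      rw [← mul_rpow hε.le (by positivity), mul_inv_cancel₀ hε.ne', one_rpow]
    calc ε ^ (δ - 1) * |f (ε⁻¹ * t)| * exp (-t)
        ≤ ε ^ (δ - 1) * (B * (ε⁻¹ ^ (δ - 1) * t ^ (δ - 1))) * exp (-t) := by gcongr
      _ = (ε ^ (δ - 1) * ε⁻¹ ^ (δ - 1)) * (B * (exp (-t) * t ^ (δ - 1))) := by ring
      _ = _ := by rw [h2, one_mul]
  · have := (GammaIntegral_convergent hδ).const_mul B
    exact this
  · refine (MeasureTheory.ae_restrict_iff' measurableSet_Ioi).2 (Eventually.of_forall ?_)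
    intro t ht
    have ht : 0 < t := ht
    have h1 : Tendsto (fun ε : ℝ => ε⁻¹ * t) (nhdsWithin 0 (Set.Ioi 0)) atTop :=
      tendsto_inv_nhdsGT_zero.atTop_mul_const ht
    have h2 := (ha.comp h1).mul_const (exp (-t) * t ^ (δ - 1))
    refine h2.congr' ?_
    filter_upwards [self_mem_nhdsWithin] with ε hε
    have hε : 0 < ε := hε
    have h3 : (ε⁻¹ * t) ^ (1 - δ) * t ^ (δ - 1) = ε ^ (δ - 1) := by
      rw [mul_rpow (by positivity) ht.le, mul_assoc, ← rpow_add ht, inv_rpow hε.le,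
        ← rpow_neg hε.le]
      norm_num
    simp only [Function.comp]
    rw [← h3]
    ring

/-- The Laplace transform of the logarithmic density. -/
noncomputable def densLaplace (S : Set ℕ) (ε : ℝ) : ℝ :=
  ∫ u in Set.Ioi 0, dens S u * exp (-(ε * u))

lemma integrableOn_mul_exp {f : ℝ → ℝ} (hf : Measurable f)
    (hb : ∀ u, 0 < u → |f u| ≤ u + 1) {ε : ℝ} (hε : 0 < ε) :
    MeasureTheory.IntegrableOn (fun u => f u * exp (-(ε * u))) (Set.Ioi 0) := by
  have h1 : MeasureTheory.IntegrableOn (fun u : ℝ => u ^ (1:ℝ) * exp (-ε * u ^ (1:ℝ)) +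
      exp (-ε * u)) (Set.Ioi 0) :=
    (integrableOn_rpow_mul_exp_neg_mul_rpow (p := 1) (s := 1) (by norm_num) one_pos hε).add
      (integrableOn_exp_mul_Ioi (by linarith) 0)
  refine MeasureTheory.Integrable.mono' h1 ?_ ?_
  · exact (hf.mul (by fun_prop)).aestronglyMeasurable
  · refine (MeasureTheory.ae_restrict_iff' measurableSet_Ioi).2 (Eventually.of_forall ?_)
    intro u hu
    rw [norm_mul, Real.norm_eq_abs, Real.norm_eq_abs, abs_exp, rpow_one, ← neg_mul,
      ← add_one_mul]
    exact mul_le_mul_of_nonneg_right (hb u hu) (exp_pos _).le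

lemma abs_dens_le (S : Set ℕ) (u : ℝ) : |dens S u| ≤ 1 := by
  rw [abs_of_nonneg (dens_nonneg S u)]
  exact dens_le_one S u

lemma abs_mul_dens_le (S : Set ℕ) {u : ℝ} (hu : 0 ≤ u) : |u * dens S u| ≤ u := by
  rw [abs_mul, abs_of_nonneg hu]
  exact mul_le_of_le_one_right hu (abs_dens_le S u)

lemma densInt_le (S : Set ℕ) {u : ℝ} (hu : 0 ≤ u) : densInt S u ≤ u := by
  have := intervalIntegral.integral_mono hu (intervalIntegrable_dens S 0 u)
    (intervalIntegrable_const (c := (1:ℝ))) (dens_le_one S)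
  simpa [densInt] using this

lemma abs_densInt_le (S : Set ℕ) {u : ℝ} (hu : 0 ≤ u) : |densInt S u| ≤ u := by
  rw [abs_of_nonneg (densInt_nonneg S hu)]
  exact densInt_le S hu

lemma integrableOn_dens_mul_exp (S : Set ℕ) {ε : ℝ} (hε : 0 < ε) :
    MeasureTheory.IntegrableOn (fun u => dens S u * exp (-(ε * u))) (Set.Ioi 0) :=
  integrableOn_mul_exp (measurable_dens S) (fun u hu => (abs_dens_le S u).trans (by linarith)) hε

lemma integrableOn_mul_dens_mul_exp (S : Set ℕ) {ε : ℝ} (hε : 0 < ε) :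
    MeasureTheory.IntegrableOn (fun u => u * dens S u * exp (-(ε * u))) (Set.Ioi 0) :=
  integrableOn_mul_exp (measurable_id.mul (measurable_dens S))
    (fun u hu => (abs_mul_dens_le S hu.le).trans (by linarith)) hε

lemma integrableOn_densInt_mul_exp (S : Set ℕ) {ε : ℝ} (hε : 0 < ε) :
    MeasureTheory.IntegrableOn (fun u => densInt S u * exp (-(ε * u))) (Set.Ioi 0) :=
  integrableOn_mul_exp (continuous_densInt S).measurable
    (fun u hu => (abs_densInt_le S hu.le).trans (by linarith)) hε

lemma hasDerivAt_densLaplace (S : Set ℕ) {ε : ℝ} (hε : 0 < ε) :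
    HasDerivAt (densLaplace S) (-∫ u in Set.Ioi 0, u * dens S u * exp (-(ε * u))) ε := by
  rw [← MeasureTheory.integral_neg]
  refine (hasDerivAt_integral_of_dominated_loc_of_deriv_le
    (μ := MeasureTheory.volume.restrict (Set.Ioi 0))
    (F := fun x u => dens S u * exp (-(x * u)))
    (F' := fun x u => -(u * dens S u * exp (-(x * u))))
    (bound := fun u => u * exp (-(ε / 2 * u)))
    (Ioi_mem_nhds (by linarith : ε / 2 < ε)) ?_ ?_ ?_ ?_ ?_ ?_).2
  · exact Eventually.of_forall fun x => ((measurable_dens S).mul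
      (by fun_prop)).aestronglyMeasurable
  · exact integrableOn_dens_mul_exp S hε
  · exact (((measurable_id.mul (measurable_dens S)).mul
      (by fun_prop)).neg).aestronglyMeasurable
  · refine (MeasureTheory.ae_restrict_iff' measurableSet_Ioi).2 (Eventually.of_forall ?_)
    intro u hu x hx
    have hu : 0 < u := hu
    have hx : ε / 2 < x := hx
    rw [norm_neg, norm_mul, Real.norm_eq_abs, Real.norm_eq_abs, abs_exp]
    refine mul_le_mul (abs_mul_dens_le S hu.le) (exp_le_exp.2 ?_) (exp_pos _).le hu.le
    nlinarith
  · exact integrableOn_mul_exp measurable_id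
      (fun u hu => by rw [id, abs_of_pos hu]; linarith) (by positivity)
  · refine Eventually.of_forall fun u x _ => ?_
    have h1 : HasDerivAt (fun x : ℝ => exp (-(x * u))) (exp (-(x * u)) * (-(1 * u))) x :=
      (((hasDerivAt_id x).mul_const u).neg).exp
    exact (h1.const_mul (dens S u)).congr_deriv (by ring)

lemma integral_densInt_mul_exp (S : Set ℕ) {ε : ℝ} (hε : 0 < ε) :
    ∫ u in Set.Ioi 0, densInt S u * exp (-(ε * u)) = densLaplace S ε / ε := by
  have hfin : ∀ U : ℝ, 0 ≤ U → ∫ u in (0:ℝ)..U, densInt S u * exp (-(ε * u)) =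
      densInt S U * (-exp (-(ε * U)) / ε) +
        (∫ u in (0:ℝ)..U, dens S u * exp (-(ε * u))) / ε := by
    intro U hU
    have hv : ∀ x : ℝ, HasDerivAt (fun x => -exp (-(ε * x)) / ε) (exp (-(ε * x))) x := by
      intro x
      have h1 : HasDerivAt (fun x : ℝ => exp (-(ε * x))) (exp (-(ε * x)) * (-(ε * 1))) x :=
        (((hasDerivAt_id x).const_mul ε).neg).exp
      exact (h1.neg.div_const ε).congr_deriv (by field_simp)
    have h := intervalIntegral.integral_mul_deriv_eq_deriv_mul_of_hasDeriv_right
      (a := 0) (b := U) (u := densInt S) (v := fun x => -exp (-(ε * x)) / ε)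
      (u' := dens S) (v' := fun x => exp (-(ε * x)))
      (continuous_densInt S).continuousOn
      (by fun_prop)
      (fun x _ => (hasDerivWithinAt_densInt S x).mono Set.Ioi_subset_Ici_self)
      (fun x _ => (hv x).hasDerivWithinAt) (intervalIntegrable_dens S 0 U)
      ((by fun_prop : Continuous fun x : ℝ => exp (-(ε * x))).intervalIntegrable _ _)
    rw [h]
    have e0 : densInt S 0 = 0 := by simp [densInt]
    rw [e0, zero_mul, sub_zero, sub_eq_add_neg, ← intervalIntegral.integral_neg,
      ← intervalIntegral.integral_div]
    congr 2
    ext x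
    ring
  have hI := MeasureTheory.intervalIntegral_tendsto_integral_Ioi 0
    (integrableOn_densInt_mul_exp S hε) tendsto_id
  have hD := MeasureTheory.intervalIntegral_tendsto_integral_Ioi 0
    (integrableOn_dens_mul_exp S hε) tendsto_id
  have h0 : Tendsto (fun U => densInt S U * (-exp (-(ε * U)) / ε)) atTop (nhds 0) := by
    have h1 : Tendsto (fun U : ℝ => U ^ (1:ℝ) * exp (-ε * U) / ε) atTop (nhds 0) := by
      simpa using (tendsto_rpow_mul_exp_neg_mul_atTop_nhds_zero 1 ε hε).div_const ε
    refine squeeze_zero_norm' ?_ h1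
    filter_upwards [eventually_ge_atTop 0] with U hU
    rw [norm_mul, Real.norm_eq_abs, Real.norm_eq_abs, abs_div, abs_neg, abs_exp, abs_of_pos hε,
      rpow_one, neg_mul, mul_div_assoc]
    exact mul_le_mul_of_nonneg_right (abs_densInt_le S hU) (by positivity)
  have h2 := h0.add (hD.div_const ε)
  rw [zero_add] at h2
  refine tendsto_nhds_unique hI (h2.congr' ?_)
  filter_upwards [eventually_ge_atTop 0] with U hU using (hfin U hU).symm

lemma hasSum_LSeries' (S : Set ℕ) {s : ℝ} (hs : 1 < s) :
    HasSum (fun n : ℕ => if n ∈ S then (n : ℝ) ^ (-s) else 0) (LSeries' S s) := by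
  refine Summable.hasSum (Summable.of_nonneg_of_le (fun n => ?_) (fun n => ?_)
    (summable_nat_rpow.2 (by linarith : -s < -1)))
  · split_ifs <;> positivity
  · split_ifs
    · rfl
    · positivity

lemma LSeries'_eq (S : Set ℕ) {s : ℝ} (hs : 1 < s) : LSeries' S s = s * densLaplace S (s - 1) := by
  have hfin : ∀ N : ℕ, 1 ≤ N →
      ∑ n ∈ Finset.range (N + 1), (if n ∈ S then (n : ℝ) ^ (-s) else 0) =
        s * (∫ u in (0:ℝ)..log N, dens S u * exp (-((s - 1) * u))) +
          dens S (log N) * exp (-((s - 1) * log N)) := by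
    intro N hN
    have hN0 : (0:ℝ) < N := by exact_mod_cast hN
    have h := integral_logSum_mul (a := chiS S) (log_natCast_nonneg N)
      (g := fun v => exp (-(s * v))) (by fun_prop)
    have e1 : ∀ v, dens S v * exp (-((s - 1) * v)) = logSum (chiS S) v * exp (-(s * v)) := by
      intro v
      rw [dens, mul_assoc, ← exp_add]
      ring_nf
    simp only [e1]
    have e2 : ∀ a b : ℝ, ∫ v in a..b, exp (-(s * v)) = (exp (-(s * a)) - exp (-(s * b))) / s := by
      intro a b
      have hv : ∀ x ∈ Set.uIcc a b,
          HasDerivAt (fun x => -exp (-(s * x)) / s) (exp (-(s * x))) x := by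
        intro x _
        have h1 : HasDerivAt (fun x : ℝ => exp (-(s * x))) (exp (-(s * x)) * (-(s * 1))) x :=
          (((hasDerivAt_id x).const_mul s).neg).exp
        exact (h1.neg.div_const s).congr_deriv (by field_simp)
      rw [intervalIntegral.integral_eq_sub_of_hasDerivAt hv
        ((by fun_prop : Continuous fun x : ℝ => exp (-(s * x))).intervalIntegrable _ _)]
      ring
    rw [h, logSum, exp_log hN0, Nat.floor_natCast, Finset.mul_sum, Finset.sum_mul,
      ← Finset.sum_add_distrib, Finset.range_eq_Ico, Finset.sum_eq_sum_Ico_succ_bot (by omega)]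
    have e3 : (if 0 ∈ S then ((0:ℕ) : ℝ) ^ (-s) else 0) = 0 := by
      rw [Nat.cast_zero, zero_rpow (by linarith), ite_self]
    rw [e3, zero_add]
    refine Finset.sum_congr rfl fun n hn => ?_
    have hn0 : (0:ℝ) < n := by
      have := (Finset.mem_Ico.1 hn).1
      exact_mod_cast this
    rw [e2, chiS, rpow_def_of_pos hn0]
    split_ifs
    · have : -(s * log n) = log n * -s := by ring
      rw [this]
      field_simp
      ring
    · ring
  have hlog : Tendsto (fun N : ℕ => log N) atTop atTop :=
    tendsto_log_atTop.comp tendsto_natCast_atTop_atTop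
  have h1 := ((hasSum_LSeries' S hs).tendsto_sum_nat).comp (tendsto_add_atTop_nat 1)
  have h2 := (MeasureTheory.intervalIntegral_tendsto_integral_Ioi 0
    (integrableOn_dens_mul_exp S (sub_pos.2 hs)) hlog).const_mul s
  have h3 : Tendsto (fun u => dens S u * exp (-((s - 1) * u))) atTop (nhds 0) := by
    have h4 : Tendsto (fun u : ℝ => exp (-((s - 1) * u))) atTop (nhds 0) :=
      tendsto_exp_neg_atTop_nhds_zero.comp (tendsto_id.const_mul_atTop (sub_pos.2 hs))
    refine squeeze_zero (fun u => mul_nonneg (dens_nonneg S u) (exp_pos _).le) (fun u => ?_) h4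
    exact mul_le_of_le_one_left (exp_pos _).le (dens_le_one S u)
  have h5 := h2.add (h3.comp hlog)
  rw [add_zero] at h5
  refine tendsto_nhds_unique h1 (h5.congr' ?_)
  filter_upwards [eventually_ge_atTop 1] with N hN using (hfin N hN).symm

lemma tendsto_rpow_mul_densLaplace {S : Set ℕ} {δ C₀ : ℝ} (hδ : 0 < δ) (hδ1 : δ < 1)
    (hC : Tendsto (fun u => dens S u / u ^ (δ - 1)) atTop (nhds C₀)) :
    Tendsto (fun ε => ε ^ δ * densLaplace S ε) (nhdsWithin 0 (Set.Ioi 0))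
      (nhds (C₀ * Gamma δ)) := by
  refine tendsto_rpow_mul_integral_exp hδ hδ1 (measurable_dens S)
    (fun u hu => (abs_dens_le S u).trans (by linarith)) (hC.congr' ?_)
  filter_upwards [eventually_gt_atTop 0] with u hu
  rw [div_eq_mul_inv, ← rpow_neg hu.le, neg_sub]

lemma tendsto_rpow_mul_densLaplace_deriv {S : Set ℕ} {δ K : ℝ} (hδ : 0 < δ) (hδ1 : δ < 1)
    (hK : Tendsto (fun u => (u * dens S u - δ * densInt S u) * u ^ (1 - δ)) atTop (nhds K)) :
    Tendsto (fun ε => ε ^ δ * (-deriv (densLaplace S) ε - δ * (densLaplace S ε / ε)))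
      (nhdsWithin 0 (Set.Ioi 0)) (nhds (K * Gamma δ)) := by
  have h := tendsto_rpow_mul_integral_exp (f := fun u => u * dens S u - δ * densInt S u) hδ hδ1
    ((measurable_id.mul (measurable_dens S)).sub
      ((continuous_densInt S).measurable.const_mul δ)) ?_ hK
  · refine h.congr' ?_
    filter_upwards [self_mem_nhdsWithin] with ε hε
    have hε : 0 < ε := hε
    rw [(hasDerivAt_densLaplace S hε).deriv, ← integral_densInt_mul_exp S hε, neg_neg,
      ← MeasureTheory.integral_const_mul δ, ← MeasureTheory.integral_sub
        (integrableOn_mul_dens_mul_exp S hε) ((integrableOn_densInt_mul_exp S hε).const_mul δ)]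
    congr 2
    ext u
    ring
  · intro u hu
    have h1 := densInt_le S hu.le
    have h2 := densInt_nonneg S hu.le
    have h3 := dens_nonneg S u
    have h4 := dens_le_one S u
    rw [abs_le]
    constructor <;> nlinarith [mul_nonneg hu.le h3]

lemma deriv_LSeries' (S : Set ℕ) {s : ℝ} (hs : 1 < s) :
    deriv (LSeries' S) s = densLaplace S (s - 1) + s * deriv (densLaplace S) (s - 1) := by
  have h1 : HasDerivAt (fun s : ℝ => s * densLaplace S (s - 1))
      (1 * densLaplace S (s - 1) + s * deriv (densLaplace S) (s - 1)) s :=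
    (hasDerivAt_id s).mul
      ((hasDerivAt_densLaplace S (sub_pos.2 hs)).differentiableAt.hasDerivAt.comp_sub_const s 1)
  have h2 : LSeries' S =ᶠ[nhds s] fun s => s * densLaplace S (s - 1) := by
    filter_upwards [lt_mem_nhds hs] with t ht using LSeries'_eq S ht
  rw [h2.deriv_eq, h1.deriv]
  ring

lemma tendsto_sub_one_nhdsGT : Tendsto (fun s : ℝ => s - 1) (nhdsWithin 1 (Set.Ioi 1))
    (nhdsWithin 0 (Set.Ioi 0)) := by
  refine tendsto_nhdsWithin_iff.2 ⟨?_, ?_⟩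
  · have : Tendsto (fun s : ℝ => s - 1) (nhds 1) (nhds (1 - 1)) :=
      tendsto_id.sub_const 1
    rw [sub_self] at this
    exact this.mono_left nhdsWithin_le_nhds
  · filter_upwards [self_mem_nhdsWithin] with s hs using Set.mem_Ioi.2 (sub_pos.2 (Set.mem_Ioi.1 hs))

lemma isEulerKronecker_of_tendsto {S : Set ℕ} {δ C₀ K : ℝ} (hδ : 0 < δ) (hδ1 : δ < 1)
    (hC0 : 0 < C₀) (hC : Tendsto (fun u => dens S u / u ^ (δ - 1)) atTop (nhds C₀))
    (hK : Tendsto (fun u => (u * dens S u - δ * densInt S u) * u ^ (1 - δ)) atTop (nhds K)) :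
    IsEulerKronecker S δ (1 - K / C₀) := by
  have hG := Gamma_pos_of_pos hδ
  have h1 := (tendsto_rpow_mul_densLaplace hδ hδ1 hC).comp tendsto_sub_one_nhdsGT
  have h2 := (tendsto_rpow_mul_densLaplace_deriv hδ hδ1 hK).comp tendsto_sub_one_nhdsGT
  have h3 : Tendsto (fun s : ℝ => s⁻¹) (nhdsWithin 1 (Set.Ioi 1)) (nhds 1) := by
    have := (continuousAt_inv₀ (one_ne_zero (α := ℝ))).tendsto
    rw [inv_one] at this
    exact this.mono_left nhdsWithin_le_nhds
  have h4 := h3.sub (h2.div h1 (by positivity))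
  rw [mul_div_mul_right _ _ hG.ne'] at h4
  refine h4.congr' ?_
  filter_upwards [self_mem_nhdsWithin, h1.eventually_const_lt (by positivity : 0 < C₀ * Gamma δ)]
    with s hs hpos
  have hs : 1 < s := hs
  have hε : 0 < s - 1 := sub_pos.2 hs
  have hp : 0 < (s - 1) ^ δ := rpow_pos_of_pos hε δ
  have hH : 0 < densLaplace S (s - 1) := by
    simpa [Function.comp, hp] using hpos
  simp only [Function.comp, Pi.div_apply]
  rw [deriv_LSeries' S hs, LSeries'_eq S hs]
  generalize densLaplace S (s - 1) = H at *
  generalize deriv (densLaplace S) (s - 1) = H'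
  generalize (s - 1) ^ δ = q at *
  have : s ≠ 0 := by linarith
  field_simp
  ring

lemma tendsto_rpow_mul_LSeries' {S : Set ℕ} {δ C₀ : ℝ} (hδ : 0 < δ) (hδ1 : δ < 1)
    (hC : Tendsto (fun u => dens S u / u ^ (δ - 1)) atTop (nhds C₀)) :
    Tendsto (fun s => (s - 1) ^ δ * LSeries' S s) (nhdsWithin 1 (Set.Ioi 1))
      (nhds (Gamma δ * C₀)) := by
  have h1 := (tendsto_rpow_mul_densLaplace hδ hδ1 hC).comp tendsto_sub_one_nhdsGT
  have h2 : Tendsto (fun s : ℝ => s) (nhdsWithin 1 (Set.Ioi 1)) (nhds 1) :=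
    tendsto_id.mono_left nhdsWithin_le_nhds
  have h3 := h2.mul h1
  rw [one_mul, mul_comm C₀] at h3
  refine h3.congr' ?_
  filter_upwards [self_mem_nhdsWithin] with s hs
  simp only [Function.comp]
  rw [LSeries'_eq S hs]
  ring

lemma one_sub_exp_neg_le_dens_univ (v : ℝ) : 1 - exp (-v) ≤ dens Set.univ v := by
  have h1 : logSum (chiS Set.univ) v = (⌊exp v⌋₊ : ℝ) := by
    simp [logSum, chiS]
  have h2 := Nat.lt_floor_add_one (exp v)
  have h3 : exp v * exp (-v) = 1 := by rw [← exp_add, add_neg_cancel, exp_zero]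
  have h4 := exp_pos (-v)
  rw [dens, h1]
  nlinarith

lemma logSum_primeWeight_univ_le (u : ℝ) : logSum (primeWeight Set.univ) u ≤ log 4 * exp u := by
  refine le_of_eq_of_le ?_ (Chebyshev.theta_le_log4_mul_x (exp_pos u).le)
  rw [Chebyshev.theta, logSum, Finset.sum_filter]
  refine Finset.sum_congr (by ext; simp; omega) fun n _ => ?_
  simp [primeWeight, chiS]

lemma exists_abs_logSum_primeWeight_univ_sub_le :
    ∃ M : ℝ, ∀ u : ℝ, 0 ≤ u → |logSum (fun p => primeWeight Set.univ p / p) u - u| ≤ M := by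
  have hmul : IsMultiplicativeSet Set.univ := ⟨trivial, fun _ _ _ _ _ => by simp⟩
  refine ⟨2 + log 4 + ∑' q, remWeight Set.univ q, fun u hu => ?_⟩
  have h := mul_dens_eq hmul hu
  have hR := abs_tsum_remTerm_le (S := Set.univ) (u := u) (B := 1) _
    (summable_remWeight Set.univ) fun q => by
      rw [one_mul]
      exact (abs_remTerm_le _ _ _).trans
        (mul_le_of_le_one_right (remWeight_nonneg _ _) (dens_le_one _ _))
  rw [one_mul] at hR
  have hint : IntervalIntegrable (fun v => dens Set.univ v * exp (v - u))
      MeasureTheory.volume 0 u :=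
    (intervalIntegrable_dens Set.univ 0 u).mul_continuousOn (by fun_prop)
  have hT0 : 0 ≤ ∫ v in (0:ℝ)..u, dens Set.univ v * exp (v - u) :=
    intervalIntegral.integral_nonneg hu fun v _ => mul_nonneg (dens_nonneg _ _) (exp_pos _).le
  have hT1 : ∫ v in (0:ℝ)..u, dens Set.univ v * exp (v - u) ≤ 1 := by
    have h1 : ∫ v in (0:ℝ)..u, dens Set.univ v * exp (v - u) ≤ ∫ v in (0:ℝ)..u, exp (v - u) :=
      intervalIntegral.integral_mono hu hint
        ((by fun_prop : Continuous fun v : ℝ => exp (v - u)).intervalIntegrable _ _)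
        fun v => mul_le_of_le_one_left (exp_pos _).le (dens_le_one _ _)
    rw [intervalIntegral.integral_comp_sub_right (fun v => exp v), integral_exp, sub_self,
      exp_zero] at h1
    linarith [exp_pos (0 - u)]
  have hD1 := mul_le_of_le_one_right hu (dens_le_one Set.univ u)
  have hD0 : u - 1 ≤ u * dens Set.univ u := by
    have h1 := mul_le_mul_of_nonneg_left (one_sub_exp_neg_le_dens_univ u) hu
    have h2 : u * exp (-u) ≤ 1 := by
      have h3 : u ≤ exp u := by linarith [add_one_le_exp u]
      calc u * exp (-u) ≤ exp u * exp (-u) := by gcongr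
        _ = 1 := by rw [← exp_add, add_neg_cancel, exp_zero]
    linarith
  set T := ∑ p ∈ Finset.Icc 1 ⌊exp u⌋₊,
    primeWeight Set.univ p / p * dens Set.univ (u - log p) with hT
  have hA : T ≤ logSum (fun p => primeWeight Set.univ p / p) u :=
    Finset.sum_le_sum fun p _ => mul_le_of_le_one_right
      (div_nonneg (primeWeight_nonneg _ _) p.cast_nonneg) (dens_le_one _ _)
  have hB : logSum (fun p => primeWeight Set.univ p / p) u - T ≤ log 4 := by
    have h1 : logSum (fun p => primeWeight Set.univ p / p) u - T ≤
        logSum (primeWeight Set.univ) u * exp (-u) := by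
      rw [hT, logSum, logSum, ← Finset.sum_sub_distrib, Finset.sum_mul]
      refine Finset.sum_le_sum fun p hp => ?_
      have hp1 := (Finset.mem_Icc.1 hp).1
      have h2 := one_sub_exp_neg_le_dens_univ (u - log p)
      have h3 : (p:ℝ)⁻¹ * exp (-(u - log p)) = exp (-u) := by
        rw [← exp_neg_log_natCast hp1, ← exp_add]
        ring_nf
      have h4 := div_nonneg (primeWeight_nonneg Set.univ p) (Nat.cast_nonneg (α := ℝ) p)
      calc primeWeight Set.univ p / p - primeWeight Set.univ p / p * dens Set.univ (u - log p)
          = primeWeight Set.univ p / p * (1 - dens Set.univ (u - log p)) := by ring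
        _ ≤ primeWeight Set.univ p / p * exp (-(u - log p)) := by gcongr; linarith
        _ = primeWeight Set.univ p * ((p:ℝ)⁻¹ * exp (-(u - log p))) := by ring
        _ = _ := by rw [h3]
    have h5 := mul_le_mul_of_nonneg_right (logSum_primeWeight_univ_le u) (exp_pos (-u)).le
    rw [mul_assoc, ← exp_add, add_neg_cancel, exp_zero, mul_one] at h5
    linarith
  have h4 : 0 ≤ log 4 := log_nonneg (by norm_num)
  rw [abs_le] at hR ⊢
  constructor <;> linarith

/-- The mean-zero coefficients `(χ_S(p) - δ) (log p) / p`, supported on the primes `p`. -/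
noncomputable def biasWeight (S : Set ℕ) (δ : ℝ) (n : ℕ) : ℝ :=
  (primeWeight S n - δ * primeWeight Set.univ n) / n

lemma exists_abs_logSum_biasWeight_le {S : Set ℕ} {δ ρ : ℝ} (h : IsPrimeRegular S δ ρ) :
    ∃ M : ℝ, ∀ u : ℝ, 0 ≤ u → |logSum (biasWeight S δ) u| ≤ M := by
  have hδ := h.density_pos
  obtain ⟨M, hM⟩ := exists_abs_logSum_primeWeight_univ_sub_le
  obtain ⟨A, hA⟩ := exists_tendsto_logSum_primeWeight h
  obtain ⟨B, hB⟩ := hA.abs.bddAbove_range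
  replace hB : ∀ V : ℕ, |logSum (fun p => primeWeight S p / p) V - δ * V| ≤ B :=
    fun V => hB ⟨V, rfl⟩
  refine ⟨B + δ + δ * M, fun u hu => ?_⟩
  have hmono : Monotone (logSum fun p => primeWeight S p / p) :=
    logSum_mono fun p => div_nonneg (primeWeight_nonneg _ _) p.cast_nonneg
  have e : logSum (biasWeight S δ) u = logSum (fun p => primeWeight S p / p) u -
      δ * logSum (fun p => primeWeight Set.univ p / p) u := by
    simp only [logSum, biasWeight, Finset.mul_sum, ← Finset.sum_sub_distrib]
    exact Finset.sum_congr rfl fun n _ => by ring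
  have h1 := hmono (Nat.floor_le hu)
  have h2 := hmono (Nat.lt_floor_add_one u).le
  have h3 := hB ⌊u⌋₊
  have h4 := hB (⌊u⌋₊ + 1)
  have h5 := hM u hu
  have h6 := mul_le_mul_of_nonneg_left (Nat.floor_le hu) hδ.le
  have h7 := mul_le_mul_of_nonneg_left (Nat.lt_floor_add_one u).le hδ.le
  push_cast at h4
  rw [abs_le] at h3 h4 h5 ⊢
  have h8 := mul_le_mul_of_nonneg_left h5.1 hδ.le
  have h9 := mul_le_mul_of_nonneg_left h5.2 hδ.le
  rw [e]
  constructor <;> linarith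

lemma abs_sum_mul_le_of_antitone {a b : ℕ → ℝ} {M : ℝ} {P : ℕ}
    (ha : ∀ n, P ≤ n → |∑ i ∈ Finset.Ico P n, a i| ≤ M)
    (hb : ∀ n, P ≤ n → b (n + 1) ≤ b n) (hb0 : ∀ n, P ≤ n → 0 ≤ b n) {N : ℕ} (hN : P ≤ N) :
    |∑ i ∈ Finset.Ico P N, a i * b i| ≤ M * b P := by
  have key : |∑ i ∈ Finset.Ico P N, a i * b i - (∑ i ∈ Finset.Ico P N, a i) * b N| ≤
      M * (b P - b N) := by
    induction N, hN using Nat.le_induction with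
    | base => simp
    | succ n hn ih =>
      rw [Finset.sum_Ico_succ_top hn, Finset.sum_Ico_succ_top hn]
      have h1 := ha (n + 1) (by omega)
      rw [Finset.sum_Ico_succ_top hn] at h1
      have h2 := mul_le_mul_of_nonneg_right h1 (sub_nonneg.2 (hb n hn))
      rw [← abs_of_nonneg (sub_nonneg.2 (hb n hn)), ← abs_mul,
        abs_of_nonneg (sub_nonneg.2 (hb n hn))] at h2
      have e : ∑ i ∈ Finset.Ico P n, a i * b i + a n * b n -
          (∑ i ∈ Finset.Ico P n, a i + a n) * b (n + 1) =
          (∑ i ∈ Finset.Ico P n, a i * b i - (∑ i ∈ Finset.Ico P n, a i) * b n) +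
          (∑ i ∈ Finset.Ico P n, a i + a n) * (b n - b (n + 1)) := by ring
      rw [e]
      refine (abs_add_le _ _).trans ?_
      linarith
  have h1 := mul_le_mul_of_nonneg_right (ha N hN) (hb0 N hN)
  have h2 := abs_sub_abs_le_abs_sub (∑ i ∈ Finset.Ico P N, a i * b i)
    ((∑ i ∈ Finset.Ico P N, a i) * b N)
  rw [abs_mul, abs_of_nonneg (hb0 N hN)] at h2
  linarith

lemma abs_sum_Ico_biasWeight_le {S : Set ℕ} {δ M : ℝ}
    (hM : ∀ u : ℝ, 0 ≤ u → |logSum (biasWeight S δ) u| ≤ M) {P n : ℕ} (hP : 2 ≤ P)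
    (hn : P ≤ n) : |∑ i ∈ Finset.Ico P n, biasWeight S δ i| ≤ 2 * M := by
  have e : ∀ k : ℕ, 1 ≤ k →
      logSum (biasWeight S δ) (log k) = ∑ i ∈ Finset.Ico 1 (k + 1), biasWeight S δ i := by
    intro k hk
    rw [logSum, exp_log (by exact_mod_cast hk), Nat.floor_natCast]
    rfl
  obtain ⟨p, rfl⟩ : ∃ p, P = p + 1 := ⟨P - 1, by omega⟩
  obtain ⟨m, rfl⟩ : ∃ m, n = m + 1 := ⟨n - 1, by omega⟩
  have h1 := hM _ (log_natCast_nonneg p)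
  have h2 := hM _ (log_natCast_nonneg m)
  rw [e p (by omega)] at h1
  rw [e m (by omega)] at h2
  rw [← Finset.sum_Ico_consecutive _ (by omega : 1 ≤ p + 1) hn] at h2
  rw [abs_le] at *
  constructor <;> linarith

lemma abs_sum_biasWeight_mul_rpow_le {S : Set ℕ} {δ M : ℝ}
    (hM : ∀ u : ℝ, 0 ≤ u → |logSum (biasWeight S δ) u| ≤ M) {P N : ℕ} (hP : 2 ≤ P)
    (hN : P ≤ N) {s : ℝ} (hs : 1 ≤ s) :
    |∑ n ∈ Finset.Ico P N, biasWeight S δ n * ((n:ℝ) ^ (1 - s) * (log n)⁻¹)| ≤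
      2 * M * (log P)⁻¹ := by
  have hM0 : 0 ≤ M := (abs_nonneg _).trans (hM 0 le_rfl)
  have hlog : ∀ n : ℕ, P ≤ n → 0 < log n := fun n hn =>
    log_pos (by exact_mod_cast (by omega : 1 < n))
  have h := abs_sum_mul_le_of_antitone (b := fun n => (n:ℝ) ^ (1 - s) * (log n)⁻¹)
    (fun n hn => abs_sum_Ico_biasWeight_le hM hP hn) ?_ ?_ hN
  · refine h.trans ?_
    have hP1 : (1:ℝ) ≤ P := by exact_mod_cast (by omega : 1 ≤ P)
    have h1 : (P:ℝ) ^ (1 - s) ≤ 1 := rpow_le_one_of_one_le_of_nonpos hP1 (by linarith)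
    have h2 := (hlog P le_rfl).le
    exact mul_le_mul_of_nonneg_left (mul_le_of_le_one_left (by positivity) h1) (by positivity)
  · intro n hn
    have hn0 : (0:ℝ) < n := by exact_mod_cast (by omega : 0 < n)
    have h1 : (n:ℝ) ≤ (n + 1 : ℕ) := by push_cast; linarith
    refine mul_le_mul (rpow_le_rpow_of_nonpos hn0 h1 (by linarith))
      (inv_anti₀ (hlog n hn) (log_le_log hn0 h1)) ?_ (by positivity)
    exact inv_nonneg.2 (hlog (n + 1) (by omega)).le
  · intro n hn
    have := (hlog n hn).le
    positivity

/-- The Euler factor of `L_S` at `p`. -/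
noncomputable def localFactor (S : Set ℕ) (p : ℕ) (s : ℝ) : ℝ :=
  ∑' e : ℕ, chiS S (p ^ e) * ((p:ℝ) ^ (-s)) ^ e

lemma rpow_neg_le_inv {p : ℕ} (hp : p.Prime) {s : ℝ} (hs : 1 ≤ s) :
    (p:ℝ) ^ (-s) ≤ (p:ℝ)⁻¹ := by
  have hp1 : (1:ℝ) ≤ p := by exact_mod_cast hp.one_le
  rw [← rpow_neg_one]
  exact rpow_le_rpow_of_exponent_le hp1 (by linarith)

lemma rpow_neg_le_half {p : ℕ} (hp : p.Prime) {s : ℝ} (hs : 1 ≤ s) :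
    (p:ℝ) ^ (-s) ≤ 1 / 2 := by
  refine (rpow_neg_le_inv hp hs).trans ?_
  rw [one_div]
  exact inv_anti₀ two_pos (by exact_mod_cast hp.two_le)

lemma rpow_neg_pos_of_prime {p : ℕ} (hp : p.Prime) (s : ℝ) : 0 < (p:ℝ) ^ (-s) :=
  rpow_pos_of_pos (by exact_mod_cast hp.pos) _

lemma summable_chiS_mul_pow (S : Set ℕ) (p : ℕ) {x : ℝ} (hx0 : 0 ≤ x) (hx : x ≤ 1 / 2) :
    Summable fun e : ℕ => chiS S (p ^ e) * x ^ e := by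
  refine Summable.of_nonneg_of_le (fun e => mul_nonneg (chiS_nonneg _ _) (by positivity))
    (fun e => mul_le_of_le_one_left (by positivity) (chiS_le_one _ _))
    (summable_geometric_of_lt_one hx0 (by linarith))

lemma exists_localFactor_eq {S : Set ℕ} (hS : 1 ∈ S) {p : ℕ} (hp : p.Prime) {s : ℝ}
    (hs : 1 ≤ s) : ∃ r, 0 ≤ r ∧ r ≤ 2 * ((p:ℝ) ^ (-s)) ^ 2 ∧
      localFactor S p s = 1 + chiS S p * (p:ℝ) ^ (-s) + r := by
  have hx0 := (rpow_neg_pos_of_prime hp s).le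
  have hx := rpow_neg_le_half hp hs
  rw [localFactor]
  generalize (p:ℝ) ^ (-s) = x at *
  have hsum := summable_chiS_mul_pow S p hx0 hx
  have hsum2 := (summable_nat_add_iff 2).2 hsum
  have hgeom := (hasSum_geometric_of_lt_one hx0 (by linarith : x < 1)).mul_left (x ^ 2)
  refine ⟨∑' e : ℕ, chiS S (p ^ (e + 2)) * x ^ (e + 2),
    tsum_nonneg fun e => mul_nonneg (chiS_nonneg _ _) (by positivity), ?_, ?_⟩
  · have h1 := hsum2.tsum_le_tsum (fun e => ?_) hgeom.summable
    · rw [hgeom.tsum_eq] at h1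
      refine h1.trans ?_
      rw [mul_comm]
      gcongr
      rw [inv_le_comm₀ (by linarith) two_pos]
      linarith
    · rw [← pow_add x, add_comm 2 e]
      exact mul_le_of_le_one_left (by positivity) (chiS_le_one _ _)
  · rw [← hsum.sum_add_tsum_nat_add 2, Finset.sum_range_succ, Finset.sum_range_one]
    simp [chiS, hS]

lemma one_le_localFactor {S : Set ℕ} (hS : 1 ∈ S) {p : ℕ} (hp : p.Prime) {s : ℝ}
    (hs : 1 ≤ s) : 1 ≤ localFactor S p s := by
  obtain ⟨r, hr, -, e⟩ := exists_localFactor_eq hS hp hs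
  have := mul_nonneg (chiS_nonneg S p) (rpow_neg_pos_of_prime hp s).le
  rw [e]
  linarith

/-- The logarithm of the Euler factor at `p` of `L_S(s) / ζ(s) ^ δ`. -/
noncomputable def logFactor (S : Set ℕ) (δ : ℝ) (p : ℕ) (s : ℝ) : ℝ :=
  log (localFactor S p s) + δ * log (1 - (p:ℝ) ^ (-s))

lemma abs_logFactor_sub_le {S : Set ℕ} (hS : 1 ∈ S) {δ : ℝ} (hδ0 : 0 ≤ δ) (hδ1 : δ ≤ 1)
    {p : ℕ} (hp : p.Prime) {s : ℝ} (hs : 1 ≤ s) :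
    |logFactor S δ p s - biasWeight S δ p * ((p:ℝ) ^ (1 - s) * (log p)⁻¹)| ≤
      8 * ((p:ℝ) ^ 2)⁻¹ := by
  have hp0 : (0:ℝ) < p := by exact_mod_cast hp.pos
  have hlog : 0 < log p := log_pos (by exact_mod_cast hp.one_lt)
  have e1 : biasWeight S δ p * ((p:ℝ) ^ (1 - s) * (log p)⁻¹) = (chiS S p - δ) * (p:ℝ) ^ (-s) := by
    have : (p:ℝ) ^ (1 - s) = p * (p:ℝ) ^ (-s) := by
      rw [sub_eq_add_neg, rpow_add hp0, rpow_one]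
    rw [this, biasWeight, primeWeight, primeWeight, if_pos hp, if_pos hp]
    simp only [chiS, Set.mem_univ, if_true]
    field_simp
  obtain ⟨r, hr0, hr, e2⟩ := exists_localFactor_eq hS hp hs
  have hx0 := rpow_neg_pos_of_prime hp s
  have hx := rpow_neg_le_half hp hs
  have hxp : ((p:ℝ) ^ (-s)) ^ 2 ≤ ((p:ℝ) ^ 2)⁻¹ := by
    rw [← inv_pow]
    exact pow_le_pow_left₀ hx0.le (rpow_neg_le_inv hp hs) 2
  rw [e1, logFactor, e2]
  generalize (p:ℝ) ^ (-s) = x at *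
  have hc0 := chiS_nonneg S p
  have hc1 := chiS_le_one S p
  generalize chiS S p = c at *
  have hy0 : 0 ≤ c * x + r := by positivity
  have hcx : c * x ≤ x := mul_le_of_le_one_left hx0.le hc1
  have hy1 : c * x + r ≤ 2 * x := by nlinarith
  have hl1 : log (1 + c * x + r) ≤ c * x + r := by
    have := log_le_sub_one_of_pos (by linarith : 0 < 1 + c * x + r)
    linarith
  have hl2 : c * x + r - (c * x + r) ^ 2 ≤ log (1 + c * x + r) := by
    refine le_trans ?_ (one_sub_inv_le_log_of_pos (by linarith : 0 < 1 + c * x + r))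
    rw [add_assoc]
    generalize c * x + r = y at *
    rw [le_sub_iff_add_le, ← le_sub_iff_add_le', inv_le_iff_one_le_mul₀ (by linarith)]
    nlinarith [mul_nonneg hy0 (mul_nonneg hy0 hy0)]
  have hm1 : log (1 - x) ≤ -x := by
    have := log_le_sub_one_of_pos (by linarith : 0 < 1 - x)
    linarith
  have hm2 : -x - 2 * x ^ 2 ≤ log (1 - x) := by
    refine le_trans ?_ (one_sub_inv_le_log_of_pos (by linarith : 0 < 1 - x))
    rw [le_sub_iff_add_le, ← le_sub_iff_add_le', inv_le_iff_one_le_mul₀ (by linarith)]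
    nlinarith [mul_nonneg hx0.le hx0.le]
  have hsq : (c * x + r) ^ 2 ≤ (2 * x) ^ 2 := pow_le_pow_left₀ hy0 hy1 2
  have hd1 := mul_le_mul_of_nonneg_left hm1 hδ0
  have hd2 := mul_le_mul_of_nonneg_left hm2 hδ0
  have hd3 := mul_le_mul_of_nonneg_right hδ1 (sq_nonneg x)
  rw [abs_le]
  constructor <;> nlinarith

/-- The sum of `logFactor S δ p s` over the primes `p < P`. -/
noncomputable def logProd (S : Set ℕ) (δ s : ℝ) (P : ℕ) : ℝ :=
  ∑ p ∈ Finset.filter Nat.Prime (Finset.range P), logFactor S δ p s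

lemma exists_abs_logProd_sub_le {S : Set ℕ} {δ ρ : ℝ} (h : IsPrimeRegular S δ ρ) :
    ∃ E : ℕ → ℝ, Tendsto E atTop (nhds 0) ∧ ∀ P Q : ℕ, 2 ≤ P → P ≤ Q → ∀ s : ℝ, 1 ≤ s →
      |logProd S δ s Q - logProd S δ s P| ≤ E P := by
  obtain ⟨M, hM⟩ := exists_abs_logSum_biasWeight_le h
  have hsum : Summable fun n : ℕ => 8 * ((n:ℝ) ^ 2)⁻¹ :=
    (summable_nat_pow_inv.2 one_lt_two).mul_left 8
  refine ⟨fun P => 2 * M * (log P)⁻¹ + ∑' n : ℕ, 8 * (((n + P : ℕ) : ℝ) ^ 2)⁻¹, ?_, ?_⟩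
  · have h1 : Tendsto (fun P : ℕ => 2 * M * (log P)⁻¹) atTop (nhds (2 * M * 0)) :=
      ((tendsto_inv_atTop_zero.comp tendsto_log_atTop).comp
        tendsto_natCast_atTop_atTop).const_mul (2 * M)
    have h2 := h1.add (tendsto_sum_nat_add fun n : ℕ => 8 * ((n:ℝ) ^ 2)⁻¹)
    rwa [mul_zero, add_zero] at h2
  intro P Q hP hPQ s hs
  have e : logProd S δ s Q - logProd S δ s P =
      ∑ n ∈ Finset.Ico P Q, if n.Prime then logFactor S δ n s else 0 := by
    rw [logProd, logProd, Finset.sum_filter, Finset.sum_filter, Finset.sum_Ico_eq_sub _ hPQ]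
  have h1 := abs_sum_biasWeight_mul_rpow_le hM hP hPQ hs
  have h2 : |∑ n ∈ Finset.Ico P Q, ((if n.Prime then logFactor S δ n s else 0) -
      biasWeight S δ n * ((n:ℝ) ^ (1 - s) * (log n)⁻¹))| ≤
      ∑' n : ℕ, 8 * (((n + P : ℕ) : ℝ) ^ 2)⁻¹ := by
    calc _ ≤ ∑ n ∈ Finset.Ico P Q, |(if n.Prime then logFactor S δ n s else 0) -
          biasWeight S δ n * ((n:ℝ) ^ (1 - s) * (log n)⁻¹)| := Finset.abs_sum_le_sum_abs _ _
      _ ≤ ∑ n ∈ Finset.Ico P Q, 8 * ((n:ℝ) ^ 2)⁻¹ := by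
        refine Finset.sum_le_sum fun n _ => ?_
        split_ifs with hp
        · exact abs_logFactor_sub_le h.mult.1 h.density_pos.le h.density_lt.le hp hs
        · simp only [biasWeight, primeWeight, if_neg hp]
          simp
      _ = ∑ n ∈ Finset.range (Q - P), 8 * (((n + P : ℕ) : ℝ) ^ 2)⁻¹ := by
        rw [Finset.sum_Ico_eq_sum_range]
        simp only [add_comm P]
      _ ≤ _ := ((summable_nat_add_iff P).2 hsum).sum_le_tsum _ fun n _ => by positivity
  rw [Finset.sum_sub_distrib] at h2
  rw [e]
  rw [abs_le] at *
  constructor <;> linarith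

lemma continuousOn_localFactor (S : Set ℕ) {p : ℕ} (hp : p.Prime) :
    ContinuousOn (localFactor S p) (Set.Ici 1) := by
  have hp0 : (0:ℝ) < p := by exact_mod_cast hp.pos
  refine continuousOn_tsum (u := fun e : ℕ => (1 / 2 : ℝ) ^ e) (fun e => ?_)
    (summable_geometric_of_lt_one (by norm_num) (by norm_num)) fun e s hs => ?_
  · exact (continuous_const.mul
      (((continuous_const_rpow hp0.ne').comp continuous_neg).pow e)).continuousOn
  · have hx0 := (rpow_neg_pos_of_prime hp s).le
    rw [Real.norm_eq_abs, abs_of_nonneg (mul_nonneg (chiS_nonneg _ _) (by positivity))]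
    exact (mul_le_of_le_one_left (by positivity) (chiS_le_one _ _)).trans
      (pow_le_pow_left₀ hx0 (rpow_neg_le_half hp hs) e)

lemma tendsto_logProd_nhdsGT {S : Set ℕ} (hS : 1 ∈ S) (δ : ℝ) (P : ℕ) :
    Tendsto (fun s => logProd S δ s P) (nhdsWithin 1 (Set.Ioi 1)) (nhds (logProd S δ 1 P)) := by
  refine tendsto_finsetSum _ fun p hp => ?_
  have hp := (Finset.mem_filter.1 hp).2
  have hp0 : (0:ℝ) < p := by exact_mod_cast hp.pos
  have h1 : Tendsto (localFactor S p) (nhdsWithin 1 (Set.Ioi 1)) (nhds (localFactor S p 1)) :=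
    (continuousOn_localFactor S hp 1 Set.self_mem_Ici).mono_left
      (nhdsWithin_mono _ Set.Ioi_subset_Ici_self)
  have h2 : Tendsto (fun s : ℝ => 1 - (p:ℝ) ^ (-s)) (nhdsWithin 1 (Set.Ioi 1))
      (nhds (1 - (p:ℝ) ^ (-(1:ℝ)))) :=
    ((continuous_const.sub ((continuous_const_rpow hp0.ne').comp continuous_neg)).tendsto 1).mono_left
      nhdsWithin_le_nhds
  have h3 := one_le_localFactor hS hp le_rfl
  have h4 := rpow_neg_le_half hp le_rfl
  exact (h1.log (by linarith)).add ((h2.log (by linarith)).const_mul δ)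

lemma wirsingProd_eq_exp {S : Set ℕ} (hS : 1 ∈ S) (δ : ℝ) (P : ℕ) :
    wirsingProd S δ P = exp (logProd S δ 1 P) := by
  rw [wirsingProd, logProd, exp_sum]
  refine Finset.prod_congr rfl fun p hp => ?_
  have hp := (Finset.mem_filter.1 hp).2
  have h3 := one_le_localFactor hS hp le_rfl
  have h4 := rpow_neg_le_half hp le_rfl
  rw [logFactor, exp_add, exp_log (by linarith), mul_comm δ, ← rpow_def_of_pos (by linarith),
    localFactor, rpow_neg_one, one_div]
  simp only [inv_pow, div_eq_mul_inv]

lemma tendsto_prod_localFactor {S : Set ℕ} (hS : IsMultiplicativeSet S) {s : ℝ} (hs : 1 < s) :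
    Tendsto (fun P : ℕ => ∏ p ∈ Finset.filter Nat.Prime (Finset.range P), localFactor S p s)
      atTop (nhds (LSeries' S s)) := by
  have hsum := (hasSum_LSeries' S hs).summable
  have hn : ∀ n : ℕ, 0 ≤ (if n ∈ S then (n : ℝ) ^ (-s) else 0) := fun n => by
    split_ifs <;> positivity
  have h0 : (if 0 ∈ S then ((0:ℕ) : ℝ) ^ (-s) else 0) = 0 := by
    rw [Nat.cast_zero, zero_rpow (by linarith), ite_self]
  have h := EulerProduct.eulerProduct (f := fun n : ℕ => if n ∈ S then (n : ℝ) ^ (-s) else 0)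
    (by simp [hS.1]) ?_ (hsum.congr fun n => (Real.norm_of_nonneg (hn n)).symm) h0
  · refine h.congr fun P => Finset.prod_congr rfl fun p _ => ?_
    rw [localFactor]
    refine tsum_congr fun e => ?_
    rw [chiS, ← rpow_natCast, ← rpow_mul p.cast_nonneg, Nat.cast_pow, ← rpow_natCast,
      ← rpow_mul p.cast_nonneg, mul_comm (-s)]
    split_ifs <;> simp
  · intro m n hmn
    rcases Nat.eq_zero_or_pos m with rfl | hm
    · simp only [zero_mul, h0]
    rcases Nat.eq_zero_or_pos n with rfl | hn
    · simp only [mul_zero, h0]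
    have := hS.2 m n hm hn hmn
    by_cases h1 : m ∈ S <;> by_cases h2 : n ∈ S <;>
      simp [this, h1, h2, mul_rpow m.cast_nonneg n.cast_nonneg]

lemma one_le_LSeries' {S : Set ℕ} (hS : 1 ∈ S) {s : ℝ} (hs : 1 < s) : 1 ≤ LSeries' S s := by
  have h := (hasSum_LSeries' S hs).summable.le_tsum 1 fun n _ => by split_ifs <;> positivity
  simpa [hS, LSeries'] using h

lemma localFactor_univ {p : ℕ} (hp : p.Prime) {s : ℝ} (hs : 1 ≤ s) :
    localFactor Set.univ p s = (1 - (p:ℝ) ^ (-s))⁻¹ := by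
  have := rpow_neg_le_half hp hs
  simp only [localFactor, chiS, Set.mem_univ, if_true, one_mul]
  exact tsum_geometric_of_lt_one (rpow_neg_pos_of_prime hp s).le (by linarith)

lemma tendsto_logProd_atTop {S : Set ℕ} (hS : IsMultiplicativeSet S) (δ : ℝ) {s : ℝ}
    (hs : 1 < s) : Tendsto (logProd S δ s) atTop
      (nhds (log (LSeries' S s) - δ * log (LSeries' Set.univ s))) := by
  have huniv : IsMultiplicativeSet Set.univ := ⟨trivial, fun _ _ _ _ _ => by simp⟩
  have h1 := (tendsto_prod_localFactor hS hs).log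
    (by linarith [one_le_LSeries' hS.1 hs])
  have h2 := (tendsto_prod_localFactor huniv hs).log
    (by linarith [one_le_LSeries' huniv.1 hs])
  refine (h1.sub (h2.const_mul δ)).congr fun P => ?_
  rw [log_prod, log_prod, Finset.mul_sum, ← Finset.sum_sub_distrib, logProd]
  · refine Finset.sum_congr rfl fun p hp => ?_
    have hp := (Finset.mem_filter.1 hp).2
    rw [logFactor, localFactor_univ hp hs.le, log_inv]
    ring
  · intro p hp
    linarith [one_le_localFactor huniv.1 (Finset.mem_filter.1 hp).2 hs.le]
  · intro p hp
    linarith [one_le_localFactor hS.1 (Finset.mem_filter.1 hp).2 hs.le]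

lemma tendsto_sub_one_mul_LSeries'_univ :
    Tendsto (fun s => (s - 1) * LSeries' Set.univ s) (nhdsWithin 1 (Set.Ioi 1)) (nhds 1) := by
  refine tendsto_sub_mul_tsum_nat_rpow.congr fun s => ?_
  simp only [LSeries', Set.mem_univ, if_true]
  congr 2
  ext n
  rw [rpow_neg n.cast_nonneg, one_div]

lemma tendsto_log_LSeries'_sub {S : Set ℕ} (hS : 1 ∈ S) {δ A : ℝ} (hA : 0 < A)
    (h : Tendsto (fun s => (s - 1) ^ δ * LSeries' S s) (nhdsWithin 1 (Set.Ioi 1)) (nhds A)) :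
    Tendsto (fun s => log (LSeries' S s) - δ * log (LSeries' Set.univ s))
      (nhdsWithin 1 (Set.Ioi 1)) (nhds (log A)) := by
  have h1 := (h.log hA.ne').sub ((tendsto_sub_one_mul_LSeries'_univ.log one_ne_zero).const_mul δ)
  rw [log_one, mul_zero, sub_zero] at h1
  refine h1.congr' ?_
  filter_upwards [self_mem_nhdsWithin] with s hs
  have hs : 1 < s := hs
  have hε : 0 < s - 1 := sub_pos.2 hs
  have h2 := one_le_LSeries' hS hs
  have h3 := one_le_LSeries' (Set.mem_univ 1) hs
  rw [log_mul (rpow_pos_of_pos hε _).ne' (by linarith), log_mul hε.ne' (by linarith),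
    log_rpow hε]
  ring

lemma tendsto_wirsingProd {S : Set ℕ} {δ ρ A : ℝ} (h : IsPrimeRegular S δ ρ) (hA : 0 < A)
    (hL : Tendsto (fun s => (s - 1) ^ δ * LSeries' S s) (nhdsWithin 1 (Set.Ioi 1)) (nhds A)) :
    Tendsto (wirsingProd S δ) atTop (nhds A) := by
  obtain ⟨E, hE, hb⟩ := exists_abs_logProd_sub_le h
  have h1 : ∀ P : ℕ, 2 ≤ P → |log A - logProd S δ 1 P| ≤ E P := by
    intro P hP
    refine le_of_tendsto ((tendsto_log_LSeries'_sub h.mult.1 hA hL).sub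
      (tendsto_logProd_nhdsGT h.mult.1 δ P)).abs ?_
    filter_upwards [self_mem_nhdsWithin] with s hs
    refine le_of_tendsto ((tendsto_logProd_atTop h.mult δ hs).sub_const _).abs ?_
    filter_upwards [eventually_ge_atTop P] with Q hQ
    exact hb P Q hP hQ s (le_of_lt hs)
  have h2 : Tendsto (fun P => log A - logProd S δ 1 P) atTop (nhds 0) :=
    squeeze_zero_norm' ((eventually_ge_atTop 2).mono h1) hE
  have h3 := ((tendsto_const_nhds (x := log A)).sub h2).rexp
  rw [sub_zero, exp_log hA] at h3
  refine h3.congr fun P => ?_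
  rw [wirsingProd_eq_exp h.mult.1, sub_sub_cancel]

lemma isPrimeRegular_of_conditionB {S : Set ℕ} {δ ρ : ℝ} (hδ0 : 0 < δ) (hδ1 : δ < 1)
    (hρ : 0 < ρ) (hS : IsMultiplicativeSet S) (hB : ConditionB S δ ρ) :
    IsPrimeRegular S δ (min ρ 1) := by
  refine ⟨hS, hδ0, hδ1, lt_min hρ one_pos, min_le_right _ _, ?_⟩
  obtain ⟨C, hC0, hC⟩ := abs_logSum_primeWeight_sub_le hρ hB
  refine ⟨C, hC0, fun u hu => (hC u hu).trans ?_⟩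
  have h1 : (1 + u) ^ (-(1 + ρ)) ≤ (1 + u) ^ (-(1 + min ρ 1)) :=
    rpow_le_rpow_of_exponent_le (by linarith) (by linarith [min_le_left ρ 1])
  gcongr

/-- If the multiplicative set `S` satisfies Condition B with density `δ ∈ (0,1)` and
exponent `ρ > 0`, then the Euler–Kronecker constant `γ_S` exists, the Wirsing constant
`C₀(S)` exists and is positive, and
`S(x) = C₀(S) x (log x)^{δ-1} (1 + (1+o(1)) C₁(S)/log x)` with `C₁(S) = (1-δ)(1-γ_S)`,
i.e. `(S(x)/(C₀(S) x (log x)^{δ-1}) - 1) log x → (1-δ)(1-γ_S)` as `x → ∞`. -/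
theorem second_order_asymptotic (S : Set ℕ) (δ ρ : ℝ) (hδ0 : 0 < δ) (hδ1 : δ < 1)
    (hρ : 0 < ρ) (hS : IsMultiplicativeSet S) (hB : ConditionB S δ ρ) :
    ∃ γS C₀ : ℝ, IsEulerKronecker S δ γS ∧ 0 < C₀ ∧
      Tendsto (wirsingProd S δ) atTop (nhds (Real.Gamma δ * C₀)) ∧
      Tendsto (fun x : ℝ =>
          ((setCount S x : ℝ) / (C₀ * x * Real.log x ^ (δ - 1)) - 1) * Real.log x)
        atTop (nhds ((1 - δ) * (1 - γS))) := by
  have h := isPrimeRegular_of_conditionB hδ0 hδ1 hρ hS hB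
  obtain ⟨C₀, hC0, hC, hI⟩ := exists_tendsto_dens h
  obtain ⟨K, hK⟩ := exists_tendsto_mul_dens_sub h
  refine ⟨1 - K / C₀, C₀, isEulerKronecker_of_tendsto hδ0 hδ1 hC0 hC hK, hC0,
    tendsto_wirsingProd h (mul_pos (Gamma_pos_of_pos hδ0) hC0)
      (tendsto_rpow_mul_LSeries' hδ0 hδ1 hC), ?_⟩
  rw [sub_sub_cancel]
  exact tendsto_setCount_second_order (tendsto_dens_second_order hδ0.ne' hC0.ne' hI hK)
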